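/- For every d ∈ ℕ there exist constants C > 0 and ε > 0 such that the following holds for every collection of at most d points pᵢ ∈ S² and radii rᵢ ∈ (0,π/2). Let M_{pᵢ,rᵢ} : S² → S² be the Möbius transformation given by the dilation centred at pᵢ that maps B_{rᵢ}(pᵢ) onto a hemisphere, let ρ_{pᵢ,rᵢ} = (1/√2)|∇M_{pᵢ,rᵢ}| be its conformal factor, and let g := g_{S²} + ∑ᵢ M_{pᵢ,rᵢ}^* g_{S²} = (1+∑ᵢ ρ_{pᵢ,rᵢ}²)·g_{S²}. Then every smooth map u : S² → S² with |deg(u)| ≤ d for which δ_u · ∏ᵢ(1+|log rᵢ|) ≤ ε satisfies the Łojasiewicz estimate δ_u ≤ C·(1+maxᵢ |log rᵢ|)·‖τ_g(u)‖²_{L²(S²,g)}. -/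

import Mathlib

open MeasureTheory Metric Real Set Filter
open scoped RealInnerProductSpace

noncomputable section

abbrev E3 : Type := EuclideanSpace ℝ (Fin 3)

/-- The unit sphere `S² ⊂ ℝ³`. -/
def S2 : Set E3 := Metric.sphere (0 : E3) 1

/-- Surface measure on `S²`: 2-dimensional Hausdorff measure restricted to the sphere. -/
def sphVol : Measure E3 := (μH[2] : Measure E3).restrict S2

/-- The 0-homogeneous extension of a map defined on the sphere. -/
def homExt (u : E3 → E3) : E3 → E3 := fun y => u (‖y‖⁻¹ • y)

def e3 (i : Fin 3) : E3 := EuclideanSpace.single i (1 : ℝ)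

/-- Energy density `|∇u|²` of `u|_{S²}` at `x ∈ S²` (squared Hilbert-Schmidt norm of the
differential, computed via the 0-homogeneous extension). -/
def enDensity (u : E3 → E3) (x : E3) : ℝ :=
  ∑ i, ‖fderiv ℝ (homExt u) x (e3 i)‖ ^ 2

/-- Dirichlet energy `E(u,Ω) = (1/2)∫_Ω |∇u|²`. -/
def energyOn (u : E3 → E3) (Ω : Set E3) : ℝ :=
  (1 / 2) * ∫ x in Ω, enDensity u x ∂sphVol

def energy (u : E3 → E3) : ℝ := energyOn u S2

def det3 (a b c : E3) : ℝ :=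
  a 0 * (b 1 * c 2 - b 2 * c 1) - a 1 * (b 0 * c 2 - b 2 * c 0)
    + a 2 * (b 0 * c 1 - b 1 * c 0)

/-- The signed Jacobian of a sphere map. -/
def jacobian (u : E3 → E3) (x : E3) : ℝ :=
  (1 / 2) * ∑ i, ∑ j, det3 x (e3 i) (e3 j) *
      det3 (u x) (fderiv ℝ (homExt u) x (e3 i)) (fderiv ℝ (homExt u) x (e3 j))

/-- The (Brouwer) degree, `deg u = (1/4π) ∫ Jac(u)`. -/
def sphDeg (u : E3 → E3) : ℝ := (4 * π)⁻¹ * ∫ x, jacobian u x ∂sphVol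

/-- The energy defect `δ_u = E(u) - 4π|deg u|`. -/
def defect (u : E3 → E3) : ℝ := energy u - 4 * π * |sphDeg u|

def IsSphereMap (u : E3 → E3) : Prop :=
  ContDiff ℝ (⊤ : ℕ∞) u ∧ ∀ x ∈ S2, u x ∈ S2

/-- Laplace-Beltrami operator of the round sphere applied to `u`. -/
def sphLap (u : E3 → E3) (x : E3) : E3 :=
  ∑ i, fderiv ℝ (fun y => fderiv ℝ (homExt u) y (e3 i)) x (e3 i)

/-- Tension field `τ(u) = Δu + |∇u|² u`. -/
def tension (u : E3 → E3) (x : E3) : E3 :=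
  sphLap u x + enDensity u x • u x

/-- Harmonic (= rational, up to orientation) maps of the round sphere. -/
def IsHarmonicSphereMap (u : E3 → E3) : Prop :=
  IsSphereMap u ∧ ∀ x ∈ S2, tension u x = 0

/-- Geodesic distance on `S²`. -/
def gdist (x y : E3) : ℝ := Real.arccos ⟪x, y⟫

/-- Geodesic ball in `S²`. -/
def gBall (x : E3) (r : ℝ) : Set E3 := {y ∈ S2 | gdist x y < r}

/-- Oscillation of `u` over `U`. -/
def oscOn (u : E3 → E3) (U : Set E3) : ℝ := ⨆ x ∈ U, ⨆ y ∈ U, ‖u x - u y‖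

/-- The Möbius dilation of the sphere with centre `p` and dilation factor `μ`. -/
def mobius (p : E3) (μ : ℝ) (y : E3) : E3 :=
  ((1 + ⟪y, p⟫) + μ ^ 2 * (1 - ⟪y, p⟫))⁻¹ •
    (((1 + ⟪y, p⟫) - μ ^ 2 * (1 - ⟪y, p⟫)) • p + (2 * μ) • (y - ⟪y, p⟫ • p))

/-- The Möbius dilation `M_{p,r}` centred at `p` scaling `B_r(p)` to a hemisphere. -/
def mobiusDil (p : E3) (r : ℝ) : E3 → E3 := mobius p (Real.tan (r / 2))⁻¹

/-- `ρ_{p,r}² = (1/2)|∇M_{p,r}|²`, the conformal factor squared of `M_{p,r}`. -/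
def confSq (p : E3) (r : ℝ) (x : E3) : ℝ := (1 / 2) * enDensity (mobiusDil p r) x

/-- Möbius transformations (conformal diffeomorphisms) of the round sphere:
compositions of an isometry with a Möbius dilation. -/
def IsMobiusTransform (M : E3 → E3) : Prop :=
  ∃ (R : E3 ≃ₗᵢ[ℝ] E3) (p : E3) (μ : ℝ),
    p ∈ S2 ∧ 0 < μ ∧ ∀ x ∈ S2, M x = R (mobius p μ x)

/-- A set obtained from a geodesic ball by removing a finite collection of smaller balls. -/
def IsBallMinusBalls (Ω : Set E3) : Prop :=
  ∃ (c : E3) (R : ℝ) (m : ℕ) (cs : Fin m → E3) (rs : Fin m → ℝ),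
    c ∈ S2 ∧ 0 < R ∧ (∀ j, cs j ∈ S2 ∧ rs j < R) ∧
    Ω = gBall c R \ ⋃ j, gBall (cs j) (rs j)

set_option linter.unusedSimpArgs false
set_option linter.unusedVariables false

/-- the algebra of smooth functions on `ℝ³` -/
def SA : Subalgebra ℝ (E3 → ℝ) where
  carrier := {f | ContDiff ℝ (⊤ : ℕ∞) f}
  mul_mem' := by
    intro f g hf hg
    rw [Set.mem_ofPred_eq] at *
    exact hf.mul hg
  add_mem' := by
    intro f g hf hg
    rw [Set.mem_ofPred_eq] at *
    exact hf.add hg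
  algebraMap_mem' := by
    intro r
    rw [Set.mem_ofPred_eq]
    exact contDiff_const

abbrev SF : Type := ↥SA

def ev (x : E3) : SF →ₐ[ℝ] ℝ := (Pi.evalAlgHom ℝ (fun _ : E3 => ℝ) x).comp SA.val

lemma ev_mk (x : E3) (f : E3 → ℝ) (hf : f ∈ SA) : ev x ⟨f, hf⟩ = f x := rfl
lemma ev_def (x : E3) (f : SF) : ev x f = f.1 x := rfl
lemma SF.smooth (f : SF) : ContDiff ℝ (⊤ : ℕ∞) f.1 := f.2
lemma SF.cont (f : SF) : Continuous f.1 := f.smooth.continuous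
lemma SF.diff (f : SF) : Differentiable ℝ f.1 := f.smooth.differentiable (by simp)
lemma ev_cont (f : SF) : Continuous (fun x => ev x f) := f.cont
lemma SF.ext' {f g : SF} (h : ∀ x, ev x f = ev x g) : f = g := Subtype.ext (funext h)

def crs (a x : E3) : E3 :=
  !₂[a 1 * x 2 - a 2 * x 1, a 2 * x 0 - a 0 * x 2, a 0 * x 1 - a 1 * x 0]

@[simp] lemma crs_0 (a x : E3) : crs a x 0 = a 1 * x 2 - a 2 * x 1 := rfl
@[simp] lemma crs_1 (a x : E3) : crs a x 1 = a 2 * x 0 - a 0 * x 2 := rfl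
@[simp] lemma crs_2 (a x : E3) : crs a x 2 = a 0 * x 1 - a 1 * x 0 := rfl

lemma E3.ext3 {x y : E3} (h0 : x 0 = y 0) (h1 : x 1 = y 1) (h2 : x 2 = y 2) : x = y := by
  ext i; fin_cases i <;> assumption

def crsL (a : E3) : E3 →L[ℝ] E3 :=
  LinearMap.toContinuousLinearMap
    { toFun := crs a
      map_add' := fun x y => by apply E3.ext3 <;> simp <;> ring
      map_smul' := fun c x => by apply E3.ext3 <;> simp <;> ring }

@[simp] lemma crsL_apply (a x : E3) : crsL a x = crs a x := rfl

lemma inner3 (x y : E3) : ⟪x, y⟫ = x 0 * y 0 + x 1 * y 1 + x 2 * y 2 := by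
  rw [PiLp.inner_apply]; simp [Fin.sum_univ_three]; ring

lemma norm3 (x : E3) : ‖x‖ ^ 2 = x 0 ^ 2 + x 1 ^ 2 + x 2 ^ 2 := by
  rw [← real_inner_self_eq_norm_sq, inner3]; ring

lemma mem_S2 {x : E3} : x ∈ S2 ↔ x 0 ^ 2 + x 1 ^ 2 + x 2 ^ 2 = 1 := by
  rw [← norm3, S2, mem_sphere_zero_iff_norm]
  constructor
  · intro h; rw [h]; norm_num
  · intro h; have := norm_nonneg x; nlinarith

/-- the Killing derivative -/
def Xv (a : E3) : Derivation ℝ SF SF := Derivation.mk'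
  { toFun := fun f => ⟨fun x => fderiv ℝ f.1 x (crsL a x), by
      have h : ContDiff ℝ (⊤ : ℕ∞) (fderiv ℝ f.1) := f.smooth.fderiv_right (by simp)
      exact h.clm_apply (crsL a).contDiff⟩
    map_add' := fun f g => by
      apply Subtype.ext; funext x
      change fderiv ℝ (f.1 + g.1) x _ = fderiv ℝ f.1 x _ + fderiv ℝ g.1 x _
      rw [fderiv_add (f.diff x) (g.diff x)]; rfl
    map_smul' := fun c f => by
      apply Subtype.ext; funext x
      change fderiv ℝ (c • f.1) x _ = c • fderiv ℝ f.1 x _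
      rw [fderiv_const_smul (f.diff x)]; rfl }
  (fun f g => by
      apply Subtype.ext; funext x
      change fderiv ℝ (f.1 * g.1) x _ = f.1 x * fderiv ℝ g.1 x _ + g.1 x * fderiv ℝ f.1 x _
      rw [fderiv_mul (f.diff x) (g.diff x)]; rfl)

lemma ev_Xv (a x : E3) (f : SF) : ev x (Xv a f) = fderiv ℝ f.1 x (crs a x) := rfl

lemma Xv_comm (a b : E3) (f : SF) : Xv a (Xv b f) = Xv b (Xv a f) - Xv (crs a b) f := by
  apply SF.ext'; intro x
  rw [map_sub]
  have h2 : ContDiff ℝ (⊤ : ℕ∞) (fderiv ℝ f.1) := f.smooth.fderiv_right (by simp)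
  have key : ∀ a b : E3, ev x (Xv a (Xv b f)) =
      fderiv ℝ (fderiv ℝ f.1) x (crs a x) (crs b x) + fderiv ℝ f.1 x (crs b (crs a x)) := by
    intro a b
    rw [ev_Xv]
    change fderiv ℝ (fun x => fderiv ℝ f.1 x (crsL b x)) x _ = _
    rw [fderiv_clm_apply (h2.differentiable (by simp) x) (crsL b).differentiableAt]
    simp [add_comm]
  have sym : fderiv ℝ (fderiv ℝ f.1) x (crs a x) (crs b x)
      = fderiv ℝ (fderiv ℝ f.1) x (crs b x) (crs a x) := by
    have : ContDiffAt ℝ 2 f.1 x := (f.smooth.of_le (WithTop.coe_le_coe.2 (le_top : (2 : ℕ∞) ≤ ⊤))).contDiffAt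
    exact (this.isSymmSndFDerivAt (by simp)).eq _ _
  rw [key, key, sym, ev_Xv]
  have : crs b (crs a x) = crs a (crs b x) - crs (crs a b) x := by
    apply E3.ext3 <;> simp <;> ring
  rw [this, map_sub]; ring

def X (i : Fin 3) : Derivation ℝ SF SF := Xv (e3 i)

lemma E3.eq_sum (a : E3) : a = a 0 • e3 0 + a 1 • e3 1 + a 2 • e3 2 := by
  apply E3.ext3 <;> simp [e3]

lemma ev_Xv_eq (a x : E3) (f : SF) :
    ev x (Xv a f) = a 0 * ev x (X 0 f) + a 1 * ev x (X 1 f) + a 2 * ev x (X 2 f) := by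
  simp only [X, ev_Xv]
  have : crs a x = a 0 • crs (e3 0) x + a 1 • crs (e3 1) x + a 2 • crs (e3 2) x := by
    apply E3.ext3 <;> simp [e3] <;> ring
  rw [this]; simp only [map_add, map_smul, smul_eq_mul]

lemma Xv_eq (a : E3) (f : SF) : Xv a f = a 0 • X 0 f + a 1 • X 1 f + a 2 • X 2 f := by
  apply SF.ext'; intro x; rw [ev_Xv_eq]; simp

lemma X10 (f : SF) : X 1 (X 0 f) = X 0 (X 1 f) + X 2 f := by
  simp only [X]; rw [Xv_comm, Xv_eq (crs _ _)]; simp [e3]; try rfl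
lemma X20 (f : SF) : X 2 (X 0 f) = X 0 (X 2 f) - X 1 f := by
  simp only [X]; rw [Xv_comm, Xv_eq (crs _ _)]; simp [e3]; try rfl
lemma X21 (f : SF) : X 2 (X 1 f) = X 1 (X 2 f) + X 0 f := by
  simp only [X]; rw [Xv_comm, Xv_eq (crs _ _)]; simp [e3]; try rfl

/-- coordinate functions -/
def co (i : Fin 3) : SF := ⟨fun x => x i, by
  change ContDiff ℝ (⊤ : ℕ∞) _
  fun_prop⟩

@[simp] lemma ev_co (x : E3) (i : Fin 3) : ev x (co i) = x i := rfl

lemma fderiv_co (x v : E3) (i : Fin 3) : fderiv ℝ (co i).1 x v = v i := by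
  have : (co i).1 = (EuclideanSpace.proj i : E3 →L[ℝ] ℝ) := rfl
  rw [this, ContinuousLinearMap.fderiv]; rfl

lemma X_co (i j : Fin 3) (x : E3) : ev x (X i (co j)) = crs (e3 i) x j := by
  rw [X, ev_Xv, fderiv_co]

@[simp] lemma X00 : X 0 (co 0) = 0 := by apply SF.ext'; intro x; rw [X_co]; simp [e3]
@[simp] lemma X01 : X 0 (co 1) = - co 2 := by apply SF.ext'; intro x; rw [X_co]; simp [e3]
@[simp] lemma X02 : X 0 (co 2) = co 1 := by apply SF.ext'; intro x; rw [X_co]; simp [e3]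
@[simp] lemma X10c : X 1 (co 0) = co 2 := by apply SF.ext'; intro x; rw [X_co]; simp [e3]
@[simp] lemma X11 : X 1 (co 1) = 0 := by apply SF.ext'; intro x; rw [X_co]; simp [e3]
@[simp] lemma X12 : X 1 (co 2) = - co 0 := by apply SF.ext'; intro x; rw [X_co]; simp [e3]
@[simp] lemma X20c : X 2 (co 0) = - co 1 := by apply SF.ext'; intro x; rw [X_co]; simp [e3]
@[simp] lemma X21c : X 2 (co 1) = co 0 := by apply SF.ext'; intro x; rw [X_co]; simp [e3]
@[simp] lemma X22 : X 2 (co 2) = 0 := by apply SF.ext'; intro x; rw [X_co]; simp [e3]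

lemma x_dot_X (f : SF) : co 0 * X 0 f + co 1 * X 1 f + co 2 * X 2 f = 0 := by
  apply SF.ext'; intro x
  have h := ev_Xv_eq x x f
  have : crs x x = 0 := by apply E3.ext3 <;> simp <;> ring
  rw [ev_Xv, this, map_zero] at h
  simp [← h]

lemma S2_compact : IsCompact S2 := isCompact_sphere _ _
lemma S2_meas : MeasurableSet S2 := S2_compact.measurableSet

lemma polar_exists (a b : ℝ) : ∃ φ ∈ Set.Icc (-π) π, ∃ R : ℝ, R ^ 2 = a ^ 2 + b ^ 2 ∧ 0 ≤ R ∧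
    a = R * cos φ ∧ b = R * sin φ := by
  refine ⟨Complex.arg ⟨a, b⟩, ⟨(Complex.neg_pi_lt_arg _).le, Complex.arg_le_pi _⟩,
    ‖(⟨a, b⟩ : ℂ)‖, ?_, norm_nonneg _, ?_, ?_⟩
  · rw [Complex.sq_norm, Complex.normSq_mk]; ring
  · exact (Complex.norm_mul_cos_arg ⟨a, b⟩).symm
  · exact (Complex.norm_mul_sin_arg ⟨a, b⟩).symm

def sphPar (q : ℝ × ℝ) : E3 := !₂[sin q.1 * cos q.2, sin q.1 * sin q.2, cos q.1]

lemma sphPar_contDiff : ContDiff ℝ 1 sphPar := by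
  unfold sphPar
  rw [contDiff_euclidean]
  intro i
  fin_cases i <;> simp <;> fun_prop

lemma S2_subset : S2 ⊆ sphPar '' (Set.Icc 0 π ×ˢ Set.Icc (-π) π) := by
  intro x hx
  rw [mem_S2] at hx
  obtain ⟨φ, hφ, R, hR, hR0, h0, h1⟩ := polar_exists (x 0) (x 1)
  refine ⟨(Real.arccos (x 2), φ), ⟨⟨Real.arccos_nonneg _, Real.arccos_le_pi _⟩, hφ⟩, ?_⟩
  have hs : sin (arccos (x 2)) = R := by
    rw [Real.sin_arccos, show 1 - x 2 ^ 2 = R ^ 2 by rw [hR]; linarith, Real.sqrt_sq hR0]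
  apply E3.ext3
  · simp [sphPar, hs, h0]
  · simp [sphPar, hs, h1]
  · simp [sphPar]
    exact Real.cos_arccos (by nlinarith [sq_nonneg (x 0), sq_nonneg (x 1)])
      (by nlinarith [sq_nonneg (x 0), sq_nonneg (x 1)])

lemma hausdorff_S2_lt_top : (μH[2] : Measure E3) S2 < ⊤ := by
  have hK : IsCompact (Set.Icc (0 : ℝ) π ×ˢ Set.Icc (-π) π) := isCompact_Icc.prod isCompact_Icc
  obtain ⟨K, hK'⟩ := (sphPar_contDiff.locallyLipschitz.locallyLipschitzOn
    (s := Set.Icc (0 : ℝ) π ×ˢ Set.Icc (-π) π)).exists_lipschitzOnWith_of_compact hK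
  have h1 := hK'.hausdorffMeasure_image_le (d := 2) (by norm_num)
  refine lt_of_le_of_lt (measure_mono S2_subset) (lt_of_le_of_lt h1 ?_)
  rw [hausdorffMeasure_prod_real]
  exact ENNReal.mul_lt_top (by simp) hK.measure_lt_top

instance : IsFiniteMeasure sphVol := ⟨by
  rw [sphVol, Measure.restrict_apply_univ]; exact hausdorff_S2_lt_top⟩

lemma sphVol_restrict : sphVol.restrict S2 = sphVol := by
  rw [sphVol, Measure.restrict_restrict S2_meas, Set.inter_self]

lemma ae_S2 : ∀ᵐ x ∂sphVol, x ∈ S2 := ae_restrict_mem S2_meas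

lemma integ {f : E3 → ℝ} (hf : ContinuousOn f S2) : Integrable f sphVol := by
  rw [← sphVol_restrict]; exact hf.integrableOn_compact S2_compact

/-- integration over the sphere -/
def J (f : E3 → ℝ) : ℝ := ∫ x, f x ∂sphVol

lemma J_congr {f g : E3 → ℝ} (h : ∀ x ∈ S2, f x = g x) : J f = J g :=
  integral_congr_ae (ae_S2.mono h)

lemma J_mono {f g : E3 → ℝ} (hf : ContinuousOn f S2) (hg : ContinuousOn g S2)
    (h : ∀ x ∈ S2, f x ≤ g x) : J f ≤ J g :=
  integral_mono_ae (integ hf) (integ hg) (ae_S2.mono h)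

lemma J_nonneg {f : E3 → ℝ} (h : ∀ x ∈ S2, 0 ≤ f x) : 0 ≤ J f :=
  integral_nonneg_of_ae (ae_S2.mono h)

lemma J_add {f g : E3 → ℝ} (hf : ContinuousOn f S2) (hg : ContinuousOn g S2) :
    J (fun x => f x + g x) = J f + J g := integral_add (integ hf) (integ hg)

lemma J_sub {f g : E3 → ℝ} (hf : ContinuousOn f S2) (hg : ContinuousOn g S2) :
    J (fun x => f x - g x) = J f - J g := integral_sub (integ hf) (integ hg)

lemma J_mul (c : ℝ) (f : E3 → ℝ) : J (fun x => c * f x) = c * J f := integral_const_mul _ _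

/-- integration of smooth functions as a linear functional -/
def I : SF →ₗ[ℝ] ℝ where
  toFun f := J f.1
  map_add' f g := J_add f.cont.continuousOn g.cont.continuousOn
  map_smul' c f := J_mul c f.1

lemma I_def (f : SF) : I f = J (fun x => ev x f) := rfl

lemma I_congr {f g : SF} (h : ∀ x ∈ S2, ev x f = ev x g) : I f = I g := J_congr h
lemma I_mono {f g : SF} (h : ∀ x ∈ S2, ev x f ≤ ev x g) : I f ≤ I g :=
  J_mono f.cont.continuousOn g.cont.continuousOn h
lemma I_nonneg {f : SF} (h : ∀ x ∈ S2, 0 ≤ ev x f) : 0 ≤ I f := J_nonneg h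

lemma fub {Φ : ℝ → E3 → ℝ} (h : Continuous (Function.uncurry Φ)) (a b : ℝ) :
    J (fun x => ∫ t in a..b, Φ t x) = ∫ t in a..b, J (Φ t) := by
  have main : ∀ a b : ℝ, a ≤ b → J (fun x => ∫ t in a..b, Φ t x) = ∫ t in a..b, J (Φ t) := by
    intro a b hab
    simp only [intervalIntegral.integral_of_le hab, J, ← integral_Icc_eq_integral_Ioc]
    apply integral_integral_swap
    have h1 : Integrable (Function.uncurry Φ) ((volume.restrict (Set.Icc a b)).prod sphVol) := by
      rw [← sphVol_restrict, Measure.prod_restrict]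
      exact h.continuousOn.integrableOn_compact (isCompact_Icc.prod S2_compact)
    exact h1.swap
  rcases le_total a b with hab | hab
  · exact main a b hab
  · have := main b a hab
    simp only [intervalIntegral.integral_symm b a]
    rw [← this]
    simp only [J, integral_neg]

/-! rotations -/

def rot (p : E3) (τ : ℝ) (x : E3) : E3 :=
  cos τ • x + sin τ • crs p x + ((1 - cos τ) * ⟪p, x⟫) • p

lemma rot_zero (p x : E3) : rot p 0 x = x := by simp [rot]

def rotL (p : E3) (τ : ℝ) : E3 →ₗ[ℝ] E3 where
  toFun := rot p τ
  map_add' x y := by apply E3.ext3 <;> simp [rot, inner3] <;> ring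
  map_smul' c x := by apply E3.ext3 <;> simp [rot, inner3] <;> ring

lemma rot_norm {p : E3} (hp : p ∈ S2) (τ : ℝ) (x : E3) : ‖rot p τ x‖ = ‖x‖ := by
  have h : ‖rot p τ x‖ ^ 2 = ‖x‖ ^ 2 := by
    rw [mem_S2] at hp
    have h0 : p 0 ^ 2 = 1 - p 1 ^ 2 - p 2 ^ 2 := by linarith
    have hs : sin τ ^ 2 = 1 - cos τ ^ 2 := by rw [← Real.sin_sq_add_cos_sq τ]; ring
    rw [norm3, norm3]
    simp [rot, inner3]
    ring_nf
    simp only [hs, h0, show p 0 ^ 4 = (p 0 ^ 2) ^ 2 by ring, show p 0 ^ 3 = p 0 * p 0 ^ 2 by ring]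
    ring
  have := norm_nonneg x
  have := norm_nonneg (rot p τ x)
  exact (sq_eq_sq₀ this (norm_nonneg x)).1 h

lemma rot_mem {p x : E3} (hp : p ∈ S2) (τ : ℝ) : rot p τ x ∈ S2 ↔ x ∈ S2 := by
  simp [S2, rot_norm hp]

lemma rot_contDiff (p : E3) : ContDiff ℝ (⊤ : ℕ∞) (fun q : ℝ × E3 => rot p q.1 q.2) := by
  unfold rot
  have h1 : ContDiff ℝ (⊤ : ℕ∞) (fun q : ℝ × E3 => crsL p q.2) := by fun_prop
  have h2 : ContDiff ℝ (⊤ : ℕ∞) (fun q : ℝ × E3 => ⟪p, q.2⟫) := contDiff_const.inner ℝ contDiff_snd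
  simp only [crsL_apply] at h1
  fun_prop

lemma rot_cont (p : E3) (t : ℝ) : Continuous (rot p t) := by
  have h1 : Continuous (fun x : E3 => crs p x) := (crsL p).continuous
  have h2 : Continuous (fun x : E3 => ⟪p, x⟫) := continuous_const.inner continuous_id
  unfold rot
  fun_prop

lemma J_rot {p : E3} (hp : p ∈ S2) (τ : ℝ) (F : E3 → ℝ) :
    J (fun x => F (rot p τ x)) = J F := by
  let li : E3 →ₗᵢ[ℝ] E3 := ⟨rotL p τ, rot_norm hp τ⟩
  let e : E3 ≃ₗᵢ[ℝ] E3 := li.toLinearIsometryEquiv rfl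
  have he : ∀ x, e x = rot p τ x := fun x => rfl
  have h1 := e.toIsometryEquiv.measurePreserving_hausdorffMeasure 2
  have h2 := h1.restrict_preimage S2_meas
  have h3 : e.toIsometryEquiv ⁻¹' S2 = S2 := by
    ext x; exact rot_mem hp τ
  rw [h3] at h2
  exact h2.integral_comp e.toIsometryEquiv.toHomeomorph.measurableEmbedding F

lemma rot_hasDerivAt {p : E3} (hp : p ∈ S2) (τ : ℝ) (x : E3) :
    HasDerivAt (fun s => rot p s x) (crs p (rot p τ x)) τ := by
  have h : HasDerivAt (fun s => rot p s x)
      (-sin τ • x + cos τ • crs p x + ((-(-sin τ)) * ⟪p, x⟫) • p) τ := by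
    unfold rot
    exact (((Real.hasDerivAt_cos τ).smul_const x).add ((Real.hasDerivAt_sin τ).smul_const _)).add
      ((((Real.hasDerivAt_cos τ).const_sub 1).mul_const _).smul_const p)
  convert h using 1
  rw [mem_S2] at hp
  apply E3.ext3 <;> simp [rot, inner3]
  · linear_combination (-sin τ * x 0) * hp
  · linear_combination (-sin τ * x 1) * hp
  · linear_combination (-sin τ * x 2) * hp

lemma ev_rot_hasDerivAt {p : E3} (hp : p ∈ S2) (τ : ℝ) (x : E3) (f : SF) :
    HasDerivAt (fun s => ev (rot p s x) f) (ev (rot p τ x) (Xv p f)) τ := by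
  rw [ev_Xv]
  exact (f.diff _).hasFDerivAt.comp_hasDerivAt τ (rot_hasDerivAt hp τ x)

attribute [irreducible] rot

lemma I_Xv {p : E3} (hp : p ∈ S2) (f : SF) : I (Xv p f) = 0 := by
  have hc : Continuous (Function.uncurry (fun (t : ℝ) (x : E3) => ev (rot p t x) (Xv p f))) :=
    (ev_cont (Xv p f)).comp (rot_contDiff p).continuous
  have h1 := fub hc 0 1
  have h2 : ∀ x, ∫ t in (0:ℝ)..1, ev (rot p t x) (Xv p f) = ev (rot p 1 x) f - ev (rot p 0 x) f := by
    intro x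
    apply intervalIntegral.integral_eq_sub_of_hasDerivAt (f := fun t => ev (rot p t x) f)
    · intro t _; exact ev_rot_hasDerivAt hp t x f
    · apply Continuous.intervalIntegrable
      exact hc.comp (by fun_prop : Continuous (fun t : ℝ => (t, x)))
  simp only [h2] at h1
  have hcr : ∀ t, Continuous (fun x => ev (rot p t x) f) := by
    intro t
    exact f.cont.comp (rot_cont p t)
  rw [J_sub (hcr 1).continuousOn (hcr 0).continuousOn,
    J_rot hp 1 (fun x => ev x f), J_rot hp 0 (fun x => ev x f)] at h1
  have h3 : ∀ t : ℝ, J (fun x => ev (rot p t x) (Xv p f)) = I (Xv p f) := fun t =>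
    J_rot hp t (fun x => ev x (Xv p f))
  simp only [h3] at h1
  simpa using h1.symm

lemma e3_mem (i : Fin 3) : e3 i ∈ S2 := by simp [S2, e3]

@[simp] lemma I_X (i : Fin 3) (f : SF) : I (X i f) = 0 := I_Xv (e3_mem i) f

lemma onb_complete {p q : E3} (hp : p ∈ S2) (hq : q ∈ S2) (hpq : ⟪p, q⟫ = 0) (x : E3) :
    x = ⟪p, x⟫ • p + ⟪q, x⟫ • q + ⟪crs p q, x⟫ • crs p q := by
  rw [mem_S2] at hp hq
  rw [inner3] at hpq
  let M : Matrix (Fin 3) (Fin 3) ℝ := !![p 0, p 1, p 2; q 0, q 1, q 2;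
    p 1 * q 2 - p 2 * q 1, p 2 * q 0 - p 0 * q 2, p 0 * q 1 - p 1 * q 0]
  have h1 : M * M.transpose = 1 := by
    ext i j
    fin_cases i <;> fin_cases j <;> simp [M, Matrix.mul_apply, Fin.sum_univ_three]
    · linarith
    · linarith
    · ring
    · linarith
    · linarith
    · ring
    · ring
    · ring
    · linear_combination hp * (q 0 ^ 2 + q 1 ^ 2 + q 2 ^ 2) + hq
        - (p 0 * q 0 + p 1 * q 1 + p 2 * q 2) * hpq
  have h2 : M.transpose * M = 1 := mul_eq_one_comm.1 h1
  have e : ∀ i j, (M.transpose * M) i j = (1 : Matrix (Fin 3) (Fin 3) ℝ) i j := fun i j => by rw [h2]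
  have e00 := e 0 0
  have e01 := e 0 1
  have e02 := e 0 2
  have e11 := e 1 1
  have e12 := e 1 2
  have e22 := e 2 2
  simp [M, Matrix.mul_apply, Fin.sum_univ_three] at e00 e01 e02 e11 e12 e22
  apply E3.ext3 <;> simp [inner3]
  · linear_combination -x 0 * e00 - x 1 * e01 - x 2 * e02
  · linear_combination -x 0 * e01 - x 1 * e11 - x 2 * e12
  · linear_combination -x 0 * e02 - x 1 * e12 - x 2 * e22

def pol (p q : E3) (θ t : ℝ) : E3 := rot p t (cos θ • p + sin θ • q)

lemma rot_def (p : E3) (τ : ℝ) (x : E3) : rot p τ x =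
  cos τ • x + sin τ • crs p x + ((1 - cos τ) * ⟪p, x⟫) • p := by unfold rot; rfl

lemma rot_rot {p : E3} (hp : p ∈ S2) (s t : ℝ) (x : E3) : rot p t (rot p s x) = rot p (t + s) x := by
  rw [mem_S2] at hp
  simp only [rot_def, cos_add, sin_add]
  apply E3.ext3 <;> simp [inner3]
  · linear_combination (cos t * (1 - cos s) * p 0 * 0 + (1 - cos t) * (1 - cos s) * (p 0 * x 0 + p 1 * x 1 + p 2 * x 2) * p 0 - sin t * sin s * x 0) * hp
  · linear_combination ((1 - cos t) * (1 - cos s) * (p 0 * x 0 + p 1 * x 1 + p 2 * x 2) * p 1 - sin t * sin s * x 1) * hp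
  · linear_combination ((1 - cos t) * (1 - cos s) * (p 0 * x 0 + p 1 * x 1 + p 2 * x 2) * p 2 - sin t * sin s * x 2) * hp

lemma pol_eq {p q : E3} (hp : p ∈ S2) (hpq : ⟪p, q⟫ = 0) (θ t : ℝ) :
    pol p q θ t = cos θ • p + sin θ • (cos t • q + sin t • crs p q) := by
  rw [mem_S2] at hp
  rw [inner3] at hpq
  simp only [pol, rot_def]
  apply E3.ext3 <;> simp [inner3]
  · linear_combination (1 - cos t) * cos θ * p 0 * hp + (1 - cos t) * sin θ * p 0 * hpq
  · linear_combination (1 - cos t) * cos θ * p 1 * hp + (1 - cos t) * sin θ * p 1 * hpq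
  · linear_combination (1 - cos t) * cos θ * p 2 * hp + (1 - cos t) * sin θ * p 2 * hpq

lemma pol_mem {p q : E3} (hp : p ∈ S2) (hq : q ∈ S2) (hpq : ⟪p, q⟫ = 0) (θ t : ℝ) :
    pol p q θ t ∈ S2 := by
  rw [pol, rot_mem hp]
  rw [mem_S2] at *
  rw [inner3] at hpq
  simp
  have := sin_sq_add_cos_sq θ
  linear_combination cos θ ^ 2 * hp + sin θ ^ 2 * hq + 2 * sin θ * cos θ * hpq + this

lemma exists_pol {p q : E3} (hp : p ∈ S2) (hq : q ∈ S2) (hpq : ⟪p, q⟫ = 0) {x : E3} (hx : x ∈ S2) :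
    ∃ s, x = rot p s (cos (arccos ⟪p, x⟫) • p + sin (arccos ⟪p, x⟫) • q) := by
  have hc := onb_complete hp hq hpq x
  have hsum : ⟪p, x⟫ ^ 2 + ⟪q, x⟫ ^ 2 + ⟪crs p q, x⟫ ^ 2 = 1 := by
    have h1 : ⟪x, x⟫ = (1 : ℝ) := by
      rw [inner3]; rw [mem_S2] at hx; linarith
    rw [← h1]
    conv_rhs => rw [hc]
    simp only [inner_add_left, inner_smul_left]
    simp
    conv_rhs => rw [← hc]
    simp only [pow_two]
  obtain ⟨s, -, R, hR, hR0, h0, h1⟩ := polar_exists ⟪q, x⟫ ⟪crs p q, x⟫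
  refine ⟨s, ?_⟩
  have := pol_eq hp hpq (arccos ⟪p, x⟫) s
  rw [pol] at this
  rw [this, Real.cos_arccos (by nlinarith [sq_nonneg ⟪q, x⟫, sq_nonneg ⟪crs p q, x⟫])
    (by nlinarith [sq_nonneg ⟪q, x⟫, sq_nonneg ⟪crs p q, x⟫]), Real.sin_arccos,
    show 1 - ⟪p, x⟫ ^ 2 = R ^ 2 by rw [hR]; linarith, Real.sqrt_sq hR0]
  rw [smul_add, smul_smul, smul_smul, ← h0, ← h1, ← add_assoc, ← hc]

lemma rot_cont2 (p : E3) : Continuous (fun q : ℝ × E3 => rot p q.1 q.2) := (rot_contDiff p).continuous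

lemma rot_periodic (p x : E3) : Function.Periodic (fun t => rot p t x) (2 * π) := by
  intro t; simp [rot_def]

/-- zonal averages -/
def zav (p q : E3) (F : E3 → ℝ) (θ : ℝ) : ℝ := ∫ t in (0:ℝ)..(2 * π), F (pol p q θ t)

lemma pol_cont (p q : E3) : Continuous (fun a : ℝ × ℝ => pol p q a.1 a.2) := by
  unfold pol
  exact (rot_cont2 p).comp (by fun_prop :
    Continuous (fun a : ℝ × ℝ => (a.2, cos a.1 • p + sin a.1 • q)))

lemma zav_cont (p q : E3) {F : E3 → ℝ} (hF : Continuous F) : Continuous (zav p q F) := by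
  unfold zav
  exact intervalIntegral.continuous_parametric_intervalIntegral_of_continuous'
    (f := fun θ t => F (pol p q θ t)) (hF.comp (pol_cont p q)) 0 (2 * π)

lemma J_avg {p q : E3} (hp : p ∈ S2) (hq : q ∈ S2) (hpq : ⟪p, q⟫ = 0) {F : E3 → ℝ}
    (hF : Continuous F) : 2 * π * J F = J (fun x => zav p q F (arccos ⟪p, x⟫)) := by
  have h1 := fub (Φ := fun t x => F (rot p t x)) (hF.comp (rot_cont2 p)) 0 (2 * π)
  simp only [J_rot hp] at h1
  rw [intervalIntegral.integral_const] at h1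
  simp only [sub_zero, smul_eq_mul] at h1
  rw [← h1]
  apply J_congr
  intro x hx
  obtain ⟨s, hs⟩ := exists_pol hp hq hpq hx
  unfold zav pol
  set y := cos (arccos ⟪p, x⟫) • p + sin (arccos ⟪p, x⟫) • q with hy
  have h2 : ∀ t, F (rot p t x) = (fun t => F (rot p t y)) (t + s) := by
    intro t
    rw [hs, rot_rot hp]
  simp only [h2]
  rw [intervalIntegral.integral_comp_add_right (fun t => F (rot p t y))]
  have hper : Function.Periodic (fun t => F (rot p t y)) (2 * π) := (rot_periodic p y).comp F
  have := hper.intervalIntegral_add_eq s 0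
  simp only [zero_add] at this
  rw [zero_add, add_comm, this]

/-- linear function `⟨p, x⟩` -/
def zf (p : E3) : SF := p 0 • co 0 + p 1 • co 1 + p 2 • co 2

@[simp] lemma ev_zf (p x : E3) : ev x (zf p) = ⟪p, x⟫ := by
  simp [zf, inner3]

lemma X0_zf (p : E3) : X 0 (zf p) = p 2 • co 1 - p 1 • co 2 := by
  simp only [zf, map_add, Derivation.map_smul]; simp; ring
lemma X1_zf (p : E3) : X 1 (zf p) = p 0 • co 2 - p 2 • co 0 := by
  simp only [zf, map_add, Derivation.map_smul]; simp; ring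
lemma X2_zf (p : E3) : X 2 (zf p) = p 1 • co 0 - p 0 • co 1 := by
  simp only [zf, map_add, Derivation.map_smul]; simp; ring

lemma moment_rec {p : E3} (hp : p ∈ S2) (n : ℕ) :
    (n : ℝ) * I (zf p ^ (n - 1)) = (n + 2) * I (zf p ^ (n + 1)) := by
  have h : I (X 0 (zf p ^ n * X 0 (zf p)) + X 1 (zf p ^ n * X 1 (zf p))
      + X 2 (zf p ^ n * X 2 (zf p))) = 0 := by
    simp only [map_add, I_X]; simp
  have h2 : I ((n : ℝ) • zf p ^ (n - 1) - ((n : ℝ) + 2) • zf p ^ (n + 1)) = 0 := by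
    rw [← h]
    apply I_congr
    intro x hx
    rw [mem_S2] at hp hx
    simp only [Derivation.leibniz, Derivation.leibniz_pow, X0_zf, X1_zf, X2_zf, map_add, map_sub,
      Derivation.map_smul, map_mul, map_smul, map_pow, ev_co, ev_zf, X00, X01, X02, X10c, X11, X12,
      X20c, X21c, X22, map_zero, map_neg, smul_eq_mul, nsmul_eq_mul, map_natCast]
    rcases n with _ | n
    · simp [inner3]; ring
    · simp only [Nat.add_sub_cancel]
      push_cast
      rw [inner3]
      set z := p 0 * x 0 + p 1 * x 1 + p 2 * x 2 with hz
      have key : (p 2 * x 1 - p 1 * x 2) ^ 2 + (p 0 * x 2 - p 2 * x 0) ^ 2 +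
        (p 1 * x 0 - p 0 * x 1) ^ 2 = 1 - z ^ 2 := by
        rw [hz]; linear_combination hp * (x 0 ^ 2 + x 1 ^ 2 + x 2 ^ 2) + hx
      linear_combination (-(n + 1) * z ^ n) * key + 2 * z ^ (n + 1) * hz
  simp only [map_sub, map_smul, smul_eq_mul] at h2
  linarith

lemma moment {p : E3} (hp : p ∈ S2) (n : ℕ) :
    I (zf p ^ n) = I 1 / 2 * ∫ s in (-1:ℝ)..1, s ^ n := by
  have main : ∀ n, I (zf p ^ n) = I 1 / 2 * ∫ s in (-1:ℝ)..1, s ^ n ∧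
      I (zf p ^ (n + 1)) = I 1 / 2 * ∫ s in (-1:ℝ)..1, s ^ (n + 1) := by
    intro n
    induction n with
    | zero =>
      constructor
      · simp; ring
      · have := moment_rec hp 0
        simp at this
        simp [this]
    | succ k ih =>
      refine ⟨ih.2, ?_⟩
      have h := moment_rec hp (k + 1)
      simp only [Nat.add_sub_cancel] at h
      rw [ih.1] at h
      push_cast at h
      rw [integral_pow] at h ⊢
      have h3 : (k : ℝ) + 1 + 2 ≠ 0 := by positivity
      have h1 : (k : ℝ) + 1 ≠ 0 := by positivity
      have : I (zf p ^ (k + 1 + 1)) = ((k : ℝ) + 1 + 2)⁻¹ * (((k : ℝ) + 1) * (I 1 / 2 * ((1 ^ (k + 1) - (-1) ^ (k + 1)) / (k + 1)))) := by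
        rw [h]; field_simp
      rw [this]
      push_cast
      field_simp
      ring
  exact (main n).1

lemma zonal_poly {p : E3} (hp : p ∈ S2) (P : Polynomial ℝ) :
    J (fun x => P.eval ⟪p, x⟫) = I 1 / 2 * ∫ s in (-1:ℝ)..1, P.eval s := by
  have hc : ∀ P : Polynomial ℝ, Continuous (fun x : E3 => P.eval ⟪p, x⟫) := fun P =>
    P.continuous.comp (continuous_const.inner continuous_id)
  induction P using Polynomial.induction_on' with
  | add P Q hP hQ =>
    simp only [Polynomial.eval_add]
    rw [J_add (hc P).continuousOn (hc Q).continuousOn, hP, hQ, intervalIntegral.integral_add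
      (P.continuous.intervalIntegrable _ _) (Q.continuous.intervalIntegrable _ _)]
    ring
  | monomial n a =>
    simp only [Polynomial.eval_monomial]
    rw [J_mul, intervalIntegral.integral_const_mul]
    have := moment hp n
    rw [I_def] at this
    simp only [map_pow, ev_zf] at this
    rw [this]; ring

lemma inner_mem {p x : E3} (hp : p ∈ S2) (hx : x ∈ S2) : ⟪p, x⟫ ∈ Set.Icc (-1:ℝ) 1 := by
  have h := abs_real_inner_le_norm p x
  have h1 : ‖p‖ = 1 := by simpa [S2] using hp
  have h2 : ‖x‖ = 1 := by simpa [S2] using hx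
  rw [h1, h2, abs_le] at h
  constructor <;> linarith [h.1, h.2]

lemma I_one_nonneg : 0 ≤ I 1 := I_nonneg (fun x _ => by simp)

lemma zonal {p : E3} (hp : p ∈ S2) {φ : ℝ → ℝ} (hφ : Continuous φ) :
    J (fun x => φ ⟪p, x⟫) = I 1 / 2 * ∫ s in (-1:ℝ)..1, φ s := by
  have hin : Continuous (fun x : E3 => (⟪p, x⟫ : ℝ)) := continuous_const.inner continuous_id
  have h : ∀ ε > 0, |J (fun x => φ ⟪p, x⟫) - I 1 / 2 * ∫ s in (-1:ℝ)..1, φ s| ≤ 2 * I 1 * ε := by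
    intro ε hε
    obtain ⟨P, hP⟩ := exists_polynomial_near_of_continuousOn (-1) 1 φ hφ.continuousOn ε hε
    have h1 := zonal_poly hp P
    have h2 : |J (fun x => φ ⟪p, x⟫) - J (fun x => P.eval ⟪p, x⟫)| ≤ I 1 * ε := by
      rw [← J_sub (f := fun x => φ ⟪p, x⟫) (g := fun x => P.eval ⟪p, x⟫) (hφ.comp hin).continuousOn (P.continuous.comp hin).continuousOn]
      have e1 : I 1 * ε = J (fun _ => ε) := by
        have := J_mul ε (fun _ => 1)
        simp only [mul_one] at this
        rw [this, mul_comm]; rfl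
      rw [e1]
      refine (abs_integral_le_integral_abs).trans ?_
      refine J_mono (f := fun x => |φ ⟪p, x⟫ - P.eval ⟪p, x⟫|) ?_ continuousOn_const ?_
      · exact ((hφ.comp hin).sub (P.continuous.comp hin)).abs.continuousOn
      · intro x hx
        have := hP _ (inner_mem hp hx)
        rw [abs_sub_comm]; exact this.le
    have h3 : |(∫ s in (-1:ℝ)..1, φ s) - ∫ s in (-1:ℝ)..1, P.eval s| ≤ 2 * ε := by
      rw [← intervalIntegral.integral_sub (hφ.intervalIntegrable _ _) (P.continuous.intervalIntegrable _ _)]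
      have := intervalIntegral.norm_integral_le_of_norm_le_const (a := (-1:ℝ)) (b := 1) (C := ε)
        (f := fun s => φ s - P.eval s) (by
          intro s hs
          rw [uIoc_of_le (by norm_num)] at hs
          rw [Real.norm_eq_abs, abs_sub_comm]
          exact (hP s ⟨hs.1.le, hs.2⟩).le)
      rw [Real.norm_eq_abs] at this
      norm_num at this
      linarith
    have hI := I_one_nonneg
    have e : J (fun x => φ ⟪p, x⟫) - I 1 / 2 * ∫ s in (-1:ℝ)..1, φ s =
      (J (fun x => φ ⟪p, x⟫) - J (fun x => P.eval ⟪p, x⟫)) - I 1 / 2 * ((∫ s in (-1:ℝ)..1, φ s) - ∫ s in (-1:ℝ)..1, P.eval s) := by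
      rw [h1]; ring
    rw [e]
    refine (abs_sub _ _).trans ?_
    rw [abs_mul, abs_of_nonneg (by linarith : 0 ≤ I 1 / 2)]
    nlinarith
  have h0 : |J (fun x => φ ⟪p, x⟫) - I 1 / 2 * ∫ s in (-1:ℝ)..1, φ s| ≤ 0 := by
    apply le_of_forall_pos_le_add
    intro ε hε
    have hI := I_one_nonneg
    refine (h (ε / (2 * I 1 + 1)) (by positivity)).trans ?_
    rw [zero_add, mul_div_assoc', div_le_iff₀ (by positivity)]
    nlinarith
  have := abs_nonpos_iff.1 h0
  linarith

def cM : ℝ := I 1 / (4 * π)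
lemma cM_nonneg : 0 ≤ cM := div_nonneg I_one_nonneg (by positivity)

/-- polar coordinates -/
lemma polar_formula {p q : E3} (hp : p ∈ S2) (hq : q ∈ S2) (hpq : ⟪p, q⟫ = 0) {F : E3 → ℝ}
    (hF : Continuous F) :
    J F = cM * ∫ θ in (0:ℝ)..π, zav p q F θ * sin θ := by
  have h1 := J_avg hp hq hpq hF
  have h2 := zonal hp (φ := fun s => zav p q F (arccos s)) ((zav_cont p q hF).comp continuous_arccos)
  rw [h2] at h1
  have h3 := intervalIntegral.integral_comp_mul_deriv (a := 0) (b := π) (f := cos)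
    (f' := fun x => - sin x) (g := fun s => zav p q F (arccos s))
    (fun x _ => Real.hasDerivAt_cos x) (by fun_prop) ((zav_cont p q hF).comp continuous_arccos)
  rw [cos_zero, cos_pi] at h3
  have h4 : ∫ θ in (0:ℝ)..π, zav p q F θ * sin θ = - ∫ x in (0:ℝ)..π, ((fun s => zav p q F (arccos s)) ∘ cos) x * -sin x := by
    rw [← intervalIntegral.integral_neg]
    apply intervalIntegral.integral_congr
    intro θ hθ
    rw [uIcc_of_le pi_pos.le] at hθ
    simp [Real.arccos_cos hθ.1 hθ.2]
  rw [h4, h3, ← intervalIntegral.integral_symm]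
  have hpi := pi_pos
  rw [cM]
  have : J F = (2 * π)⁻¹ * (2 * π * J F) := by field_simp
  rw [this, h1]
  field_simp
  ring

lemma exists_perp {p : E3} (hp : p ∈ S2) : ∃ q ∈ S2, ⟪p, q⟫ = 0 := by
  obtain ⟨i, hi⟩ : ∃ i, crs p (e3 i) ≠ 0 := by
    by_contra! h
    have h0 := congrFun (congrArg (fun v : E3 => (v : Fin 3 → ℝ)) (h 0)) 
    have h1 := congrFun (congrArg (fun v : E3 => (v : Fin 3 → ℝ)) (h 1)) 
    have a1 := h0 1
    have a2 := h0 2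
    have a0 := h1 2
    simp [e3] at a0 a1 a2
    rw [mem_S2] at hp
    rw [a0, a1, a2] at hp
    norm_num at hp
  refine ⟨‖crs p (e3 i)‖⁻¹ • crs p (e3 i), ?_, ?_⟩
  · simp [S2, norm_smul, hi]
  · rw [inner_smul_right, inner3]
    simp
    right; ring

lemma perp_symm {p q : E3} (h : ⟪p, q⟫ = (0 : ℝ)) : ⟪q, p⟫ = (0 : ℝ) := by
  rw [real_inner_comm]; exact h

lemma pol_q {p q : E3} (hp : p ∈ S2) (hpq : ⟪p, q⟫ = 0) : pol p q (π / 2) 0 = q := by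
  rw [pol_eq hp hpq]; simp

lemma zav_nonneg {p q : E3} (hp : p ∈ S2) (hq : q ∈ S2) (hpq : ⟪p, q⟫ = 0) {F : E3 → ℝ}
    (h0 : ∀ x ∈ S2, 0 ≤ F x) (θ : ℝ) : 0 ≤ zav p q F θ := by
  unfold zav
  exact intervalIntegral.integral_nonneg (by positivity) (fun t _ => h0 _ (pol_mem hp hq hpq θ t))

lemma J_eq_zero {F : E3 → ℝ} (hc : 0 < cM) (hF : Continuous F) (h0 : ∀ x ∈ S2, 0 ≤ F x)
    (hJ : J F = 0) : ∀ x ∈ S2, F x = 0 := by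
  intro x hx
  by_contra hne
  have hpos : 0 < F x := lt_of_le_of_ne (h0 x hx) (Ne.symm hne)
  obtain ⟨p, hp, hpx⟩ := exists_perp hx
  have hpx' : ⟪p, x⟫ = 0 := perp_symm hpx
  rw [polar_formula hp hx hpx' hF] at hJ
  have hz : 0 < zav p x F (π / 2) := by
    unfold zav
    apply intervalIntegral.integral_pos (by positivity)
    · exact (hF.comp ((pol_cont p x).comp (by fun_prop : Continuous (fun t : ℝ => (π / 2, t))))).continuousOn
    · intro t _; exact h0 _ (pol_mem hp hx hpx' _ t)
    · exact ⟨0, ⟨le_rfl, by positivity⟩, by rw [pol_q hp hpx']; exact hpos⟩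
  have h2 : 0 < ∫ θ in (0:ℝ)..π, zav p x F θ * sin θ := by
    apply intervalIntegral.integral_pos pi_pos
    · exact ((zav_cont p x hF).mul continuous_sin).continuousOn
    · intro θ hθ
      exact mul_nonneg (zav_nonneg hp hx hpx' h0 θ) (sin_nonneg_of_nonneg_of_le_pi hθ.1.le hθ.2)
    · refine ⟨π / 2, ⟨by positivity, by linarith [pi_pos]⟩, ?_⟩
      simpa using hz
  have := mul_pos hc h2
  linarith

/-- unit vector at angle `t` -/
def wv (p q : E3) (t : ℝ) : E3 := cos t • q + sin t • crs p q

lemma crs_norm {p q : E3} (hp : p ∈ S2) (hq : q ∈ S2) (hpq : ⟪p, q⟫ = 0) : crs p q ∈ S2 := by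
  rw [mem_S2] at *
  rw [inner3] at hpq
  simp
  linear_combination hp * (q 0 ^ 2 + q 1 ^ 2 + q 2 ^ 2) + hq
        - (p 0 * q 0 + p 1 * q 1 + p 2 * q 2) * hpq

lemma wv_perp {p q : E3} (hpq : ⟪p, q⟫ = 0) (t : ℝ) : ⟪p, wv p q t⟫ = 0 := by
  rw [inner3] at *
  simp [wv]
  linear_combination cos t * hpq

lemma wv_mem {p q : E3} (hp : p ∈ S2) (hq : q ∈ S2) (hpq : ⟪p, q⟫ = 0) (t : ℝ) :
    wv p q t ∈ S2 := by
  have := pol_mem hp hq hpq (π / 2) t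
  rw [pol_eq hp hpq] at this
  simpa [wv] using this

lemma rot_perp {p w : E3} (hp : p ∈ S2) (hpw : ⟪p, w⟫ = 0) (θ : ℝ) :
    rot (crs p w) θ p = cos θ • p + sin θ • w := by
  rw [mem_S2] at hp
  rw [inner3] at hpw
  rw [rot_def]
  apply E3.ext3 <;> simp [inner3]
  · linear_combination sin θ * w 0 * hp - sin θ * p 0 * hpw
  · linear_combination sin θ * w 1 * hp - sin θ * p 1 * hpw
  · linear_combination sin θ * w 2 * hp - sin θ * p 2 * hpw

lemma pol_eq_rot {p q : E3} (hp : p ∈ S2) (hpq : ⟪p, q⟫ = 0) (θ t : ℝ) :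
    pol p q θ t = rot (crs p (wv p q t)) θ p := by
  rw [rot_perp hp (wv_perp hpq t), pol_eq hp hpq]; rfl

/-- squared gradient -/
def g2 (f : SF) : SF := X 0 f ^ 2 + X 1 f ^ 2 + X 2 f ^ 2

lemma ev_g2 (x : E3) (f : SF) : ev x (g2 f) = ev x (X 0 f) ^ 2 + ev x (X 1 f) ^ 2 + ev x (X 2 f) ^ 2 := by
  simp [g2]

lemma ev_g2_nonneg (x : E3) (f : SF) : 0 ≤ ev x (g2 f) := by rw [ev_g2]; positivity

lemma Xv_sq_le {n : E3} (hn : n ∈ S2) (x : E3) (f : SF) : ev x (Xv n f) ^ 2 ≤ ev x (g2 f) := by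
  rw [ev_Xv_eq, ev_g2]
  rw [mem_S2] at hn
  set a := ev x (X 0 f)
  set b := ev x (X 1 f)
  set c := ev x (X 2 f)
  have : a ^ 2 + b ^ 2 + c ^ 2 = (n 0 ^ 2 + n 1 ^ 2 + n 2 ^ 2) * (a ^ 2 + b ^ 2 + c ^ 2) := by rw [hn, one_mul]
  rw [this]
  nlinarith [sq_nonneg (n 0 * b - n 1 * a), sq_nonneg (n 0 * c - n 2 * a), sq_nonneg (n 1 * c - n 2 * b)]

lemma Xp_sq_le {p x : E3} (hp : p ∈ S2) (hx : x ∈ S2) (f : SF) :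
    ev x (Xv p f) ^ 2 ≤ (1 - ⟪p, x⟫ ^ 2) * ev x (g2 f) := by
  have h := x_dot_X f
  have h' := congrArg (ev x) h
  simp at h'
  rw [ev_Xv_eq, ev_g2, inner3]
  rw [mem_S2] at hp hx
  set a := ev x (X 0 f)
  set b := ev x (X 1 f)
  set c := ev x (X 2 f)
  set z := p 0 * x 0 + p 1 * x 1 + p 2 * x 2 with hz
  have e1 : p 0 * a + p 1 * b + p 2 * c = (p 0 - z * x 0) * a + (p 1 - z * x 1) * b + (p 2 - z * x 2) * c := by
    linear_combination z * h'
  have e2 : 1 - z ^ 2 = (p 0 - z * x 0) ^ 2 + (p 1 - z * x 1) ^ 2 + (p 2 - z * x 2) ^ 2 := by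
    linear_combination -hp - z ^ 2 * hx - 2 * z * hz
  rw [e1, e2]
  generalize p 0 - z * x 0 = n0
  generalize p 1 - z * x 1 = n1
  generalize p 2 - z * x 2 = n2
  nlinarith [sq_nonneg (n0 * b - n1 * a), sq_nonneg (n0 * c - n2 * a), sq_nonneg (n1 * c - n2 * b)]

lemma const_of_g2 {f : SF} (h : ∀ x ∈ S2, ev x (g2 f) = 0) : ∀ x ∈ S2, ∀ y ∈ S2, ev x f = ev y f := by
  have key : ∀ n ∈ S2, ∀ x ∈ S2, ∀ t, ev (rot n t x) f = ev x f := by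
    intro n hn x hx t
    have := is_const_of_deriv_eq_zero (f := fun s => ev (rot n s x) f)
      (fun s => (ev_rot_hasDerivAt hn s x f).differentiableAt) (fun s => by
        rw [(ev_rot_hasDerivAt hn s x f).deriv]
        have h1 := Xv_sq_le hn (rot n s x) f
        rw [h _ ((rot_mem hn s).2 hx)] at h1
        exact pow_eq_zero_iff (two_ne_zero) |>.1 (le_antisymm h1 (sq_nonneg _))) t 0
    simpa [rot_zero] using this
  intro x hx y hy
  obtain ⟨q, hq, hxq⟩ := exists_perp hx
  obtain ⟨s, hs⟩ := exists_pol hx hq hxq hy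
  set θ := arccos ⟪x, y⟫
  have hn : crs x q ∈ S2 := crs_norm hx hq hxq
  have h1 := rot_perp hx hxq θ
  rw [hs, ← h1, key x hx _ ((rot_mem hn θ).2 hx) s, key _ hn x hx]

lemma integ_swap {f : ℝ → ℝ → ℝ} (hf : Continuous (Function.uncurry f)) {a b c d : ℝ} (hab : a ≤ b)
    (hcd : c ≤ d) : ∫ x in a..b, ∫ y in c..d, f x y = ∫ y in c..d, ∫ x in a..b, f x y := by
  simp only [intervalIntegral.integral_of_le hab, intervalIntegral.integral_of_le hcd, ← integral_Icc_eq_integral_Ioc]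
  apply integral_integral_swap
  rw [Measure.prod_restrict]
  exact hf.continuousOn.integrableOn_compact (isCompact_Icc.prod isCompact_Icc)

lemma osc_bound {f f' : ℝ → ℝ} {T : ℝ} (hT : 1 ≤ T) (hf : ∀ t, HasDerivAt f (f' t) t) (hf' : Continuous f')
    {t : ℝ} (ht : t ∈ Set.Icc 0 T) : |f t| ≤ ∫ s in (0:ℝ)..T, (|f s| + |f' s|) := by
  have hT0 : 0 ≤ T := by linarith
  have hfc : Continuous f := continuous_iff_continuousAt.2 (fun t => (hf t).continuousAt)
  set K := ∫ s in (0:ℝ)..T, |f' s| with hK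
  have hK0 : 0 ≤ K := intervalIntegral.integral_nonneg hT0 (fun _ _ => abs_nonneg _)
  have h1 : ∀ s ∈ Set.Icc 0 T, |f t| ≤ |f s| + K := by
    intro s hs
    have e := intervalIntegral.integral_eq_sub_of_hasDerivAt (a := s) (b := t) (fun x _ => hf x) (hf'.intervalIntegrable _ _)
    have h2 : |f t - f s| ≤ K := by
      rw [← e]
      refine (intervalIntegral.norm_integral_le_integral_norm_uIoc (f := f')).trans ?_
      rw [hK, intervalIntegral.integral_of_le hT0]
      apply setIntegral_mono_set
      · exact (hf'.abs.intervalIntegrable 0 T).1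
      · exact Eventually.of_forall (fun _ => abs_nonneg _)
      · apply LE.le.eventuallyLE
        intro y hy
        rw [uIoc, mem_Ioc] at hy
        exact ⟨lt_of_le_of_lt (le_min hs.1 ht.1) hy.1, hy.2.trans (max_le hs.2 ht.2)⟩
    have := abs_sub_abs_le_abs_sub (f t) (f s)
    linarith
  have h3 : ∫ s in (0:ℝ)..T, |f t| ≤ ∫ s in (0:ℝ)..T, (|f s| + K) := by
    apply intervalIntegral.integral_mono_on hT0 (by simp) 
      ((hfc.abs.add continuous_const).intervalIntegrable _ _) h1
  rw [intervalIntegral.integral_const, intervalIntegral.integral_add (hfc.abs.intervalIntegrable _ _) (by simp),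
    intervalIntegral.integral_const] at h3
  rw [intervalIntegral.integral_add (hfc.abs.intervalIntegrable _ _) (hf'.abs.intervalIntegrable _ _), ← hK]
  simp only [sub_zero, smul_eq_mul] at h3
  have h4 : 0 ≤ ∫ s in (0:ℝ)..T, |f s| := intervalIntegral.integral_nonneg hT0 (fun _ _ => abs_nonneg _)
  by_contra! hcon
  nlinarith

lemma inner_pol {p q : E3} (hp : p ∈ S2) (hpq : ⟪p, q⟫ = 0) (θ t : ℝ) : ⟪p, pol p q θ t⟫ = cos θ := by
  rw [pol_eq hp hpq]
  have := wv_perp hpq t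
  rw [wv] at this
  rw [inner_add_right, inner_smul_right, inner_smul_right, this]
  rw [mem_S2] at hp
  rw [inner3]
  linear_combination cos θ * hp

lemma lemmaL {p : E3} (hp : p ∈ S2) (F G : SF) {H : E3 → ℝ} (hH : Continuous H)
    (hG : ∀ x ∈ S2, 0 ≤ ev x G) (hGp : ev p G = 0) (hH0 : ∀ x ∈ S2, 0 ≤ H x)
    (hGH : ∀ x ∈ S2, ev x (g2 G) ≤ (1 - ⟪p, x⟫ ^ 2) * H x ^ 2) :
    cM * I (F * G) ≤ J H * J (fun x => |ev x F| + |ev x (Xv p F)|) := by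
  obtain ⟨q, hq, hpq⟩ := exists_perp hp
  have hpi := pi_pos
  set N : E3 → ℝ := fun x => |ev x F| + |ev x (Xv p F)| with hN
  have hNc : Continuous N := (ev_cont F).abs.add (ev_cont (Xv p F)).abs
  have hN0 : ∀ x ∈ S2, 0 ≤ N x := fun x _ => by positivity
  have polt : ∀ θ, Continuous (fun t : ℝ => pol p q θ t) := fun θ =>
    (pol_cont p q).comp (by fun_prop : Continuous (fun t : ℝ => (θ, t)))
  have polθ : ∀ t, Continuous (fun θ : ℝ => pol p q θ t) := fun t =>
    (pol_cont p q).comp (by fun_prop : Continuous (fun θ : ℝ => (θ, t)))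
  -- bound on F
  have hF1 : ∀ θ, ∀ t ∈ Set.Icc 0 (2 * π), |ev (pol p q θ t) F| ≤ zav p q N θ := by
    intro θ t ht
    exact osc_bound (f := fun t => ev (pol p q θ t) F) (f' := fun t => ev (pol p q θ t) (Xv p F)) (T := 2 * π)
      (by linarith [Real.pi_gt_three]) (fun t => ev_rot_hasDerivAt hp t _ F)
      ((ev_cont (Xv p F)).comp (polt θ)) ht
  have hJH0 : 0 ≤ J H := J_nonneg hH0
  -- bound on G
  have hG1 : ∀ θ ∈ Set.Icc 0 π, cM * zav p q (fun x => ev x G) θ ≤ J H := by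
    intro θ hθ
    rw [polar_formula hp hq hpq hH]
    apply mul_le_mul_of_nonneg_left _ cM_nonneg
    have hsw : ∫ θ in (0:ℝ)..π, zav p q H θ * sin θ = ∫ t in (0:ℝ)..(2 * π), ∫ θ in (0:ℝ)..π, H (pol p q θ t) * sin θ := by
      rw [← integ_swap (f := fun θ t => H (pol p q θ t) * sin θ) _ hpi.le (by positivity)]
      · apply intervalIntegral.integral_congr
        intro θ _
        simp only [zav]
        rw [intervalIntegral.integral_mul_const]
      · exact (hH.comp (pol_cont p q)).mul (continuous_sin.comp continuous_fst)
    rw [hsw]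
    unfold zav
    have hcc : Continuous (fun a : ℝ × ℝ => H (pol p q a.2 a.1) * sin a.2) :=
      (hH.comp ((pol_cont p q).comp continuous_swap)).mul (continuous_sin.comp continuous_snd)
    apply intervalIntegral.integral_mono_on (by positivity)
    · exact ((ev_cont G).comp (polt θ)).intervalIntegrable _ _
    · exact (intervalIntegral.continuous_parametric_intervalIntegral_of_continuous'
        (f := fun t θ => H (pol p q θ t) * sin θ) hcc 0 π).intervalIntegrable _ _
    · intro t _
      set n := crs p (wv p q t) with hn
      have hnm : n ∈ S2 := crs_norm hp (wv_mem hp hq hpq t) (wv_perp hpq t)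
      have hder : ∀ s, HasDerivAt (fun s => ev (pol p q s t) G) (ev (pol p q s t) (Xv n G)) s := by
        intro s
        simp only [pol_eq_rot hp hpq]
        exact ev_rot_hasDerivAt hnm s p G
      have hcd : Continuous (fun s => ev (pol p q s t) (Xv n G)) := (ev_cont _).comp (polθ t)
      have e := intervalIntegral.integral_eq_sub_of_hasDerivAt (a := 0) (b := θ) (fun s _ => hder s)
        (hcd.intervalIntegrable _ _)
      have e0 : ev (pol p q 0 t) G = 0 := by rw [pol_eq_rot hp hpq, rot_zero, hGp]
      rw [e0, sub_zero] at e
      beta_reduce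
      rw [← e]
      have hHc : Continuous (fun s => H (pol p q s t) * sin s) := (hH.comp (polθ t)).mul continuous_sin
      have hle : ∀ s ∈ Set.Icc 0 π, ev (pol p q s t) (Xv n G) ≤ H (pol p q s t) * sin s := by
        intro s hs
        have m := pol_mem hp hq hpq s t
        have h1 := hGH _ m
        rw [inner_pol hp hpq] at h1
        have h2 := Xv_sq_le hnm (pol p q s t) G
        apply le_of_abs_le
        apply abs_le_of_sq_le_sq _ (mul_nonneg (hH0 _ m) (sin_nonneg_of_nonneg_of_le_pi hs.1 hs.2))
        have := sin_sq_add_cos_sq s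
        calc _ ≤ _ := h2
          _ ≤ _ := h1
          _ = _ := by rw [show 1 - cos s ^ 2 = sin s ^ 2 by linarith]; ring
      calc _ ≤ ∫ s in (0:ℝ)..θ, H (pol p q s t) * sin s :=
            intervalIntegral.integral_mono_on hθ.1 (hcd.intervalIntegrable _ _) (hHc.intervalIntegrable _ _)
              (fun s hs => hle s ⟨hs.1, hs.2.trans hθ.2⟩)
        _ ≤ _ := by
            apply intervalIntegral.integral_mono_interval le_rfl hθ.1 hθ.2 _ (hHc.intervalIntegrable _ _)
            rw [EventuallyLE, ae_restrict_iff' measurableSet_Ioc]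
            filter_upwards with s hs
            exact mul_nonneg (hH0 _ (pol_mem hp hq hpq s t)) (sin_nonneg_of_nonneg_of_le_pi hs.1.le hs.2)
  -- combine
  have hFG : ∀ θ, zav p q (fun x => ev x (F * G)) θ ≤ zav p q N θ * zav p q (fun x => ev x G) θ := by
    intro θ
    conv_rhs => rw [zav.eq_1 p q (fun x => ev x G)]
    rw [← intervalIntegral.integral_const_mul]
    unfold zav
    apply intervalIntegral.integral_mono_on (by positivity)
    · exact ((ev_cont (F * G)).comp (polt θ)).intervalIntegrable _ _
    · exact (continuous_const.mul ((ev_cont G).comp (polt θ))).intervalIntegrable _ _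
    · intro t ht
      beta_reduce
      rw [map_mul]
      exact mul_le_mul_of_nonneg_right ((le_abs_self _).trans (hF1 θ t ht)) (hG _ (pol_mem hp hq hpq θ t))
  have e1 : I (F * G) = cM * ∫ θ in (0:ℝ)..π, zav p q (fun x => ev x (F * G)) θ * sin θ :=
    polar_formula hp hq hpq (ev_cont (F * G))
  rw [e1, polar_formula hp hq hpq hNc]
  rw [mul_left_comm (J H)]
  apply mul_le_mul_of_nonneg_left _ cM_nonneg
  rw [← intervalIntegral.integral_const_mul, ← intervalIntegral.integral_const_mul]
  apply intervalIntegral.integral_mono_on hpi.le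
  · exact (continuous_const.mul ((zav_cont p q (ev_cont (F * G))).mul continuous_sin)).intervalIntegrable _ _
  · exact (continuous_const.mul ((zav_cont p q hNc).mul continuous_sin)).intervalIntegrable _ _
  · intro θ hθ
    rw [← mul_assoc, ← mul_assoc]
    apply mul_le_mul_of_nonneg_right _ (sin_nonneg_of_nonneg_of_le_pi hθ.1 hθ.2)
    calc _ ≤ cM * (zav p q N θ * zav p q (fun x => ev x G) θ) := mul_le_mul_of_nonneg_left (hFG θ) cM_nonneg
      _ = (cM * zav p q (fun x => ev x G) θ) * zav p q N θ := by ring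
      _ ≤ _ := mul_le_mul_of_nonneg_right (hG1 θ hθ) (zav_nonneg hp hq hpq hN0 θ)

/-- gradient vector -/
def gv (x : E3) (f : SF) : E3 := !₂[ev x (X 0 f), ev x (X 1 f), ev x (X 2 f)]

lemma gv_sq (x : E3) (f : SF) : ‖gv x f‖ ^ 2 = ev x (g2 f) := by
  rw [norm3, ev_g2]; simp [gv]

lemma gv_add (x : E3) (f g : SF) : gv x (f + g) = gv x f + gv x g := by
  apply E3.ext3 <;> simp [gv]

lemma gv_smul (x : E3) (c : ℝ) (f : SF) : gv x (c • f) = c • gv x f := by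
  apply E3.ext3 <;> simp [gv]

lemma gv_mul (x : E3) (f g : SF) : gv x (f * g) = ev x f • gv x g + ev x g • gv x f := by
  apply E3.ext3 <;> simp [gv]

attribute [fun_prop] ev_cont

@[fun_prop] lemma gv_cont' (f : SF) : Continuous (fun x => gv x f) := by
  unfold gv
  have h : Continuous (fun x : E3 => (![ev x (X 0 f), ev x (X 1 f), ev x (X 2 f)] : Fin 3 → ℝ)) := by
    apply continuous_pi
    intro i
    fin_cases i <;> simp <;> fun_prop
  exact (PiLp.continuous_toLp 2 _).comp h

lemma gv_cont (f : SF) : Continuous (fun x => ‖gv x f‖) := by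
  have : (fun x => ‖gv x f‖) = fun x => √(ev x (g2 f)) := by
    funext x; rw [← gv_sq, Real.sqrt_sq (norm_nonneg _)]
  rw [this]
  exact (ev_cont (g2 f)).sqrt

lemma gv_mul_le (x : E3) (f g : SF) : ‖gv x (f * g)‖ ≤ |ev x f| * ‖gv x g‖ + |ev x g| * ‖gv x f‖ := by
  rw [gv_mul]
  refine (norm_add_le _ _).trans ?_
  rw [norm_smul, norm_smul, Real.norm_eq_abs, Real.norm_eq_abs]

lemma gv_zf {p x : E3} (hp : p ∈ S2) (hx : x ∈ S2) : ‖gv x (zf p)‖ ^ 2 = 1 - ⟪p, x⟫ ^ 2 := by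
  rw [norm3, inner3]
  rw [mem_S2] at hp hx
  simp [gv, X0_zf, X1_zf, X2_zf]
  linear_combination hp * (x 0 ^ 2 + x 1 ^ 2 + x 2 ^ 2) + hx

lemma Xv_abs_le {n : E3} (hn : n ∈ S2) (x : E3) (f : SF) : |ev x (Xv n f)| ≤ ‖gv x f‖ := by
  apply abs_le_of_sq_le_sq _ (norm_nonneg _)
  rw [gv_sq]; exact Xv_sq_le hn x f

/-- Cauchy-Schwarz -/
lemma J_cs {f g : E3 → ℝ} (hf : ContinuousOn f S2) (hg : ContinuousOn g S2) :
    J (fun x => f x * g x) ^ 2 ≤ J (fun x => f x ^ 2) * J (fun x => g x ^ 2) := by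
  have h : ∀ s : ℝ, 0 ≤ J (fun x => g x ^ 2) * (s * s) + (-2 * J (fun x => f x * g x)) * s + J (fun x => f x ^ 2) := by
    intro s
    have h1 : 0 ≤ J (fun x => (f x - s * g x) ^ 2) := J_nonneg (fun x _ => sq_nonneg _)
    have h2 : J (fun x => (f x - s * g x) ^ 2) = J (fun x => (f x ^ 2 - (2 * s) * (f x * g x)) + s ^ 2 * g x ^ 2) :=
      J_congr (fun x _ => by ring)
    rw [h2, J_add (by fun_prop) (by fun_prop), J_sub (by fun_prop) (by fun_prop), J_mul, J_mul] at h1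
    linarith
  have := discrim_le_zero h
  rw [discrim] at this
  nlinarith

lemma J_cs_sqrt {f g : E3 → ℝ} (hf : ContinuousOn f S2) (hg : ContinuousOn g S2) {A B : ℝ}
    (hA : J (fun x => f x ^ 2) ≤ A) (hB : J (fun x => g x ^ 2) ≤ B) :
    J (fun x => f x * g x) ≤ √A * √B := by
  have h1 := J_cs hf hg
  have hA0 : 0 ≤ J (fun x => f x ^ 2) := J_nonneg (fun x _ => sq_nonneg _)
  have hB0 : 0 ≤ J (fun x => g x ^ 2) := J_nonneg (fun x _ => sq_nonneg _)
  rw [← Real.sqrt_mul (hA0.trans hA)]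
  apply Real.le_sqrt_of_sq_le
  exact h1.trans (mul_le_mul hA hB hB0 (hA0.trans hA))

/-- weak Sobolev inequality -/
lemma sobolev {F : SF} (hF : ∀ x ∈ S2, 0 ≤ ev x F) :
    cM * I (F ^ 2) ≤ 3 * (I F + J (fun x => ‖gv x F‖)) ^ 2 := by
  set A := I F with hA
  set B := J (fun x => ‖gv x F‖) with hB
  have hA0 : 0 ≤ A := I_nonneg hF
  have hB0 : 0 ≤ B := J_nonneg (fun x _ => norm_nonneg _)
  have key : ∀ k : Fin 3, cM * I (F * ((1 - co k ^ 2) * F)) ≤ (2 * A + B) * (A + B) := by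
    intro k
    have hz : ∀ x, ⟪e3 k, x⟫ = x k := fun x => by
      rw [inner3]; fin_cases k <;> simp [e3]
    have hle : ∀ x ∈ S2, x k ^ 2 ≤ 1 := by
      intro x hx
      have := inner_mem (e3_mem k) hx
      rw [hz] at this
      nlinarith [this.1, this.2]
    have hH : Continuous (fun x => 2 * ev x F + ‖gv x F‖ + 0) := by
      have := gv_cont F
      have := ev_cont F
      fun_prop
    have h := lemmaL (e3_mem k) F ((1 - co k ^ 2) * F) (H := fun x => 2 * |ev x F| + ‖gv x F‖)
      (by have := gv_cont F
          have := ev_cont F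
          fun_prop)
      (by intro x hx
          have := hF x hx
          have := hle x hx
          simp only [map_mul, map_sub, map_one, map_pow, ev_co]
          exact mul_nonneg (by linarith) (hF x hx))
      (by simp [e3])
      (by intro x hx; positivity)
      (by
        intro x hx
        rw [← gv_sq, hz]
        have e : (1 - co k ^ 2 : SF) = 1 - zf (e3 k) * zf (e3 k) := by
          apply SF.ext'; intro y; simp [hz, pow_two]
        have hs := gv_zf (e3_mem k) hx
        rw [hz] at hs
        have h1 : gv x (1 - co k ^ 2) = (-2 * x k) • gv x (zf (e3 k)) := by
          rw [e]
          apply E3.ext3 <;> simp [gv, hz] <;> ring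
        have h2 : ‖gv x (1 - co k ^ 2)‖ = 2 * |x k| * ‖gv x (zf (e3 k))‖ := by
          rw [h1, norm_smul]; simp
        have h3 := gv_mul_le x (1 - co k ^ 2) F
        rw [h2] at h3
        set s := ‖gv x (zf (e3 k))‖
        have hs0 : 0 ≤ s := norm_nonneg _
        have hxk := hle x hx
        have hax : |x k| ≤ 1 := by rw [← sq_le_one_iff_abs_le_one]; exact hxk
        have hs1 : s ≤ 1 := by nlinarith [sq_nonneg (x k)]
        simp only [map_sub, map_one, map_pow, ev_co] at h3
        rw [← hs, abs_of_nonneg (sq_nonneg s)] at h3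
        rw [← hs, ← mul_pow]
        apply pow_le_pow_left₀ (norm_nonneg _)
        have hgn := norm_nonneg (gv x F)
        have hfn := abs_nonneg (ev x F)
        have i1 : s ^ 2 * ‖gv x F‖ ≤ s * ‖gv x F‖ := by
          apply mul_le_mul_of_nonneg_right _ hgn; nlinarith
        have i2 : |ev x F| * (2 * |x k| * s) ≤ |ev x F| * (2 * 1 * s) := by gcongr
        linarith)
    have hc1 : Continuous (fun x => |ev x F|) := (ev_cont F).abs
    have hc2 := gv_cont F
    have hc3 : Continuous (fun x => |ev x (Xv (e3 k) F)|) := (ev_cont _).abs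
    have eA : J (fun x => |ev x F|) = A := J_congr (fun x hx => abs_of_nonneg (hF x hx))
    rw [J_add (Continuous.continuousOn (by fun_prop)) (Continuous.continuousOn (by fun_prop)), J_add (Continuous.continuousOn (by fun_prop)) (Continuous.continuousOn (by fun_prop)), J_mul, eA, ← hB] at h
    refine h.trans ?_
    apply mul_le_mul_of_nonneg_left _ (by positivity)
    gcongr
    exact J_mono (Continuous.continuousOn (by fun_prop)) (Continuous.continuousOn (by fun_prop)) (fun x _ => Xv_abs_le (e3_mem k) x F)
  have e : 2 * I (F ^ 2) = I (F * ((1 - co 0 ^ 2) * F)) + I (F * ((1 - co 1 ^ 2) * F)) + I (F * ((1 - co 2 ^ 2) * F)) := by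
    rw [← map_add, ← map_add, ← smul_eq_mul, ← map_smul]
    apply I_congr
    intro x hx
    rw [mem_S2] at hx
    simp
    linear_combination (ev x F) ^ 2 * hx
  have k0 := key 0
  have k1 := key 1
  have k2 := key 2
  have : cM * (2 * I (F ^ 2)) ≤ 3 * ((2 * A + B) * (A + B)) := by rw [e]; linarith
  nlinarith

/-! vector fields -/

abbrev VF : Type := Fin 3 → SF

def dv (Y : VF) : SF := X 0 (Y 0) + X 1 (Y 1) + X 2 (Y 2)
def rt (Y : VF) : VF := ![co 1 * Y 2 - co 2 * Y 1, co 2 * Y 0 - co 0 * Y 2, co 0 * Y 1 - co 1 * Y 0]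
def cl (Y : VF) : SF := dv (rt Y)
def n2 (Y : VF) : SF := Y 0 ^ 2 + Y 1 ^ 2 + Y 2 ^ 2
def T2 (Y : VF) : SF := g2 (Y 0) + g2 (Y 1) + g2 (Y 2)
def Tang (Y : VF) : Prop := co 0 * Y 0 + co 1 * Y 1 + co 2 * Y 2 = 0
def bErr (b : SF) (Y : VF) : SF :=
  X 0 b * (Y 0 * X 0 (Y 0) + Y 1 * X 1 (Y 0) + Y 2 * X 2 (Y 0) - Y 0 * dv Y)
  + X 1 b * (Y 0 * X 0 (Y 1) + Y 1 * X 1 (Y 1) + Y 2 * X 2 (Y 1) - Y 1 * dv Y)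
  + X 2 b * (Y 0 * X 0 (Y 2) + Y 1 * X 1 (Y 2) + Y 2 * X 2 (Y 2) - Y 2 * dv Y)

lemma I_dv (W : VF) : I (dv W) = 0 := by simp [dv]

lemma tang_ev {Y : VF} (h : Tang Y) (x : E3) : x 0 * ev x (Y 0) + x 1 * ev x (Y 1) + x 2 * ev x (Y 2) = 0 := by
  have := congrArg (ev x) h
  simpa using this

lemma tang_X {Y : VF} (h : Tang Y) (x : E3) :
    (x 0 * ev x (X 0 (Y 0)) + x 1 * ev x (X 0 (Y 1)) + x 2 * ev x (X 0 (Y 2)) =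
      - (x 1 * ev x (Y 2) - x 2 * ev x (Y 1))) ∧
    (x 0 * ev x (X 1 (Y 0)) + x 1 * ev x (X 1 (Y 1)) + x 2 * ev x (X 1 (Y 2)) =
      - (x 2 * ev x (Y 0) - x 0 * ev x (Y 2))) ∧
    (x 0 * ev x (X 2 (Y 0)) + x 1 * ev x (X 2 (Y 1)) + x 2 * ev x (X 2 (Y 2)) =
      - (x 0 * ev x (Y 1) - x 1 * ev x (Y 0))) := by
  refine ⟨?_, ?_, ?_⟩
  · have := congrArg (fun f => ev x (X 0 f)) h
    simp at this
    linarith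
  · have := congrArg (fun f => ev x (X 1 f)) h
    simp at this
    linarith
  · have := congrArg (fun f => ev x (X 2 f)) h
    simp at this
    linarith

lemma dot_ev (f : SF) (x : E3) : x 0 * ev x (X 0 f) + x 1 * ev x (X 1 f) + x 2 * ev x (X 2 f) = 0 := by
  have := congrArg (ev x) (x_dot_X f)
  simpa using this

lemma cl_ev {Y : VF} (h : Tang Y) (x : E3) : ev x (cl Y) =
    -(x 0 * (ev x (X 1 (Y 2)) - ev x (X 2 (Y 1))) + x 1 * (ev x (X 2 (Y 0)) - ev x (X 0 (Y 2)))
      + x 2 * (ev x (X 0 (Y 1)) - ev x (X 1 (Y 0)))) := by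
  have := tang_ev h x
  simp [cl, dv, rt]
  linear_combination -2 * this

lemma T2_ge {Y : VF} (h : Tang Y) {x : E3} (hx : x ∈ S2) : ev x (n2 Y) ≤ ev x (T2 Y) := by
  obtain ⟨a0, a1, a2⟩ := tang_X h x
  have t := tang_ev h x
  rw [mem_S2] at hx
  simp only [n2, T2, map_add, map_pow, ev_g2]
  set y0 := ev x (Y 0)
  set y1 := ev x (Y 1)
  set y2 := ev x (Y 2)
  have e : y0 ^ 2 + y1 ^ 2 + y2 ^ 2 = (x 1 * y2 - x 2 * y1) ^ 2 + (x 2 * y0 - x 0 * y2) ^ 2 + (x 0 * y1 - x 1 * y0) ^ 2 := by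
    linear_combination (x 0 * y0 + x 1 * y1 + x 2 * y2) * t - (y0 ^ 2 + y1 ^ 2 + y2 ^ 2) * hx
  have cs : ∀ a b c : ℝ, (x 0 * a + x 1 * b + x 2 * c) ^ 2 ≤ a ^ 2 + b ^ 2 + c ^ 2 := by
    intro a b c
    have : a ^ 2 + b ^ 2 + c ^ 2 = (x 0 ^ 2 + x 1 ^ 2 + x 2 ^ 2) * (a ^ 2 + b ^ 2 + c ^ 2) := by rw [hx, one_mul]
    rw [this]
    nlinarith [sq_nonneg (x 0 * b - x 1 * a), sq_nonneg (x 0 * c - x 2 * a), sq_nonneg (x 1 * c - x 2 * b)]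
  have c0 := cs (ev x (X 0 (Y 0))) (ev x (X 0 (Y 1))) (ev x (X 0 (Y 2)))
  have c1 := cs (ev x (X 1 (Y 0))) (ev x (X 1 (Y 1))) (ev x (X 1 (Y 2)))
  have c2 := cs (ev x (X 2 (Y 0))) (ev x (X 2 (Y 1))) (ev x (X 2 (Y 2)))
  rw [a0] at c0
  rw [a1] at c1
  rw [a2] at c2
  rw [e]
  linarith

lemma bochner (b : SF) {Y : VF} (h : Tang Y) :
    I (b * T2 Y) = I (b * (dv Y ^ 2 + cl Y ^ 2)) - I (bErr b Y) := by
  let W : VF := fun j => b * (Y 0 * X 0 (Y j) + Y 1 * X 1 (Y j) + Y 2 * X 2 (Y j) - Y j * dv Y)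
  have hW := I_dv W
  have : I (b * T2 Y - b * (dv Y ^ 2 + cl Y ^ 2) + bErr b Y) = I (dv W) := by
    apply I_congr
    intro x hx
    obtain ⟨a0, a1, a2⟩ := tang_X h x
    have t := tang_ev h x
    have d0 := dot_ev (Y 0) x
    have d1 := dot_ev (Y 1) x
    have d2 := dot_ev (Y 2) x
    have hcl := cl_ev h x
    rw [mem_S2] at hx
    simp only [map_add, map_sub, map_mul, map_pow, hcl]
    simp only [W, bErr, T2, ev_g2, dv, map_add, map_sub, map_mul, Derivation.leibniz, map_pow, smul_eq_mul, X10, X20, X21]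
    set y0 := ev x (Y 0)
    set y1 := ev x (Y 1)
    set y2 := ev x (Y 2)
    set T00 := ev x (X 0 (Y 0))
    set T01 := ev x (X 0 (Y 1))
    set T02 := ev x (X 0 (Y 2))
    set T10 := ev x (X 1 (Y 0))
    set T11 := ev x (X 1 (Y 1))
    set T12 := ev x (X 1 (Y 2))
    set T20 := ev x (X 2 (Y 0))
    set T21 := ev x (X 2 (Y 1))
    set T22 := ev x (X 2 (Y 2))
    obtain ⟨s, hs⟩ : ∃ s, s = x 0 * (T12 - T21) + x 1 * (T20 - T02) + x 2 * (T01 - T10) := ⟨_, rfl⟩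
    have m0 : x 1 * ((T01 - T10) + y2) - x 2 * ((T20 - T02) + y1) = 0 := by linear_combination a0 - d0
    have m1 : x 2 * ((T12 - T21) + y0) - x 0 * ((T01 - T10) + y2) = 0 := by linear_combination a1 - d1
    have m2 : x 0 * ((T20 - T02) + y1) - x 1 * ((T12 - T21) + y0) = 0 := by linear_combination a2 - d2
    have A0 : T12 - T21 = s * x 0 - y0 := by
      linear_combination (-((T12 - T21) + y0)) * hx - x 0 * hs + x 0 * t + x 2 * m1 - x 1 * m2
    have A1 : T20 - T02 = s * x 1 - y1 := by
      linear_combination (-((T20 - T02) + y1)) * hx - x 1 * hs + x 1 * t + x 0 * m2 - x 2 * m0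
    have A2 : T01 - T10 = s * x 2 - y2 := by
      linear_combination (-((T01 - T10) + y2)) * hx - x 2 * hs + x 2 * t + x 1 * m0 - x 0 * m1
    have key1 : (T12 - T21) ^ 2 + (T20 - T02) ^ 2 + (T01 - T10) ^ 2 = s ^ 2 + y0 ^ 2 + y1 ^ 2 + y2 ^ 2 := by
      rw [A0, A1, A2]; linear_combination s ^ 2 * hx - 2 * s * t
    have key2 : y0 * (T12 - T21) + y1 * (T20 - T02) + y2 * (T01 - T10) = - (y0 ^ 2 + y1 ^ 2 + y2 ^ 2) := by
      rw [A0, A1, A2]; linear_combination s * t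
    rw [← hs]
    linear_combination ev x b * key1 + ev x b * key2
  rw [hW, map_add, map_sub] at this
  linarith

lemma bochner_one {Y : VF} (h : Tang Y) : I (T2 Y) = I (dv Y ^ 2 + cl Y ^ 2) := by
  have := bochner 1 h
  have e : bErr 1 Y = 0 := by simp [bErr]
  rw [e] at this
  simpa using this

lemma n2_le_div_curl {Y : VF} (h : Tang Y) : I (n2 Y) ≤ I (dv Y ^ 2 + cl Y ^ 2) := by
  rw [← bochner_one h]
  exact I_mono (fun x hx => T2_ge h hx)

lemma bochner_weight {b : SF} (hb : ∀ x ∈ S2, 0 < ev x b) (hb2 : ∀ x ∈ S2, ev x (g2 b) ≤ 2 * ev x b)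
    {Y : VF} (h : Tang Y) :
    I (b * T2 Y) ≤ 2 * I (b * (dv Y ^ 2 + cl Y ^ 2)) + 16 * I (n2 Y) := by
  have h1 := bochner b h
  have h2 : I (- bErr b Y) ≤ I ((1 / 2 : ℝ) • (b * T2 Y) + (8 : ℝ) • n2 Y) := by
    apply I_mono
    intro x hx
    have hb0 := hb x hx
    have hb1 := hb2 x hx
    rw [ev_g2] at hb1
    simp only [bErr, T2, ev_g2, n2, dv, map_add, map_sub, map_mul, map_pow, map_neg, map_smul, smul_eq_mul]
    set c := √(ev x b) with hc
    have hc0 : 0 < c := Real.sqrt_pos.2 hb0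
    have hcb : ev x b = c ^ 2 := (Real.sq_sqrt hb0.le).symm
    rw [hcb] at hb1 ⊢
    obtain ⟨γ0, h0⟩ : ∃ γ, ev x (X 0 b) = c * γ := ⟨ev x (X 0 b) / c, by field_simp⟩
    obtain ⟨γ1, h1⟩ : ∃ γ, ev x (X 1 b) = c * γ := ⟨ev x (X 1 b) / c, by field_simp⟩
    obtain ⟨γ2, h2⟩ : ∃ γ, ev x (X 2 b) = c * γ := ⟨ev x (X 2 b) / c, by field_simp⟩
    rw [h0, h1, h2] at hb1 ⊢
    have hγ : γ0 ^ 2 + γ1 ^ 2 + γ2 ^ 2 ≤ 2 := by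
      have : c ^ 2 * (γ0 ^ 2 + γ1 ^ 2 + γ2 ^ 2) ≤ c ^ 2 * 2 := by linarith
      exact le_of_mul_le_mul_left this (by positivity)
    generalize ev x (Y 0) = y0
    generalize ev x (Y 1) = y1
    generalize ev x (Y 2) = y2
    generalize ev x (X 0 (Y 0)) = T00
    generalize ev x (X 0 (Y 1)) = T01
    generalize ev x (X 0 (Y 2)) = T02
    generalize ev x (X 1 (Y 0)) = T10
    generalize ev x (X 1 (Y 1)) = T11
    generalize ev x (X 1 (Y 2)) = T12
    generalize ev x (X 2 (Y 0)) = T20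
    generalize ev x (X 2 (Y 1)) = T21
    generalize ev x (X 2 (Y 2)) = T22
    have q : ∀ T y γ : ℝ, -(c * γ * (y * T)) ≤ c ^ 2 * T ^ 2 / 4 + γ ^ 2 * y ^ 2 := by
      intro T y γ; nlinarith [sq_nonneg (c * T / 2 + γ * y)]
    set D := T00 + T11 + T22 with hD
    set g := γ0 * y0 + γ1 * y1 + γ2 * y2 with hg
    have q2 : c * g * D ≤ c ^ 2 * D ^ 2 / 12 + 3 * g ^ 2 := by nlinarith [sq_nonneg (c * D / 6 - g)]
    have q3 : D ^ 2 ≤ 3 * (T00 ^ 2 + T11 ^ 2 + T22 ^ 2) := by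
      rw [hD]; nlinarith [sq_nonneg (T00 - T11), sq_nonneg (T00 - T22), sq_nonneg (T11 - T22)]
    have q3' : c ^ 2 * D ^ 2 ≤ c ^ 2 * (3 * (T00 ^ 2 + T11 ^ 2 + T22 ^ 2)) := by gcongr
    have q4 : g ^ 2 ≤ (γ0 ^ 2 + γ1 ^ 2 + γ2 ^ 2) * (y0 ^ 2 + y1 ^ 2 + y2 ^ 2) := by
      rw [hg]; nlinarith [sq_nonneg (γ0 * y1 - γ1 * y0), sq_nonneg (γ0 * y2 - γ2 * y0), sq_nonneg (γ1 * y2 - γ2 * y1)]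
    have q5 : (γ0 ^ 2 + γ1 ^ 2 + γ2 ^ 2) * (y0 ^ 2 + y1 ^ 2 + y2 ^ 2) ≤ 2 * (y0 ^ 2 + y1 ^ 2 + y2 ^ 2) := by gcongr
    have p1 : 0 ≤ c ^ 2 * (T01 ^ 2 + T02 ^ 2 + T10 ^ 2 + T12 ^ 2 + T20 ^ 2 + T21 ^ 2) := by positivity
    have e : -(c * γ0 * (y0 * T00 + y1 * T10 + y2 * T20 - y0 * D) + c * γ1 * (y0 * T01 + y1 * T11 + y2 * T21 - y1 * D)
        + c * γ2 * (y0 * T02 + y1 * T12 + y2 * T22 - y2 * D)) = 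
        -(c * γ0 * (y0 * T00)) - (c * γ0 * (y1 * T10)) - (c * γ0 * (y2 * T20))
        - (c * γ1 * (y0 * T01)) - (c * γ1 * (y1 * T11)) - (c * γ1 * (y2 * T21))
        - (c * γ2 * (y0 * T02)) - (c * γ2 * (y1 * T12)) - (c * γ2 * (y2 * T22)) + c * g * D := by
      rw [hg]; ring
    rw [e]
    have r00 := q T00 y0 γ0
    have r10 := q T10 y1 γ0
    have r20 := q T20 y2 γ0
    have r01 := q T01 y0 γ1
    have r11 := q T11 y1 γ1
    have r21 := q T21 y2 γ1
    have r02 := q T02 y0 γ2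
    have r12 := q T12 y1 γ2
    have r22 := q T22 y2 γ2
    linarith
  rw [map_neg, map_add, map_smul, map_smul, smul_eq_mul, smul_eq_mul] at h2
  linarith

def Lap (f : SF) : SF := X 0 (X 0 f) + X 1 (X 1 f) + X 2 (X 2 f)

def Xf (f : SF) : VF := ![X 0 f, X 1 f, X 2 f]

lemma tang_Xf (f : SF) : Tang (Xf f) := by
  have := x_dot_X f
  simpa [Tang, Xf] using this

lemma dv_Xf (f : SF) : dv (Xf f) = Lap f := by simp [dv, Xf, Lap]
lemma n2_Xf (f : SF) : n2 (Xf f) = g2 f := by simp [n2, Xf, g2]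

lemma cl_Xf (f : SF) : cl (Xf f) = 0 := by
  apply SF.ext'
  intro x
  have h := dot_ev f x
  rw [cl_ev (tang_Xf f)]
  simp [Xf, X10, X20, X21]
  linear_combination h

lemma I_parts (i : Fin 3) (f g : SF) : I (f * X i g) = - I (X i f * g) := by
  have := I_X i (f * g)
  simp only [Derivation.leibniz, smul_eq_mul, map_add] at this
  rw [mul_comm (X i f) g]
  linarith

/-- pointwise product of gradients -/
def gg (f g : SF) : SF := X 0 f * X 0 g + X 1 f * X 1 g + X 2 f * X 2 g

lemma I_mul_Lap (f g : SF) : I (f * Lap g) = - I (gg f g) := by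
  simp only [Lap, gg, mul_add, map_add, I_parts]
  ring

lemma gg_self (f : SF) : gg f f = g2 f := by simp [gg, g2, sq]
lemma gg_comm (f g : SF) : gg f g = gg g f := by simp [gg, mul_comm]

/-! polynomials -/
def W1 : Submodule ℝ SF := Submodule.span ℝ {1, co 0, co 1, co 2}
def PN (N : ℕ) : Submodule ℝ SF := W1 ^ N

lemma W1_fg : W1.FG := Submodule.fg_span (by simp)
lemma PN_fg (N : ℕ) : (PN N).FG := W1_fg.pow N

lemma W1_one : (1 : SF) ∈ W1 := Submodule.subset_span (by simp)
lemma W1_co (i : Fin 3) : co i ∈ W1 := by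
  apply Submodule.subset_span
  fin_cases i <;> simp

lemma PN_mono {M N : ℕ} (h : M ≤ N) : PN M ≤ PN N :=
  pow_le_pow_right₀ (Submodule.one_le.2 W1_one) h

lemma X_W1 (i : Fin 3) {f : SF} (hf : f ∈ W1) : X i f ∈ W1 := by
  unfold W1 at hf
  induction hf using Submodule.span_induction with
  | mem x hx =>
    simp only [Set.mem_insert_iff, Set.mem_singleton_iff] at hx
    rcases hx with rfl | rfl | rfl | rfl <;> fin_cases i <;> simp [W1_co]
  | zero => simp
  | add x y _ _ h1 h2 => simpa using add_mem h1 h2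
  | smul c x _ h => simpa using Submodule.smul_mem _ c h

lemma X_PN (i : Fin 3) (N : ℕ) : ∀ {f : SF}, f ∈ PN N → X i f ∈ PN N := by
  induction N with
  | zero =>
    intro f hf
    simp only [PN, pow_zero] at hf ⊢
    obtain ⟨c, rfl⟩ := Submodule.mem_one.1 hf
    simp
  | succ N ih =>
    intro f hf
    simp only [PN, pow_succ] at hf ⊢
    induction hf using Submodule.mul_induction_on' with
    | mem_mul_mem a ha b hb =>
      simp only [Derivation.leibniz, smul_eq_mul]
      apply add_mem
      · exact Submodule.mul_mem_mul ha (X_W1 i hb)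
      · rw [mul_comm b]; exact Submodule.mul_mem_mul (ih ha) hb
    | add a _ b _ h1 h2 => simpa using add_mem h1 h2

lemma Lap_PN {N : ℕ} {f : SF} (hf : f ∈ PN N) : Lap f ∈ PN N :=
  add_mem (add_mem (X_PN 0 N (X_PN 0 N hf)) (X_PN 1 N (X_PN 1 N hf))) (X_PN 2 N (X_PN 2 N hf))

lemma adjoin_PN {f : SF} (hf : f ∈ Algebra.adjoin ℝ ({co 0, co 1, co 2} : Set SF)) : ∃ N, f ∈ PN N := by
  induction hf using Algebra.adjoin_induction with
  | mem x hx =>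
    refine ⟨1, ?_⟩
    simp only [Set.mem_insert_iff, Set.mem_singleton_iff] at hx
    rcases hx with rfl | rfl | rfl <;> simp [PN, W1_co]
  | algebraMap r =>
    refine ⟨0, ?_⟩
    simp only [PN, pow_zero]
    exact Submodule.algebraMap_mem r
  | add x y _ _ h1 h2 =>
    obtain ⟨M, h1⟩ := h1
    obtain ⟨N, h2⟩ := h2
    exact ⟨max M N, add_mem (PN_mono (le_max_left _ _) h1) (PN_mono (le_max_right _ _) h2)⟩
  | mul x y _ _ h1 h2 =>
    obtain ⟨M, h1⟩ := h1
    obtain ⟨N, h2⟩ := h2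
    refine ⟨M + N, ?_⟩
    simp only [PN, pow_add]
    exact Submodule.mul_mem_mul h1 h2

def toC : SF →ₐ[ℝ] C(E3, ℝ) where
  toFun f := ⟨f.1, f.cont⟩
  map_one' := rfl
  map_mul' _ _ := rfl
  map_zero' := rfl
  map_add' _ _ := rfl
  commutes' _ := rfl

lemma poly_dense (g : SF) {η : ℝ} (hη : 0 < η) : ∃ N, ∃ q ∈ PN N, ∀ x ∈ S2, |ev x q - ev x g| < η := by
  have hs : ((Algebra.adjoin ℝ ({co 0, co 1, co 2} : Set SF)).map toC).SeparatesPoints := by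
    intro x y hxy
    by_contra hcon
    apply hxy
    have key : ∀ i : Fin 3, x i = y i := by
      intro i
      by_contra hi
      apply hcon
      refine ⟨toC (co i), ⟨toC (co i), ?_, rfl⟩, hi⟩
      refine Subalgebra.mem_map.2 ⟨co i, Algebra.subset_adjoin ?_, rfl⟩
      fin_cases i <;> simp
    exact E3.ext3 (key 0) (key 1) (key 2)
  obtain ⟨q', hq', h⟩ := ContinuousMap.exists_mem_subalgebra_near_continuous_of_isCompact_of_separatesPoints
    hs (toC g) S2_compact hη
  obtain ⟨q, hq, rfl⟩ := Subalgebra.mem_map.1 hq'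
  obtain ⟨N, hN⟩ := adjoin_PN hq
  exact ⟨N, q, hN, h⟩

lemma I_sq_nonneg (f : SF) : 0 ≤ I (f * f) := I_nonneg (fun x _ => by rw [map_mul]; exact mul_self_nonneg _)

lemma I_zero_of_sq {v f : SF} (h : I (v * v) = 0) : I (f * v) = 0 := by
  have key : ∀ c : ℝ, 0 ≤ I (f * f) + 2 * c * I (f * v) := by
    intro c
    have h1 := I_sq_nonneg (f + c • v)
    have h2 : (f + c • v) * (f + c • v) = f * f + (2 * c) • (f * v) + (c ^ 2) • (v * v) := by
      apply SF.ext'; intro x; simp; ring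
    rw [h2, map_add, map_add, map_smul, map_smul, h] at h1
    simpa using h1
  by_contra hne
  have := key (-(I (f * f) + 1) / (2 * I (f * v)))
  field_simp at this
  linarith

lemma exists_proj {W : Submodule ℝ SF} (hW : W.FG) : ∀ g : SF, ∃ w ∈ W, ∀ v ∈ W, I ((g - w) * v) = 0 := by
  classical
  obtain ⟨s, rfl⟩ := hW
  induction s using Finset.induction_on with
  | empty => intro g; exact ⟨0, by simp, by simp⟩
  | insert a s ha ih =>
    intro g
    obtain ⟨w, hw, h1⟩ := ih g
    obtain ⟨a', ha', h2⟩ := ih a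
    have hle : Submodule.span ℝ (s : Set SF) ≤ Submodule.span ℝ ((insert a s : Finset SF) : Set SF) :=
      Submodule.span_mono (by simp)
    have haa : a ∈ Submodule.span ℝ ((insert a s : Finset SF) : Set SF) := Submodule.subset_span (by simp)
    set e := a - a' with he
    have hE : e ∈ Submodule.span ℝ ((insert a s : Finset SF) : Set SF) := sub_mem haa (hle ha')
    obtain ⟨c, hc⟩ : ∃ c : ℝ, I ((g - w) * e) = c * I (e * e) := by
      by_cases h0 : I (e * e) = 0
      · exact ⟨0, by rw [I_zero_of_sq h0]; simp⟩
      · exact ⟨I ((g - w) * e) / I (e * e), by field_simp⟩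
    refine ⟨w + c • e, add_mem (hle hw) (Submodule.smul_mem _ _ hE), ?_⟩
    have hv1 : ∀ v ∈ Submodule.span ℝ (s : Set SF), I ((g - (w + c • e)) * v) = 0 := by
      intro v hv
      have : (g - (w + c • e)) * v = (g - w) * v - c • (e * v) := by
        apply SF.ext'; intro x; simp; ring
      rw [this, map_sub, map_smul, h1 v hv, h2 v hv]; simp
    have hv2 : I ((g - (w + c • e)) * e) = 0 := by
      have : (g - (w + c • e)) * e = (g - w) * e - c • (e * e) := by
        apply SF.ext'; intro x; simp; ring
      rw [this, map_sub, map_smul, hc]; simp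
    intro v hv
    rw [Finset.coe_insert, Submodule.mem_span_insert] at hv
    obtain ⟨k, z, hz, rfl⟩ := hv
    have : k • a + z = k • e + (k • a' + z) := by rw [he]; module
    rw [this, mul_add, map_add, hv1 _ (add_mem (Submodule.smul_mem _ _ ha') hz), mul_smul_comm, map_smul, hv2]
    simp

def LapL : SF →ₗ[ℝ] SF where
  toFun := Lap
  map_add' f g := by simp [Lap]; abel
  map_smul' c f := by simp [Lap]

lemma Lap_add (f g : SF) : Lap (f + g) = Lap f + Lap g := LapL.map_add f g
lemma Lap_sub (f g : SF) : Lap (f - g) = Lap f - Lap g := LapL.map_sub f g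
lemma Lap_smul (c : ℝ) (f : SF) : Lap (c • f) = c • Lap f := LapL.map_smul c f
lemma Lap_one : Lap 1 = 0 := by simp [Lap]
lemma I_Lap (f : SF) : I (Lap f) = 0 := by simp [Lap]

lemma I_one_pos (hc : 0 < cM) : 0 < I 1 := by
  unfold cM at hc
  have h4 : 0 < 4 * π := by positivity
  by_contra h
  push Not at h
  have := div_nonpos_of_nonpos_of_nonneg h h4.le
  linarith

lemma poisson_poly (hc : 0 < cM) {N : ℕ} {g : SF} (hg : g ∈ PN N) (h0 : I g = 0) :
    ∃ f, ∀ x ∈ S2, ev x (Lap f) = ev x g := by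
  obtain ⟨w, hw, h⟩ := exists_proj ((PN_fg N).map LapL) g
  obtain ⟨f, hf, rfl⟩ := Submodule.mem_map.1 hw
  refine ⟨f, ?_⟩
  set k := g - LapL f with hk
  have hkP : k ∈ PN N := sub_mem hg (Lap_PN hf)
  have h1 : I (k * Lap k) = 0 := h (Lap k) (Submodule.mem_map.2 ⟨k, hkP, rfl⟩)
  rw [I_mul_Lap, gg_self] at h1
  have h2 := J_eq_zero hc (ev_cont (g2 k)) (fun x _ => ev_g2_nonneg x k) (by rw [← I_def]; linarith)
  have h3 := const_of_g2 h2
  intro x hx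
  have h4 : I k = ev x k * I 1 := by
    have : I k = I (ev x k • (1 : SF)) := I_congr (fun y hy => by rw [h3 y hy x hx]; simp)
    rw [this, map_smul, smul_eq_mul]
  have h5 : I k = 0 := by
    rw [hk, map_sub, h0]
    have : I (LapL f) = 0 := I_Lap f
    rw [this]; simp
  have h6 : ev x k = 0 := by
    rw [h5] at h4
    rcases mul_eq_zero.1 h4.symm with h | h
    · exact h
    · exact absurd h (I_one_pos hc).ne'
  rw [hk, map_sub] at h6
  have : ev x (LapL f) = ev x (Lap f) := rfl
  linarith

lemma poisson (hc : 0 < cM) {g : SF} (h0 : I g = 0) {η : ℝ} (hη : 0 < η) :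
    ∃ f, I f = 0 ∧ I ((Lap f - g) ^ 2) ≤ η := by
  have hM := I_one_pos hc
  set e := √(η / (4 * I 1)) with he
  have he0 : 0 < e := Real.sqrt_pos.2 (by positivity)
  have he2 : e ^ 2 = η / (4 * I 1) := Real.sq_sqrt (by positivity)
  obtain ⟨N, q, hq, hqg⟩ := poly_dense g he0
  have hm : |I q| ≤ e * I 1 := by
    have e1 : I q = I (q - g) := by rw [map_sub, h0, sub_zero]
    have a1 : I (q - g) ≤ I (e • (1 : SF)) := I_mono (fun x hx => by
      have := hqg x hx; rw [abs_lt] at this; simp; linarith)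
    have a2 : I ((-e) • (1 : SF)) ≤ I (q - g) := I_mono (fun x hx => by
      have := hqg x hx; rw [abs_lt] at this; simp; linarith)
    rw [map_smul, smul_eq_mul] at a1 a2
    rw [abs_le, e1]
    constructor <;> linarith
  set m := I q / I 1 with hmd
  have hm' : |m| ≤ e := by
    rw [hmd, abs_div, abs_of_pos hM, div_le_iff₀ hM]; exact hm
  have hP : q - m • 1 ∈ PN N := by
    refine sub_mem hq (Submodule.smul_mem _ _ ?_)
    exact PN_mono (Nat.zero_le N) (by simp [PN])
  obtain ⟨f, hf⟩ := poisson_poly hc hP (by rw [map_sub, map_smul, smul_eq_mul, hmd]; field_simp; simp)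
  refine ⟨f - (I f / I 1) • 1, by rw [map_sub, map_smul, smul_eq_mul]; field_simp; simp, ?_⟩
  have : I ((Lap (f - (I f / I 1) • 1) - g) ^ 2) ≤ I ((4 * e ^ 2) • (1 : SF)) := by
    apply I_mono
    intro x hx
    have h1 := hqg x hx
    rw [Lap_sub, Lap_smul, Lap_one]
    simp only [smul_zero, sub_zero, map_pow, map_sub, hf x hx, map_smul, map_one, smul_eq_mul, mul_one]
    rw [abs_lt] at h1
    rw [abs_le] at hm'
    nlinarith
  refine this.trans ?_
  rw [map_smul, smul_eq_mul, he2]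
  field_simp; rfl

lemma gg_le (x : E3) (f g : SF) : |ev x (gg f g)| ≤ ‖gv x f‖ * ‖gv x g‖ := by
  have h := abs_real_inner_le_norm (gv x f) (gv x g)
  rw [inner3] at h
  simpa [gv, gg] using h

lemma gg_amgm (x : E3) (f g : SF) {c : ℝ} (hc : 0 < c) :
    -ev x (gg f g) ≤ c * ev x (g2 f) + (4 * c)⁻¹ * ev x (g2 g) := by
  have h := gg_le x f g
  rw [abs_le] at h
  rw [← gv_sq, ← gv_sq]
  have : ‖gv x f‖ * ‖gv x g‖ ≤ c * ‖gv x f‖ ^ 2 + (4 * c)⁻¹ * ‖gv x g‖ ^ 2 := by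
    have := sq_nonneg (2 * c * ‖gv x f‖ - ‖gv x g‖)
    field_simp
    nlinarith
  linarith

lemma poincare (hc : 0 < cM) {h : SF} (h0 : I h = 0) : I (h ^ 2) ≤ 4 * I (g2 h) := by
  apply le_of_forall_pos_le_add
  intro η hη
  obtain ⟨f, hf, hf2⟩ := poisson hc h0 (η := η / 4) (by positivity)
  have e1 : I (h ^ 2) = - I (gg h f) + I (h * (h - Lap f)) := by
    rw [← I_mul_Lap, ← map_add]; congr 1; ring
  have e2 : - I (gg h f) ≤ 2 * I (g2 h) + (8 : ℝ)⁻¹ * I (g2 f) := by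
    have : I (-gg h f) ≤ I ((2 : ℝ) • g2 h + (8 : ℝ)⁻¹ • g2 f) := I_mono (fun x hx => by
      have := gg_amgm x h f (c := 2) (by norm_num)
      simp; norm_num at this; linarith)
    simpa using this
  have e3 : I (g2 f) ≤ 2 * I (h ^ 2) + 2 * I ((Lap f - h) ^ 2) := by
    have h1 := n2_le_div_curl (tang_Xf f)
    rw [n2_Xf, dv_Xf, cl_Xf] at h1
    have h2 : I (Lap f ^ 2 + 0 ^ 2) ≤ I ((2 : ℝ) • h ^ 2 + (2 : ℝ) • (Lap f - h) ^ 2) := I_mono (fun x hx => by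
      simp; nlinarith [sq_nonneg (ev x (Lap f) - 2 * ev x h)])
    rw [map_add I ((2 : ℝ) • h ^ 2), map_smul, map_smul, smul_eq_mul, smul_eq_mul] at h2
    linarith
  have e4 : I (h * (h - Lap f)) ≤ (4 : ℝ)⁻¹ * I (h ^ 2) + I ((Lap f - h) ^ 2) := by
    have h2 : I (h * (h - Lap f)) ≤ I ((4 : ℝ)⁻¹ • h ^ 2 + (Lap f - h) ^ 2) := I_mono (fun x hx => by
      simp; nlinarith [sq_nonneg (ev x h / 2 + (ev x (Lap f) - ev x h))])
    rwa [map_add, map_smul, smul_eq_mul] at h2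
  linarith

/-- the Hodge decomposition, in approximate form -/
lemma hodge (hc : 0 < cM) {Y : VF} (hY : Tang Y) {η : ℝ} (hη : 0 < η) :
    ∃ h k : SF, I (h ^ 2) ≤ 4 * I (g2 h) ∧ I (k ^ 2) ≤ 4 * I (g2 k) ∧
      I (g2 h) + I (g2 k) ≤ 2 * I (n2 Y) + η ∧
      I (n2 Y) ≤ 2 * (I (k * cl Y) - I (h * dv Y)) + η := by
  obtain ⟨h, h0, h1⟩ := poisson hc (I_dv Y) (η := η / 4) (by positivity)
  obtain ⟨k, k0, k1⟩ := poisson hc (g := - cl Y) (by rw [map_neg, cl, I_dv, neg_zero]) (η := η / 4) (by positivity)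
  set ω : VF := Xf h + rt (Xf k) with hω
  set Z : VF := Y - ω with hZ
  have tω : Tang ω := by
    apply SF.ext'; intro x
    have := dot_ev h x
    simp [hω, Xf, rt]
    linear_combination this
  have tZ : Tang Z := by
    apply SF.ext'; intro x
    have a1 := tang_ev tω x
    have a2 := tang_ev hY x
    simp only [hZ, Pi.sub_apply, map_add, map_mul, map_sub, ev_co, map_zero]
    linear_combination a2 - a1
  have d1 : dv Z = dv Y - Lap h := by
    have := cl_Xf k
    have e : dv Z = dv Y - (dv (Xf h) + dv (rt (Xf k))) := by
      simp only [dv, hZ, hω, Pi.sub_apply, Pi.add_apply, map_sub, map_add]; ring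
    rw [e, dv_Xf]
    unfold cl at this
    rw [this, add_zero]
  have d2 : ∀ x ∈ S2, ev x (cl Z) = ev x (cl Y) + ev x (Lap k) := by
    intro x hx
    have hx' := mem_S2.1 hx
    have e : cl Z = cl Y - (cl (Xf h) + cl (rt (Xf k))) := by
      simp only [cl, dv, rt, hZ, hω, Pi.sub_apply, Pi.add_apply, map_sub, map_add, mul_add, mul_sub, Matrix.cons_val_zero, Matrix.cons_val_one, Matrix.cons_val]
      ring
    have e2 : ev x (cl (rt (Xf k))) = - ev x (Lap k) := by
      have r : rt (rt (Xf k)) = fun i => -((co 0 ^ 2 + co 1 ^ 2 + co 2 ^ 2) * Xf k i) := by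
        have := x_dot_X k
        funext i
        fin_cases i
        · simp [rt, Xf]; linear_combination co 0 * this
        · simp [rt, Xf]; linear_combination co 1 * this
        · simp [rt, Xf]; linear_combination co 2 * this
      unfold cl
      rw [r]
      simp [dv, Xf, Lap]
      linear_combination (-(ev x (X 0 (X 0 k))) - ev x (X 1 (X 1 k)) - ev x (X 2 (X 2 k))) * hx'
    rw [e, map_sub, map_add, cl_Xf, e2]; simp
  have hZs : I (n2 Z) ≤ η / 2 := by
    refine (n2_le_div_curl tZ).trans ?_
    have : I (dv Z ^ 2 + cl Z ^ 2) = I ((Lap h - dv Y) ^ 2) + I ((Lap k - - cl Y) ^ 2) := by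
      rw [← map_add]
      apply I_congr
      intro x hx
      rw [d1]
      simp [d2 x hx]; ring
    linarith
  have n1 : I (n2 ω) = I (g2 h) + I (g2 k) := by
    have c : I (h * dv (rt (Xf k))) = 0 := by
      have := cl_Xf k
      unfold cl at this
      rw [this]; simp
    have c2 : I (h * dv (rt (Xf k))) = - I (X 0 h * rt (Xf k) 0 + X 1 h * rt (Xf k) 1 + X 2 h * rt (Xf k) 2) := by
      simp only [dv, mul_add, map_add, I_parts]; ring
    have : I (n2 ω) = I (g2 h) + I (g2 k) + 2 * I (X 0 h * rt (Xf k) 0 + X 1 h * rt (Xf k) 1 + X 2 h * rt (Xf k) 2) := by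
      rw [← map_add, ← smul_eq_mul, ← map_smul, ← map_add]
      apply I_congr
      intro x hx
      have hx' := mem_S2.1 hx
      have := dot_ev k x
      simp [n2, hω, Xf, rt, g2]
      linear_combination (ev x (X 0 k) ^ 2 + ev x (X 1 k) ^ 2 + ev x (X 2 k) ^ 2) * hx' - (x 0 * ev x (X 0 k) + x 1 * ev x (X 1 k) + x 2 * ev x (X 2 k)) * this
    rw [this]; linarith
  refine ⟨h, k, poincare hc h0, poincare hc k0, ?_, ?_⟩
  · rw [← n1]
    have : I (n2 ω) ≤ I ((2 : ℝ) • n2 Y + (2 : ℝ) • n2 Z) := I_mono (fun x hx => by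
      simp [n2, hZ]
      nlinarith [sq_nonneg (2 * ev x (Y 0) - ev x (ω 0)), sq_nonneg (2 * ev x (Y 1) - ev x (ω 1)), sq_nonneg (2 * ev x (Y 2) - ev x (ω 2))])
    rw [map_add, map_smul, map_smul, smul_eq_mul, smul_eq_mul] at this
    linarith
  · have p1 : I (Y 0 * ω 0 + Y 1 * ω 1 + Y 2 * ω 2) = I (k * cl Y) - I (h * dv Y) := by
      have q1 : I (h * dv Y) = - I (X 0 h * Y 0 + X 1 h * Y 1 + X 2 h * Y 2) := by
        simp only [dv, mul_add, map_add, I_parts]; ring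
      have q2 : I (k * cl Y) = - I (X 0 k * rt Y 0 + X 1 k * rt Y 1 + X 2 k * rt Y 2) := by
        simp only [cl, dv, mul_add, map_add, I_parts]; ring
      rw [q1, q2, ← map_neg, ← map_neg, ← map_sub]
      congr 1
      apply SF.ext'; intro x
      simp [hω, Xf, rt]; ring
    have p2 : I (n2 Y) ≤ I ((2 : ℝ) • (Y 0 * ω 0 + Y 1 * ω 1 + Y 2 * ω 2) + n2 Z) := I_mono (fun x hx => by
      simp [n2, hZ]
      nlinarith [sq_nonneg (ev x (ω 0)), sq_nonneg (ev x (ω 1)), sq_nonneg (ev x (ω 2))])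
    rw [map_add, map_smul, smul_eq_mul, p1] at p2
    linarith

open Classical in
/-- composition with a function of one variable -/
def cmpS (φ : ℝ → ℝ) (f : SF) : SF :=
  if h : ContDiff ℝ (⊤ : ℕ∞) (fun x => φ (f.1 x)) then ⟨fun x => φ (f.1 x), h⟩ else 0

lemma ev_cmpS {φ : ℝ → ℝ} {f : SF} (h : ∀ x, ContDiffAt ℝ (⊤ : ℕ∞) φ (ev x f)) (x : E3) :
    ev x (cmpS φ f) = φ (ev x f) := by
  have h' : ContDiff ℝ (⊤ : ℕ∞) (fun x => φ (f.1 x)) := by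
    rw [contDiff_iff_contDiffAt]
    intro x
    exact (h x).comp x f.smooth.contDiffAt
  simp only [cmpS, h', dif_pos]
  rfl

lemma X_cmpS {φ : ℝ → ℝ} {f : SF} (h : ∀ x, ContDiffAt ℝ (⊤ : ℕ∞) φ (ev x f)) (x : E3) {φ' : ℝ}
    (hd : HasDerivAt φ φ' (ev x f)) (i : Fin 3) :
    ev x (X i (cmpS φ f)) = φ' * ev x (X i f) := by
  have e : (cmpS φ f).1 = fun x => φ (f.1 x) := by
    funext y; exact ev_cmpS h y
  rw [X, ev_Xv, ev_Xv, e]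
  have h1 : HasFDerivAt f.1 (fderiv ℝ f.1 x) x := (f.diff x).hasFDerivAt
  have h2 : HasFDerivAt (fun x => φ (f.1 x)) (φ' • fderiv ℝ f.1 x) x := hd.comp_hasFDerivAt x h1
  rw [h2.fderiv]
  rfl

def sInv (f : SF) : SF := cmpS (fun y => y⁻¹) f

lemma inv_cd {f : SF} (hf : ∀ x, 0 < ev x f) : ∀ x, ContDiffAt ℝ (⊤ : ℕ∞) (fun y : ℝ => y⁻¹) (ev x f) :=
  fun x => contDiffAt_inv ℝ (hf x).ne'

lemma ev_sInv {f : SF} (hf : ∀ x, 0 < ev x f) (x : E3) : ev x (sInv f) = (ev x f)⁻¹ :=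
  ev_cmpS (inv_cd hf) x

lemma sInv_pos {f : SF} (hf : ∀ x, 0 < ev x f) (x : E3) : 0 < ev x (sInv f) := by
  rw [ev_sInv hf]; exact inv_pos.2 (hf x)

lemma mul_sInv {f : SF} (hf : ∀ x, 0 < ev x f) : f * sInv f = 1 := by
  apply SF.ext'; intro x
  rw [map_mul, ev_sInv hf, map_one, mul_inv_cancel₀ (hf x).ne']

lemma X_sInv {f : SF} (hf : ∀ x, 0 < ev x f) (i : Fin 3) : X i (sInv f) = - (sInv f ^ 2 * X i f) := by
  apply SF.ext'; intro x
  have := X_cmpS (inv_cd hf) x (hasDerivAt_inv (hf x).ne') i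
  unfold sInv at *
  rw [this, map_neg, map_mul, map_pow, ev_cmpS (inv_cd hf)]
  simp

lemma gv_sInv {f : SF} (hf : ∀ x, 0 < ev x f) (x : E3) : gv x (sInv f) = (-(ev x (sInv f) ^ 2)) • gv x f := by
  apply E3.ext3 <;> simp [gv, X_sInv hf]

def sLog (f : SF) : SF := cmpS Real.log f

lemma log_cd {f : SF} (hf : ∀ x, 0 < ev x f) : ∀ x, ContDiffAt ℝ (⊤ : ℕ∞) Real.log (ev x f) :=
  fun x => contDiffAt_log.2 (hf x).ne'

lemma ev_sLog {f : SF} (hf : ∀ x, 0 < ev x f) (x : E3) : ev x (sLog f) = Real.log (ev x f) :=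
  ev_cmpS (log_cd hf) x

lemma X_sLog {f : SF} (hf : ∀ x, 0 < ev x f) (i : Fin 3) : X i (sLog f) = sInv f * X i f := by
  apply SF.ext'; intro x
  have := X_cmpS (log_cd hf) x (hasDerivAt_log (hf x).ne') i
  unfold sLog
  rw [this, map_mul, ev_sInv hf]

def sSqrt (f : SF) : SF := cmpS Real.sqrt f

lemma sqrt_cd {f : SF} (hf : ∀ x, 0 < ev x f) : ∀ x, ContDiffAt ℝ (⊤ : ℕ∞) Real.sqrt (ev x f) :=
  fun x => contDiffAt_sqrt (hf x).ne'

lemma ev_sSqrt {f : SF} (hf : ∀ x, 0 < ev x f) (x : E3) : ev x (sSqrt f) = Real.sqrt (ev x f) :=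
  ev_cmpS (sqrt_cd hf) x

lemma gv_sSqrt {f : SF} (hf : ∀ x, 0 < ev x f) (x : E3) : gv x (sSqrt f) = (1 / (2 * √(ev x f))) • gv x f := by
  have := X_cmpS (sqrt_cd hf) x (hasDerivAt_sqrt (hf x).ne')
  apply E3.ext3 <;> simp [gv, sSqrt, this]

/-! the weights -/
def Dw (p : E3) (t : ℝ) : SF :=
  ((1 - t ^ 2) / 2) • ((co 0 - p 0 • 1) ^ 2 + (co 1 - p 1 • 1) ^ 2 + (co 2 - p 2 • 1) ^ 2) + (2 * t ^ 2) • 1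

lemma Dw_pos (p : E3) {t : ℝ} (h0 : 0 < t) (h1 : t < 1) (x : E3) : 0 < ev x (Dw p t) := by
  have : 0 < 1 - t ^ 2 := by nlinarith
  simp [Dw]; positivity

lemma ev_Dw {p x : E3} (hp : p ∈ S2) (hx : x ∈ S2) (t : ℝ) :
    ev x (Dw p t) = (1 - t ^ 2) * (1 - ⟪p, x⟫) + 2 * t ^ 2 := by
  have a := mem_S2.1 hp
  have b := mem_S2.1 hx
  rw [inner3]
  simp [Dw]
  linear_combination (1 - t ^ 2) / 2 * a + (1 - t ^ 2) / 2 * b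

lemma X_Dw (p : E3) (t : ℝ) (i : Fin 3) : X i (Dw p t) = (-(1 - t ^ 2)) • X i (zf p) := by
  apply SF.ext'; intro x
  fin_cases i <;> simp [Dw, X0_zf, X1_zf, X2_zf, map_ofNat] <;> ring

lemma gv_Dw (p : E3) (t : ℝ) (x : E3) : gv x (Dw p t) = (-(1 - t ^ 2)) • gv x (zf p) := by
  apply E3.ext3 <;> simp [gv, X_Dw]

def iD (p : E3) (t : ℝ) : SF := sInv (Dw p t)
def Bw (p : E3) (t : ℝ) : SF := (2 : ℝ) • iD p t
def rho2 (p : E3) (t : ℝ) : SF := (4 * t ^ 2) • iD p t ^ 2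

lemma Lap_zf {p x : E3} : ev x (Lap (zf p)) = -2 * ⟪p, x⟫ := by
  rw [inner3]
  simp [Lap, X0_zf, X1_zf, X2_zf]
  ring

lemma Lap_mul (f g : SF) : Lap (f * g) = f * Lap g + g * Lap f + 2 * gg f g := by
  simp only [Lap, gg, Derivation.leibniz, smul_eq_mul, map_add]; ring


lemma Dw_bd {p : E3} {t : ℝ} (hp : p ∈ S2) (h0 : 0 < t) (h1 : t < 1) {x : E3} (hx : x ∈ S2) : 2 * t ^ 2 ≤ ev x (Dw p t) ∧ ev x (Dw p t) ≤ 2 ∧ 1 - ⟪p, x⟫ ≤ ev x (Dw p t)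
    ∧ (1 - t ^ 2) * (1 - ⟪p, x⟫) ≤ ev x (Dw p t) ∧ ev x (Dw p t) ≤ (1 - ⟪p, x⟫) + 2 * t ^ 2 := by
  rw [ev_Dw hp hx]
  obtain ⟨a, b⟩ := inner_mem hp hx
  have : 0 < 1 - t ^ 2 := by nlinarith
  refine ⟨?_, ?_, ?_, ?_, ?_⟩ <;> nlinarith [sq_nonneg t]

lemma ev_iD {p : E3} {t : ℝ} (hp : p ∈ S2) (h0 : 0 < t) (h1 : t < 1) (x : E3) : ev x (iD p t) = (ev x (Dw p t))⁻¹ := ev_sInv (Dw_pos p h0 h1) x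

lemma Lap_psi {p : E3} {t : ℝ} (hp : p ∈ S2) (h0 : 0 < t) (h1 : t < 1) {x : E3} (hx : x ∈ S2) : ev x (Lap (sLog (Dw p t))) = ev x (rho2 p t) - 1 := by
  have hD := Dw_pos p h0 h1
  have hne := (hD x).ne'
  have hg := gv_zf hp hx
  rw [gv_sq, ev_g2] at hg
  have hL := @Lap_zf p x
  simp only [Lap, map_add] at hL
  have hDx := ev_Dw hp hx t
  have key : ev x (Lap (sLog (Dw p t))) = -(1 - t ^ 2) * ev x (iD p t) * ev x (Lap (zf p))
      - (1 - t ^ 2) ^ 2 * ev x (iD p t) ^ 2 * (ev x (X 0 (zf p)) ^ 2 + ev x (X 1 (zf p)) ^ 2 + ev x (X 2 (zf p)) ^ 2) := by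
    simp [Lap, X_sLog hD, X_sInv hD, X_Dw, iD]
    ring
  rw [key, hg, Lap_zf, rho2, map_smul, map_pow, ev_iD hp h0 h1, smul_eq_mul]
  generalize ev x (Dw p t) = D at *
  field_simp
  rw [hDx]
  ring

lemma g2_psi {p : E3} {t : ℝ} (hp : p ∈ S2) (h0 : 0 < t) (h1 : t < 1) {x : E3} (hx : x ∈ S2) : ev x (g2 (sLog (Dw p t))) =
    (1 + t ^ 2) / t ^ 2 * (t ^ 2 * ev x (Bw p t)) - 1 - ev x (rho2 p t) := by
  have hD := Dw_pos p h0 h1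
  have hne := (hD x).ne'
  have hg := gv_zf hp hx
  rw [gv_sq, ev_g2] at hg
  have hDx := ev_Dw hp hx t
  have key : ev x (g2 (sLog (Dw p t))) = 
      (1 - t ^ 2) ^ 2 * ev x (iD p t) ^ 2 * (ev x (X 0 (zf p)) ^ 2 + ev x (X 1 (zf p)) ^ 2 + ev x (X 2 (zf p)) ^ 2) := by
    simp [g2, X_sLog hD, X_Dw, iD]
    ring
  rw [key, hg, rho2, Bw, map_smul, map_smul, map_pow, ev_iD hp h0 h1, smul_eq_mul, smul_eq_mul]
  generalize ev x (Dw p t) = D at *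
  field_simp
  rw [hDx]
  ring

lemma psi_bd {p : E3} {t : ℝ} (hp : p ∈ S2) (h0 : 0 < t) (h1 : t < 1) {x : E3} (hx : x ∈ S2) : |ev x (sLog (Dw p t)) - Real.log (2 * t)| ≤ - Real.log t := by
  have hD := Dw_pos p h0 h1
  obtain ⟨a, b, _⟩ := Dw_bd hp h0 h1 hx
  rw [ev_sLog hD, ← Real.log_div (hD x).ne' (by positivity), abs_le]
  constructor
  · rw [neg_neg]
    apply Real.log_le_log h0
    rw [le_div_iff₀ (by positivity)]; nlinarith
  · rw [← Real.log_inv]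
    apply Real.log_le_log (div_pos (hD x) (by positivity))
    rw [div_le_iff₀ (by positivity)]
    field_simp; linarith

lemma rho2_nonneg {p : E3} {t : ℝ} (hp : p ∈ S2) (h0 : 0 < t) (h1 : t < 1) (x : E3) : 0 ≤ ev x (rho2 p t) := by
  simp [rho2]; positivity

lemma S_bd {p : E3} {t : ℝ} (hp : p ∈ S2) (h0 : 0 < t) (h1 : t < 1) (h : SF) : I (g2 (sLog (Dw p t)) * h ^ 2) ≤ 4 * (-Real.log t) ^ 2 * I (g2 h) +
    2 * (-Real.log t) * (I (rho2 p t * h ^ 2) + I (h ^ 2)) := by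
  set Λ := -Real.log t with hΛ
  set ψ : SF := sLog (Dw p t) - Real.log (2 * t) • 1 with hψ
  have hgg : ∀ f, gg ψ f = gg (sLog (Dw p t)) f := by intro f; simp [gg, hψ]
  have hg2 : g2 ψ = g2 (sLog (Dw p t)) := by simp [g2, hψ]
  have hL : Lap ψ = Lap (sLog (Dw p t)) := by rw [hψ, Lap_sub, Lap_smul, Lap_one]; simp
  have hb : ∀ x ∈ S2, |ev x ψ| ≤ Λ := by
    intro x hx; have := psi_bd hp h0 h1 hx; simpa [hψ] using this
  have e1 : I (h ^ 2 * Lap (ψ * ψ)) = - I (4 * (ψ * h * gg ψ h)) := by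
    rw [I_mul_Lap]; congr 2
    simp only [gg, Derivation.leibniz, smul_eq_mul, sq]; ring
  have e2 : h ^ 2 * Lap (ψ * ψ) = (2 : ℝ) • (g2 ψ * h ^ 2) + (2 : ℝ) • (ψ * Lap ψ * h ^ 2) := by
    rw [Lap_mul, gg_self]
    apply SF.ext'; intro x; simp [map_ofNat]; ring
  rw [e2, map_add, map_smul, map_smul, smul_eq_mul, smul_eq_mul] at e1
  have e3 : I (-(4 * (ψ * h * gg ψ h)) - (2 : ℝ) • (ψ * Lap ψ * h ^ 2)) ≤ 
      I (g2 ψ * h ^ 2 + (4 * Λ ^ 2) • g2 h + (2 * Λ) • (rho2 p t * h ^ 2 + h ^ 2)) := by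
    apply I_mono
    intro x hx
    have hx1 := hb x hx
    have hx2 := gg_le x ψ h
    have hx3 := rho2_nonneg hp h0 h1 x
    rw [hL]
    simp only [map_sub, map_neg, map_mul, map_add, map_smul, map_pow, smul_eq_mul, Lap_psi hp h0 h1 hx, ← gv_sq, map_ofNat]
    have a1 : -(4 * (ev x ψ * ev x h * ev x (gg ψ h))) ≤ ‖gv x ψ‖ ^ 2 * ev x h ^ 2 + 4 * Λ ^ 2 * ‖gv x h‖ ^ 2 := by
      have : |ev x ψ * ev x h * ev x (gg ψ h)| ≤ Λ * |ev x h| * (‖gv x ψ‖ * ‖gv x h‖) := by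
        rw [abs_mul, abs_mul]
        have hΛ1 : 0 ≤ Λ := (abs_nonneg _).trans hx1
        gcongr
      rw [abs_le] at this
      nlinarith [sq_nonneg (‖gv x ψ‖ * |ev x h| - 2 * Λ * ‖gv x h‖), sq_abs (ev x h)]
    have a2 : -(2 * (ev x ψ * (ev x (rho2 p t) - 1) * ev x h ^ 2)) ≤ 2 * Λ * (ev x (rho2 p t) * ev x h ^ 2 + ev x h ^ 2) := by
      have : |ev x ψ * (ev x (rho2 p t) - 1)| ≤ Λ * (ev x (rho2 p t) + 1) := by
        rw [abs_mul]
        have : |ev x (rho2 p t) - 1| ≤ ev x (rho2 p t) + 1 := by rw [abs_le]; constructor <;> linarith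
        gcongr
        exact (abs_nonneg _).trans hx1
      rw [abs_le] at this
      nlinarith [sq_nonneg (ev x h)]
    linarith
  simp only [map_sub, map_neg, map_add, map_smul, smul_eq_mul] at e3
  rw [← hg2]
  linarith

lemma rho2_main {p : E3} {t : ℝ} (hp : p ∈ S2) (h0 : 0 < t) (h1 : t < 1) (h : SF) : I (rho2 p t * h ^ 2) ≤ 3 * I (h ^ 2) + 10 * (-Real.log t) * I (g2 h) := by
  have hS := S_bd hp h0 h1 h
  set Λ := -Real.log t with hΛ
  have hΛ0 : 0 < Λ := by rw [hΛ]; have := Real.log_neg h0 h1; linarith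
  set ψ : SF := sLog (Dw p t) with hψ
  have e1 : I (h ^ 2 * Lap ψ) = - I (2 * (h * gg ψ h)) := by
    rw [I_mul_Lap]; congr 2
    simp only [gg, Derivation.leibniz, smul_eq_mul, sq]; ring
  have e2 : I (h ^ 2 * Lap ψ) = I (rho2 p t * h ^ 2) - I (h ^ 2) := by
    rw [← map_sub]
    apply I_congr
    intro x hx
    simp only [map_mul, map_sub, map_pow, hψ, Lap_psi hp h0 h1 hx]; ring
  have e3 : I (-(2 * (h * gg ψ h))) ≤ I ((4 * Λ)⁻¹ • (g2 ψ * h ^ 2) + (4 * Λ) • g2 h) := by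
    apply I_mono
    intro x hx
    have hx2 := gg_le x ψ h
    simp only [map_neg, map_mul, map_add, map_smul, map_pow, smul_eq_mul, ← gv_sq, map_ofNat]
    have : |ev x h * ev x (gg ψ h)| ≤ |ev x h| * (‖gv x ψ‖ * ‖gv x h‖) := by
      rw [abs_mul]; gcongr
    rw [abs_le] at this
    have k : 2 * (|ev x h| * (‖gv x ψ‖ * ‖gv x h‖)) ≤ (4 * Λ)⁻¹ * (‖gv x ψ‖ ^ 2 * ev x h ^ 2) + 4 * Λ * ‖gv x h‖ ^ 2 := by
      rw [← sq_abs (ev x h)]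
      field_simp
      nlinarith [sq_nonneg (‖gv x ψ‖ * |ev x h| - 4 * Λ * ‖gv x h‖)]
    linarith
  simp only [map_neg, map_add, map_smul, smul_eq_mul] at e3
  have e4 : (4 * Λ)⁻¹ * I (g2 ψ * h ^ 2) ≤ (4 * Λ)⁻¹ * (4 * Λ ^ 2 * I (g2 h) +
    2 * Λ * (I (rho2 p t * h ^ 2) + I (h ^ 2))) := by gcongr
  have e5 : (4 * Λ)⁻¹ * (4 * Λ ^ 2 * I (g2 h) +
    2 * Λ * (I (rho2 p t * h ^ 2) + I (h ^ 2))) = Λ * I (g2 h) + (I (rho2 p t * h ^ 2) + I (h ^ 2)) / 2 := by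
    field_simp; ring
  linarith

lemma Bw_one {p : E3} {t : ℝ} (hp : p ∈ S2) (h0 : 0 < t) (h1 : t < 1) : I (Bw p t) ≤ (2 + 4 * (-Real.log t)) * I 1 := by
  have hS := S_bd hp h0 h1 1
  have e0 : g2 (1 : SF) = 0 := by simp [g2]
  have hA : I (rho2 p t) = I 1 := by
    have h := I_Lap (sLog (Dw p t))
    have : I (Lap (sLog (Dw p t))) = I (rho2 p t - 1) := I_congr (fun x hx => by rw [Lap_psi hp h0 h1 hx]; simp)
    rw [this, map_sub] at h; linarith
  have hB : I (Bw p t) ≤ I (g2 (sLog (Dw p t)) + 1 + rho2 p t) := by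
    apply I_mono
    intro x hx
    have h3 : 0 < ev x (Bw p t) := by
      simp [Bw, ev_iD hp h0 h1]; exact Dw_pos p h0 h1 x
    rw [map_add, map_add, g2_psi hp h0 h1 hx, map_one]
    have : (1 + t ^ 2) / t ^ 2 * (t ^ 2 * ev x (Bw p t)) = (1 + t ^ 2) * ev x (Bw p t) := by field_simp
    rw [this]
    nlinarith [mul_pos (pow_pos h0 2) h3]
  rw [map_add, map_add, hA] at hB
  rw [e0] at hS
  simp only [one_pow, mul_one, map_zero, mul_zero, zero_add, hA] at hS
  linarith

def qf (p : E3) : SF := co 0 ^ 2 + co 1 ^ 2 + co 2 ^ 2 - zf p ^ 2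

lemma ev_qf' (p x : E3) : ev x (qf p) = x 0 ^ 2 + x 1 ^ 2 + x 2 ^ 2 - ⟪p, x⟫ ^ 2 := by
  simp [qf]

lemma ev_qf (p : E3) {x : E3} (hx : x ∈ S2) : ev x (qf p) = 1 - ⟪p, x⟫ ^ 2 := by
  rw [ev_qf', mem_S2.1 hx]

lemma qf_nonneg {p : E3} (hp : p ∈ S2) (x : E3) : 0 ≤ ev x (qf p) := by
  have a := mem_S2.1 hp
  rw [ev_qf', inner3]
  nlinarith [sq_nonneg (p 0 * x 1 - p 1 * x 0), sq_nonneg (p 0 * x 2 - p 2 * x 0), sq_nonneg (p 1 * x 2 - p 2 * x 1)]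

lemma gv_qf (p x : E3) : gv x (qf p) = (-2 * ⟪p, x⟫) • gv x (zf p) := by
  apply E3.ext3 <;> simp [gv, qf, sq] <;> ring

def Kf (p : E3) (t : ℝ) : SF := sInv (qf p + (t ^ 2) • 1)

lemma qt_pos {p : E3} {t : ℝ} (hp : p ∈ S2) (h0 : 0 < t) (x : E3) : 0 < ev x (qf p + (t ^ 2) • 1) := by
  have := qf_nonneg hp x
  simp; positivity

lemma ev_Kf {p : E3} {t : ℝ} (hp : p ∈ S2) (h0 : 0 < t) (x : E3) : ev x (Kf p t) = (ev x (qf p) + t ^ 2)⁻¹ := by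
  rw [Kf, ev_sInv (qt_pos hp h0)]; simp

lemma neg_S2 {p : E3} (hp : p ∈ S2) : -p ∈ S2 := by
  simpa [S2] using hp

lemma Bw_pos {p : E3} {t : ℝ} (hp : p ∈ S2) (h0 : 0 < t) (h1 : t < 1) (x : E3) : 0 < ev x (Bw p t) := by
  simp [Bw, ev_iD hp h0 h1]; exact Dw_pos p h0 h1 x

lemma ev_Bw {p : E3} {t : ℝ} (hp : p ∈ S2) (h0 : 0 < t) (h1 : t < 1) (x : E3) : ev x (Bw p t) = 2 / ev x (Dw p t) := by
  simp [Bw, ev_iD hp h0 h1, div_eq_mul_inv]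

lemma ev_rho2 {p : E3} {t : ℝ} (x : E3) : ev x (rho2 p t) = t ^ 2 * ev x (Bw p t) ^ 2 := by
  simp [rho2, Bw]; ring

lemma K_half {p : E3} {t : ℝ} (hp : p ∈ S2) (h0 : 0 < t) (h1 : t < 1) {x : E3} (hx : x ∈ S2)
    (hz : 0 ≤ ⟪p, x⟫) : ev x (Kf p t) ≤ ev x (Bw p t) := by
  rw [ev_Kf hp h0, ev_Bw hp h0 h1, inv_eq_one_div]
  have hD := Dw_pos p h0 h1 x
  obtain ⟨_, _, _, _, h5⟩ := Dw_bd hp h0 h1 hx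
  obtain ⟨a, b⟩ := inner_mem hp hx
  have hq := qf_nonneg hp x
  rw [div_le_div_iff₀ (by positivity) hD, ev_qf p hx]
  nlinarith

lemma K_or {p : E3} {t : ℝ} (hp : p ∈ S2) (h0 : 0 < t) (h1 : t < 1) {x : E3} (hx : x ∈ S2) :
    ev x (Kf p t) ≤ ev x (Bw p t) ∨ ev x (Kf p t) ≤ ev x (Bw (-p) t) := by
  rcases le_total 0 ⟪p, x⟫ with h | h
  · exact Or.inl (K_half hp h0 h1 hx h)
  · right
    have := K_half (neg_S2 hp) h0 h1 hx (by rw [inner_neg_left]; linarith)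
    have e : ev x (Kf (-p) t) = ev x (Kf p t) := by
      rw [ev_Kf hp h0, ev_Kf (neg_S2 hp) h0, ev_qf', ev_qf', inner_neg_left, neg_sq]
    rwa [e] at this

lemma K_pos {p : E3} {t : ℝ} (hp : p ∈ S2) (h0 : 0 < t) (x : E3) : 0 < ev x (Kf p t) := sInv_pos (qt_pos hp h0) x

lemma K_le {p : E3} {t : ℝ} (hp : p ∈ S2) (h0 : 0 < t) (h1 : t < 1) {x : E3} (hx : x ∈ S2) :
    ev x (Kf p t) ≤ ev x (Bw p t) + ev x (Bw (-p) t) := by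
  have a := Bw_pos hp h0 h1 x
  have b := Bw_pos (neg_S2 hp) h0 h1 x
  rcases K_or hp h0 h1 hx with h | h <;> linarith

lemma K_le2 {p : E3} {t : ℝ} (hp : p ∈ S2) (h0 : 0 < t) (h1 : t < 1) {x : E3} (hx : x ∈ S2) :
    t ^ 2 * ev x (Kf p t) ^ 2 ≤ ev x (rho2 p t) + ev x (rho2 (-p) t) := by
  have a := Bw_pos hp h0 h1 x
  have b := Bw_pos (neg_S2 hp) h0 h1 x
  have k := K_pos hp h0 x
  rw [ev_rho2, ev_rho2]
  rcases K_or hp h0 h1 hx with h | h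
  · have : t ^ 2 * ev x (Kf p t) ^ 2 ≤ t ^ 2 * ev x (Bw p t) ^ 2 := by gcongr
    nlinarith [mul_pos (pow_pos h0 2) (pow_pos b 2)]
  · have : t ^ 2 * ev x (Kf p t) ^ 2 ≤ t ^ 2 * ev x (Bw (-p) t) ^ 2 := by gcongr
    nlinarith [mul_pos (pow_pos h0 2) (pow_pos a 2)]

lemma I_K1 {p : E3} {t : ℝ} (hp : p ∈ S2) (h0 : 0 < t) (h1 : t < 1) :
    I (Kf p t) ≤ (4 + 8 * (-Real.log t)) * I 1 := by
  have : I (Kf p t) ≤ I (Bw p t + Bw (-p) t) := I_mono (fun x hx => by rw [map_add]; exact K_le hp h0 h1 hx)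
  rw [map_add] at this
  have a := Bw_one hp h0 h1
  have b := Bw_one (neg_S2 hp) h0 h1
  linarith

lemma I_K2 {p : E3} {t : ℝ} (hp : p ∈ S2) (h0 : 0 < t) (h1 : t < 1) (h : SF) :
    I ((t ^ 2) • (Kf p t ^ 2 * h ^ 2)) ≤ 6 * I (h ^ 2) + 20 * (-Real.log t) * I (g2 h) := by
  have : I ((t ^ 2) • (Kf p t ^ 2 * h ^ 2)) ≤ I (rho2 p t * h ^ 2 + rho2 (-p) t * h ^ 2) := I_mono (fun x hx => by
    have := K_le2 hp h0 h1 hx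
    simp only [map_add, map_mul, map_smul, map_pow, smul_eq_mul]
    nlinarith [sq_nonneg (ev x h)])
  rw [map_add] at this
  have a := rho2_main hp h0 h1 h
  have b := rho2_main (neg_S2 hp) h0 h1 h
  linarith

lemma log_t_pos {t : ℝ} (h0 : 0 < t) (h1 : t < 1) : 0 < -Real.log t := by
  have := Real.log_neg h0 h1; linarith

lemma I_g2_nonneg (g : SF) : 0 ≤ I (g2 g) := I_nonneg (fun x _ => ev_g2_nonneg x g)
lemma I_sq_nonneg' (g : SF) : 0 ≤ I (g ^ 2) := by rw [sq]; exact I_sq_nonneg g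

/-- H1 norm squared -/
def H1 (g : SF) : ℝ := I (g ^ 2) + I (g2 g)

lemma H1_nonneg (g : SF) : 0 ≤ H1 g := add_nonneg (I_sq_nonneg' g) (I_g2_nonneg g)

lemma I_K2' {p : E3} {t : ℝ} (hp : p ∈ S2) (h0 : 0 < t) (h1 : t < 1) (h : SF) :
    I ((t ^ 2) • (Kf p t ^ 2 * h ^ 2)) ≤ 20 * ((1 + -Real.log t) * H1 h) := by
  have := I_K2 hp h0 h1 h
  have a := I_sq_nonneg' h
  have b := I_g2_nonneg h
  have c := log_t_pos h0 h1
  unfold H1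
  nlinarith [mul_nonneg c.le a]

lemma hemi {p : E3} {t : ℝ} (hp : p ∈ S2) (h0 : 0 < t) (h1 : t < 1) (F g : SF) (hg : ∀ x ∈ S2, 0 ≤ ev x g) :
    cM * I (F * (qf p * Kf p t * g)) ≤ 30 * √((1 + -Real.log t) * I 1 * H1 g) *
      J (fun x => |ev x F| + |ev x (Xv p F)|) := by
  set H : E3 → ℝ := fun x => 2 * t ^ 2 * ev x (Kf p t) ^ 2 * ev x g + √(ev x (qf p)) * ev x (Kf p t) * ‖gv x g‖ with hH
  have hHc : Continuous H := by rw [hH]; fun_prop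
  have L := lemmaL hp F (qf p * Kf p t * g) (H := H) hHc ?_ ?_ ?_ ?_
  · refine L.trans ?_
    have hJ : 0 ≤ J (fun x => |ev x F| + |ev x (Xv p F)|) := J_nonneg (fun x _ => by positivity)
    have hΛ := log_t_pos h0 h1
    have hM := I_one_nonneg
    have hN := H1_nonneg g
    apply mul_le_mul_of_nonneg_right _ hJ
    set S := √((1 + -Real.log t) * I 1 * H1 g) with hS
    have e0 : J H = 2 * J (fun x => (t * ev x (Kf p t)) * (t * ev x (Kf p t) * ev x g)) +
        J (fun x => (√(ev x (qf p)) * ev x (Kf p t)) * ‖gv x g‖) := by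
      rw [← J_mul, ← J_add (Continuous.continuousOn (by fun_prop)) (Continuous.continuousOn (by fun_prop))]
      congr 1; funext x; simp only [hH]; ring
    have e1 : J (fun x => (t * ev x (Kf p t)) * (t * ev x (Kf p t) * ev x g)) ≤ 
        √(6 * I 1) * √(20 * ((1 + -Real.log t) * H1 g)) := by
      apply J_cs_sqrt (Continuous.continuousOn (by fun_prop)) (Continuous.continuousOn (by fun_prop))
      · have := I_K2 hp h0 h1 1
        have e : g2 (1 : SF) = 0 := by simp [g2]
        rw [e] at this
        simp only [one_pow, map_zero, mul_zero, add_zero, mul_one] at this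
        refine le_trans (le_of_eq ?_) this
        rw [I_def]; congr 1; funext x; simp; ring
      · refine le_trans (le_of_eq ?_) (I_K2' hp h0 h1 g)
        rw [I_def]; congr 1; funext x; simp; ring
    have e2 : J (fun x => (√(ev x (qf p)) * ev x (Kf p t)) * ‖gv x g‖) ≤ √((4 + 8 * (-Real.log t)) * I 1) * √(H1 g) := by
      apply J_cs_sqrt (Continuous.continuousOn (by fun_prop)) (Continuous.continuousOn (by fun_prop))
      · refine le_trans ?_ (I_K1 hp h0 h1)
        rw [I_def]
        apply J_mono (Continuous.continuousOn (by fun_prop)) (Continuous.continuousOn (by fun_prop))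
        intro x hx
        have k := K_pos hp h0 x
        have hq := qf_nonneg hp x
        beta_reduce
        rw [mul_pow, Real.sq_sqrt hq]
        have : ev x (qf p) * ev x (Kf p t) ≤ 1 := by
          rw [ev_Kf hp h0, ← div_eq_mul_inv, div_le_one (by positivity)]; nlinarith [sq_nonneg t]
        nlinarith
      · refine le_trans (le_of_eq ?_) (le_add_of_nonneg_left (I_sq_nonneg' g))
        rw [I_def]; congr 1; funext x; rw [gv_sq]
    rw [← Real.sqrt_mul (by positivity)] at e1 e2
    have k1 : √(6 * I 1 * (20 * ((1 + -Real.log t) * H1 g))) ≤ 11 * S := by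
      rw [hS, show (11 : ℝ) = √(11 ^ 2) by rw [Real.sqrt_sq (by norm_num)], ← Real.sqrt_mul (by norm_num)]
      apply Real.sqrt_le_sqrt
      have : 0 ≤ (1 + -Real.log t) * I 1 * H1 g := by positivity
      nlinarith
    have k2 : √((4 + 8 * (-Real.log t)) * I 1 * H1 g) ≤ 3 * S := by
      rw [hS, show (3 : ℝ) = √(3 ^ 2) by rw [Real.sqrt_sq (by norm_num)], ← Real.sqrt_mul (by norm_num)]
      apply Real.sqrt_le_sqrt
      have : 0 ≤ I 1 * H1 g := by positivity
      nlinarith [mul_nonneg hΛ.le this]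
    have : 0 ≤ S := Real.sqrt_nonneg _
    linarith
  · intro x hx
    have := hg x hx
    have k := K_pos hp h0 x
    have hq := qf_nonneg hp x
    simp only [map_mul]; positivity
  · rw [map_mul, map_mul, ev_qf p hp, real_inner_self_eq_norm_sq]
    have : ‖p‖ = 1 := by simpa [S2] using hp
    rw [this]; simp
  · intro x hx
    have := hg x hx
    have k := K_pos hp h0 x
    simp only [hH]; positivity
  · intro x hx
    have hgx := hg x hx
    have k := K_pos hp h0 x
    have hq := qf_nonneg hp x
    have hz : ‖gv x (zf p)‖ = √(ev x (qf p)) := by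
      rw [ev_qf p hx, ← gv_zf hp hx, Real.sqrt_sq (norm_nonneg _)]
    obtain ⟨a, b⟩ := inner_mem hp hx
    have hκ : qf p * Kf p t = 1 - (t ^ 2) • Kf p t := by
      have := mul_sInv (qt_pos hp h0)
      change (qf p + (t ^ 2) • 1) * Kf p t = 1 at this
      rw [add_mul, smul_mul_assoc, one_mul] at this
      rw [← this]; abel
    have h1' : gv x (qf p * Kf p t) = (t ^ 2 * ev x (Kf p t) ^ 2 * (-2 * ⟪p, x⟫)) • gv x (zf p) := by
      have e : gv x (1 - (t ^ 2) • Kf p t) = (-(t ^ 2)) • gv x (Kf p t) := by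
        apply E3.ext3 <;> simp [gv]
      have e2 : gv x (qf p + (t ^ 2) • 1) = gv x (qf p) := by
        apply E3.ext3 <;> simp [gv]
      rw [hκ, e]
      have := gv_sInv (qt_pos hp h0) x
      change gv x (Kf p t) = (-(ev x (Kf p t) ^ 2)) • _ at this
      rw [this, e2, gv_qf, smul_smul, smul_smul]
      congr 1; ring
    have h2 : ‖gv x (qf p * Kf p t)‖ ≤ 2 * t ^ 2 * ev x (Kf p t) ^ 2 * √(ev x (qf p)) := by
      rw [h1', norm_smul, hz, Real.norm_eq_abs, abs_mul, abs_mul (-2), abs_of_nonneg (by positivity : 0 ≤ t ^ 2 * ev x (Kf p t) ^ 2)]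
      have : |⟪p, x⟫| ≤ 1 := abs_le.2 ⟨a, b⟩
      rw [show |(-2 : ℝ)| = 2 by norm_num]
      have hh : t ^ 2 * ev x (Kf p t) ^ 2 * (2 * |⟪p, x⟫|) ≤ t ^ 2 * ev x (Kf p t) ^ 2 * (2 * 1) := by gcongr
      calc _ ≤ t ^ 2 * ev x (Kf p t) ^ 2 * (2 * 1) * √(ev x (qf p)) := by gcongr
        _ = _ := by ring
    have h3 := gv_mul_le x (qf p * Kf p t) g
    rw [abs_of_nonneg hgx, map_mul, abs_of_nonneg (by positivity)] at h3
    have h4 : ‖gv x (qf p * Kf p t * g)‖ ≤ √(ev x (qf p)) * H x := by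
      refine h3.trans ?_
      have e : ev x g * ‖gv x (qf p * Kf p t)‖ ≤ ev x g * (2 * t ^ 2 * ev x (Kf p t) ^ 2 * √(ev x (qf p))) := by gcongr
      have e' := Real.mul_self_sqrt hq
      simp only [hH]
      nlinarith [mul_nonneg k.le (norm_nonneg (gv x g))]
    rw [← gv_sq, ← ev_qf p hx, ← Real.sq_sqrt hq, ← mul_pow]
    gcongr

/-! families of weights -/
lemma gv_Bw_le {p : E3} {t : ℝ} (hp : p ∈ S2) (h0 : 0 < t) (h1 : t < 1) {x : E3} (hx : x ∈ S2) :
    ‖gv x (Bw p t)‖ ≤ ev x (Bw p t) * √(ev x (Bw p t)) := by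
  have hB := Bw_pos hp h0 h1 x
  have hD := Dw_pos p h0 h1 x
  obtain ⟨_, _, _, h4, h5⟩ := Dw_bd hp h0 h1 hx
  obtain ⟨a, b⟩ := inner_mem hp hx
  apply abs_le_of_sq_le_sq' _ (by positivity) |>.2
  rw [mul_pow, Real.sq_sqrt hB.le]
  have e : gv x (Bw p t) = (2 * (ev x (iD p t)) ^ 2 * (1 - t ^ 2)) • gv x (zf p) := by
    rw [Bw, gv_smul, iD, gv_sInv (Dw_pos p h0 h1), gv_Dw, smul_smul, smul_smul]
    congr 1; ring
  rw [e, norm_smul, mul_pow, gv_zf hp hx, Real.norm_eq_abs, sq_abs, ev_Bw hp h0 h1, ev_iD hp h0 h1]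
  generalize ev x (Dw p t) = D at *
  have key : (1 - t ^ 2) ^ 2 * (1 - ⟪p, x⟫ ^ 2) ≤ 2 * D := by
    have e1 : (1 - t ^ 2) ≤ 1 := by nlinarith
    have e2 : 0 ≤ 1 - t ^ 2 := by nlinarith
    have e3 : (1 - t ^ 2) * (1 + ⟪p, x⟫) ≤ 2 := by nlinarith
    have e4 : 0 ≤ (1 - t ^ 2) * (1 - ⟪p, x⟫) := mul_nonneg e2 (by linarith)
    calc (1 - t ^ 2) ^ 2 * (1 - ⟪p, x⟫ ^ 2) = ((1 - t ^ 2) * (1 - ⟪p, x⟫)) * ((1 - t ^ 2) * (1 + ⟪p, x⟫)) := by ring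
      _ ≤ ((1 - t ^ 2) * (1 - ⟪p, x⟫)) * 2 := by gcongr
      _ ≤ 2 * D := by linarith
  field_simp
  nlinarith

lemma q_Bw_le {p : E3} {t : ℝ} (hp : p ∈ S2) (h0 : 0 < t) (h1 : t < 1) {x : E3} (hx : x ∈ S2) :
    √(ev x (qf p)) * √(ev x (Bw p t)) ≤ 2 := by
  have hB := Bw_pos hp h0 h1 x
  have hD := Dw_pos p h0 h1 x
  obtain ⟨_, _, h3, _, _⟩ := Dw_bd hp h0 h1 hx
  obtain ⟨a, b⟩ := inner_mem hp hx
  rw [← Real.sqrt_mul (qf_nonneg hp x), Real.sqrt_le_left (by norm_num), ev_qf p hx, ev_Bw hp h0 h1, ← mul_div_assoc, div_le_iff₀ hD]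
  nlinarith

structure Wts (m : ℕ) (p : Fin m → E3) (t : Fin m → ℝ) : Prop where
  hp : ∀ i, p i ∈ S2
  h0 : ∀ i, 0 < t i
  h1 : ∀ i, t i < 1

def BB {m : ℕ} (p : Fin m → E3) (t : Fin m → ℝ) : SF := 1 + ∑ i, Bw (p i) (t i)
def bb {m : ℕ} (p : Fin m → E3) (t : Fin m → ℝ) : SF := sInv (BB p t)

section
variable {m : ℕ} {p : Fin m → E3} {t : Fin m → ℝ}

lemma ev_BB (x : E3) : ev x (BB p t) = 1 + ∑ i, ev x (Bw (p i) (t i)) := by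
  simp [BB]

lemma BB_ge (W : Wts m p t) (x : E3) : 1 ≤ ev x (BB p t) := by
  rw [ev_BB]
  have : 0 ≤ ∑ i, ev x (Bw (p i) (t i)) := Finset.sum_nonneg (fun i _ => (Bw_pos (W.hp i) (W.h0 i) (W.h1 i) x).le)
  linarith

lemma BB_pos (W : Wts m p t) (x : E3) : 0 < ev x (BB p t) := lt_of_lt_of_le one_pos (BB_ge W x)

lemma Bw_le_BB (W : Wts m p t) (x : E3) (i : Fin m) : ev x (Bw (p i) (t i)) ≤ ev x (BB p t) := by
  rw [ev_BB]
  have := Finset.single_le_sum (f := fun i => ev x (Bw (p i) (t i)))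
    (fun i _ => (Bw_pos (W.hp i) (W.h0 i) (W.h1 i) x).le) (Finset.mem_univ i)
  linarith

lemma ev_bb (W : Wts m p t) (x : E3) : ev x (bb p t) = (ev x (BB p t))⁻¹ := ev_sInv (BB_pos W) x
lemma bb_pos (W : Wts m p t) (x : E3) : 0 < ev x (bb p t) := sInv_pos (BB_pos W) x
lemma bb_le (W : Wts m p t) (x : E3) : ev x (bb p t) ≤ 1 := by
  rw [ev_bb W]; exact inv_le_one_of_one_le₀ (BB_ge W x)

lemma gv_BB_le (W : Wts m p t) {x : E3} (hx : x ∈ S2) : ‖gv x (BB p t)‖ ≤ ev x (BB p t) * √(ev x (BB p t)) := by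
  have e : gv x (BB p t) = ∑ i, gv x (Bw (p i) (t i)) := by
    let G : SF →+ E3 := AddMonoidHom.mk' (gv x) (gv_add x)
    have h : G (BB p t) = G 1 + ∑ i, G (Bw (p i) (t i)) := by rw [BB, map_add, map_sum]
    have h1 : G 1 = 0 := by
      change gv x 1 = 0
      apply E3.ext3 <;> simp [gv]
    rw [h1, zero_add] at h
    exact h
  rw [e]
  refine (norm_sum_le _ _).trans ?_
  have : ∀ i ∈ Finset.univ, ‖gv x (Bw (p i) (t i))‖ ≤ ev x (Bw (p i) (t i)) * √(ev x (BB p t)) := by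
    intro i _
    refine (gv_Bw_le (W.hp i) (W.h0 i) (W.h1 i) hx).trans ?_
    have := (Bw_pos (W.hp i) (W.h0 i) (W.h1 i) x).le
    have := Bw_le_BB W x i
    gcongr
  refine (Finset.sum_le_sum this).trans ?_
  rw [← Finset.sum_mul, ev_BB]
  gcongr
  linarith

lemma gv_bb_le (W : Wts m p t) {x : E3} (hx : x ∈ S2) : ‖gv x (bb p t)‖ ≤ √(ev x (bb p t)) := by
  have hB := BB_pos W x
  have h := gv_BB_le W hx
  rw [bb, gv_sInv (BB_pos W), norm_smul, norm_neg, ev_sInv (BB_pos W), Real.sqrt_inv]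
  set s := √(ev x (BB p t)) with hs
  have hs0 : 0 < s := Real.sqrt_pos.2 hB
  have hs2 : ev x (BB p t) = s ^ 2 := (Real.sq_sqrt hB.le).symm
  rw [hs2] at h ⊢
  rw [Real.norm_of_nonneg (by positivity)]
  calc _ ≤ ((s ^ 2)⁻¹) ^ 2 * (s ^ 2 * s) := by gcongr
    _ = s⁻¹ := by field_simp

lemma g2_bb_le (W : Wts m p t) {x : E3} (hx : x ∈ S2) : ev x (g2 (bb p t)) ≤ ev x (bb p t) := by
  have h := gv_bb_le W hx
  rw [← gv_sq, ← Real.sq_sqrt (bb_pos W x).le]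
  gcongr

lemma w_bb (W : Wts m p t) {x : E3} (hx : x ∈ S2) : ev x (bb p t) ≤ (1 + ∑ i, ev x (rho2 (p i) (t i)))⁻¹ := by
  rw [ev_bb W]
  have h0 : ∀ i, 0 ≤ ev x (rho2 (p i) (t i)) := fun i => rho2_nonneg (W.hp i) (W.h0 i) (W.h1 i) x
  apply inv_anti₀
  · have := Finset.sum_nonneg (fun i (_ : i ∈ Finset.univ) => h0 i)
    linarith
  · rw [ev_BB]
    gcongr with i
    rw [ev_rho2]
    have hB := Bw_pos (W.hp i) (W.h0 i) (W.h1 i) x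
    have hD := Dw_pos (p i) (W.h0 i) (W.h1 i) x
    obtain ⟨h1, _⟩ := Dw_bd (W.hp i) (W.h0 i) (W.h1 i) hx
    have : t i ^ 2 * ev x (Bw (p i) (t i)) ≤ 1 := by
      rw [ev_Bw (W.hp i) (W.h0 i) (W.h1 i), ← mul_div_assoc, div_le_one hD]; linarith
    nlinarith

def chi {m : ℕ} (p : Fin m → E3) (t : Fin m → ℝ) (i : Fin m) : SF := bb p t * Bw (p i) (t i)

lemma chi_sum (W : Wts m p t) : bb p t + ∑ i, chi p t i = 1 := by
  unfold chi
  rw [← Finset.mul_sum]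
  have := mul_sInv (BB_pos W)
  change BB p t * bb p t = 1 at this
  rw [← this, BB]; ring

lemma chi_pos (W : Wts m p t) (x : E3) (i : Fin m) : 0 < ev x (chi p t i) := by
  rw [chi, map_mul]
  exact mul_pos (bb_pos W x) (Bw_pos (W.hp i) (W.h0 i) (W.h1 i) x)

lemma chi_le (W : Wts m p t) (x : E3) (i : Fin m) : ev x (chi p t i) ≤ 1 := by
  rw [chi, map_mul, ev_bb W, inv_mul_le_iff₀ (BB_pos W x), mul_one]
  exact Bw_le_BB W x i

lemma q_chi (W : Wts m p t) {x : E3} (hx : x ∈ S2) (i : Fin m) :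
    √(ev x (qf (p i))) * ev x (chi p t i) ≤ 2 * √(ev x (bb p t)) := by
  have h1 := q_Bw_le (W.hp i) (W.h0 i) (W.h1 i) hx
  have hc := chi_le W x i
  rw [chi, map_mul] at hc ⊢
  have hB := Bw_pos (W.hp i) (W.h0 i) (W.h1 i) x
  have hb := bb_pos W x
  set s := √(ev x (Bw (p i) (t i))) with hs
  set r := √(ev x (bb p t)) with hr
  have s2 : ev x (Bw (p i) (t i)) = s ^ 2 := (Real.sq_sqrt hB.le).symm
  have r2 : ev x (bb p t) = r ^ 2 := (Real.sq_sqrt hb.le).symm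
  have s0 : 0 ≤ s := Real.sqrt_nonneg _
  have r0 : 0 ≤ r := Real.sqrt_nonneg _
  rw [s2, r2] at hc
  rw [s2, r2]
  have hrs : r * s ≤ 1 := by
    rw [← mul_pow] at hc
    exact (pow_le_one_iff_of_nonneg (by positivity) (by norm_num)).1 hc
  calc √(ev x (qf (p i))) * (r ^ 2 * s ^ 2) = (√(ev x (qf (p i))) * s) * (r * s) * r := by ring
    _ ≤ 2 * 1 * r := by gcongr
    _ = 2 * r := by ring

lemma q_gv_chi (W : Wts m p t) {x : E3} (hx : x ∈ S2) (i : Fin m) :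
    √(ev x (qf (p i))) * ‖gv x (chi p t i)‖ ≤ 4 := by
  have h1 := q_Bw_le (W.hp i) (W.h0 i) (W.h1 i) hx
  have hc := chi_le W x i
  have hB := Bw_pos (W.hp i) (W.h0 i) (W.h1 i) x
  have hb := bb_pos W x
  have g := gv_mul_le x (bb p t) (Bw (p i) (t i))
  rw [abs_of_pos hB, abs_of_pos hb] at g
  have g1 := gv_Bw_le (W.hp i) (W.h0 i) (W.h1 i) hx
  have g2' := gv_bb_le W hx
  change ‖gv x (chi p t i)‖ ≤ _ at g
  rw [chi, map_mul] at hc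
  set s := √(ev x (Bw (p i) (t i))) with hs
  set r := √(ev x (bb p t)) with hr
  have s2 : ev x (Bw (p i) (t i)) = s ^ 2 := (Real.sq_sqrt hB.le).symm
  have r2 : ev x (bb p t) = r ^ 2 := (Real.sq_sqrt hb.le).symm
  have s0 : 0 ≤ s := Real.sqrt_nonneg _
  have r0 : 0 ≤ r := Real.sqrt_nonneg _
  rw [s2, r2] at hc g
  rw [s2] at g1
  have hrs : r * s ≤ 1 := by
    rw [← mul_pow] at hc
    exact (pow_le_one_iff_of_nonneg (by positivity) (by norm_num)).1 hc
  have g3 : ‖gv x (chi p t i)‖ ≤ r ^ 2 * (s ^ 2 * s) + s ^ 2 * r := by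
    refine g.trans ?_
    gcongr
  set Q := √(ev x (qf (p i)))
  have Q0 : 0 ≤ Q := Real.sqrt_nonneg _
  calc Q * ‖gv x (chi p t i)‖ ≤ Q * (r ^ 2 * (s ^ 2 * s) + s ^ 2 * r) := by gcongr
    _ = (Q * s) * (r * s) * (r * s) + (Q * s) * (r * s) := by ring
    _ ≤ 2 * 1 * 1 + 2 * 1 := by gcongr
    _ = 4 := by norm_num
end

lemma X_congr {f g : SF} (h : ∀ x ∈ S2, ev x f = ev x g) (i : Fin 3) :
    ∀ x ∈ S2, ev x (X i f) = ev x (X i g) := by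
  intro x hx
  have h1 := ev_rot_hasDerivAt (e3_mem i) 0 x f
  have h2 := ev_rot_hasDerivAt (e3_mem i) 0 x g
  have e : (fun s => ev (rot (e3 i) s x) f) = (fun s => ev (rot (e3 i) s x) g) := by
    funext s
    exact h _ ((rot_mem (e3_mem i) s).2 hx)
  rw [e] at h1
  have := h1.unique h2
  rw [rot_zero] at this
  exact this

/-- partial derivatives -/
def pd (i : Fin 3) : Derivation ℝ SF SF := Derivation.mk'
  { toFun := fun f => ⟨fun x => fderiv ℝ f.1 x (e3 i), by
      have h : ContDiff ℝ (⊤ : ℕ∞) (fderiv ℝ f.1) := f.smooth.fderiv_right (by simp)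
      exact h.clm_apply contDiff_const⟩
    map_add' := fun f g => by
      apply Subtype.ext; funext x
      change fderiv ℝ (f.1 + g.1) x _ = fderiv ℝ f.1 x _ + fderiv ℝ g.1 x _
      rw [fderiv_add (f.diff x) (g.diff x)]; rfl
    map_smul' := fun c f => by
      apply Subtype.ext; funext x
      change fderiv ℝ (c • f.1) x _ = c • fderiv ℝ f.1 x _
      rw [fderiv_const_smul (f.diff x)]; rfl }
  (fun f g => by
      apply Subtype.ext; funext x
      change fderiv ℝ (f.1 * g.1) x _ = f.1 x * fderiv ℝ g.1 x _ + g.1 x * fderiv ℝ f.1 x _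
      rw [fderiv_mul (f.diff x) (g.diff x)]; rfl)

lemma ev_pd (i : Fin 3) (x : E3) (f : SF) : ev x (pd i f) = fderiv ℝ f.1 x (e3 i) := rfl

lemma fderiv_pd (x v : E3) (f : SF) : fderiv ℝ f.1 x v =
    v 0 * ev x (pd 0 f) + v 1 * ev x (pd 1 f) + v 2 * ev x (pd 2 f) := by
  conv_lhs => rw [E3.eq_sum v]
  simp only [map_add, map_smul, smul_eq_mul, ev_pd]

lemma pd_comm (i j : Fin 3) (f : SF) : pd i (pd j f) = pd j (pd i f) := by
  apply SF.ext'; intro x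
  have h2 : ContDiff ℝ (⊤ : ℕ∞) (fderiv ℝ f.1) := f.smooth.fderiv_right (by simp)
  have key : ∀ i j : Fin 3, ev x (pd i (pd j f)) =
      fderiv ℝ (fderiv ℝ f.1) x (e3 i) (e3 j) := by
    intro a b
    rw [ev_pd]
    change fderiv ℝ (fun x => fderiv ℝ f.1 x (e3 b)) x _ = _
    rw [fderiv_clm_apply (h2.differentiable (by simp) x) (differentiableAt_const _)]
    simp
  have : ContDiffAt ℝ 2 f.1 x := (f.smooth.of_le (WithTop.coe_le_coe.2 (le_top : (2 : ℕ∞) ≤ ⊤))).contDiffAt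
  rw [key, key]
  exact (this.isSymmSndFDerivAt (by simp)).eq _ _

lemma pd_co (i j : Fin 3) : pd i (co j) = if i = j then 1 else 0 := by
  apply SF.ext'; intro x
  rw [ev_pd, fderiv_co]
  split_ifs with h
  · subst h; simp [e3]
  · simp [e3, Ne.symm h]

lemma X_pd0 (f : SF) : X 0 f = co 1 * pd 2 f - co 2 * pd 1 f := by
  apply SF.ext'; intro x
  rw [X, ev_Xv, fderiv_pd]; simp [e3]; ring
lemma X_pd1 (f : SF) : X 1 f = co 2 * pd 0 f - co 0 * pd 2 f := by
  apply SF.ext'; intro x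
  rw [X, ev_Xv, fderiv_pd]; simp [e3]; ring
lemma X_pd2 (f : SF) : X 2 f = co 0 * pd 1 f - co 1 * pd 0 f := by
  apply SF.ext'; intro x
  rw [X, ev_Xv, fderiv_pd]; simp [e3]; ring

def rad (f : SF) : SF := co 0 * pd 0 f + co 1 * pd 1 f + co 2 * pd 2 f

lemma ev_rad (f : SF) (x : E3) : ev x (rad f) = fderiv ℝ f.1 x x := by
  rw [fderiv_pd]; simp [rad]

lemma Lap_pd (f : SF) : Lap f = (co 0^2 + co 1^2 + co 2^2) * (pd 0 (pd 0 f) + pd 1 (pd 1 f) + pd 2 (pd 2 f))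
    - (co 0 * pd 0 (rad f) + co 1 * pd 1 (rad f) + co 2 * pd 2 (rad f)) - rad f := by
  have c10 := pd_comm 1 0 f
  have c20 := pd_comm 2 0 f
  have c21 := pd_comm 2 1 f
  simp only [Lap, rad, X_pd0, X_pd1, X_pd2, map_add, map_sub, Derivation.leibniz, pd_co, smul_eq_mul, c10, c20, c21]
  simp
  ring

def bmp : ContDiffBump (0 : E3) := ⟨1/4, 1/2, by norm_num, by norm_num⟩

def homSF (f : SF) : SF := ⟨fun y => (1 - bmp y) * f.1 (‖y‖⁻¹ • y), by
  change ContDiff ℝ (⊤ : ℕ∞) _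
  rw [contDiff_iff_contDiffAt]
  intro y
  by_cases hy : y = 0
  · have : (fun y : E3 => (1 - bmp y) * f.1 (‖y‖⁻¹ • y)) =ᶠ[nhds y] (fun _ => 0) := by
      rw [hy]
      filter_upwards [bmp.eventuallyEq_one] with z hz
      rw [hz]; simp
    exact contDiffAt_const.congr_of_eventuallyEq this
  · have h1 : ContDiffAt ℝ (⊤ : ℕ∞) (fun y : E3 => ‖y‖⁻¹ • y) y :=
      ((contDiffAt_norm ℝ hy).inv (norm_ne_zero_iff.2 hy)).smul contDiffAt_id
    have h2 : ContDiffAt ℝ (⊤ : ℕ∞) (fun y : E3 => (1 - bmp y)) y :=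
      contDiffAt_const.sub (bmp.contDiff).contDiffAt
    exact h2.mul (ContDiffAt.comp y f.smooth.contDiffAt h1)⟩

lemma homSF_eq (f : SF) {y : E3} (hy : 1/2 < ‖y‖) : (homSF f).1 y = f.1 (‖y‖⁻¹ • y) := by
  change (1 - bmp y) * f.1 (‖y‖⁻¹ • y) = _
  rw [bmp.zero_of_le_dist]
  · simp
  · simp [bmp]; linarith

lemma norm_S2 {x : E3} (hx : x ∈ S2) : ‖x‖ = 1 := by simpa [S2] using hx

lemma homSF_S2 (f : SF) {x : E3} (hx : x ∈ S2) : ev x (homSF f) = ev x f := by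
  have := norm_S2 hx
  rw [ev_def, ev_def, homSF_eq f (by rw [this]; norm_num), this]; simp

lemma rad_homSF (f : SF) {y : E3} (hy : 1/2 < ‖y‖) : ev y (rad (homSF f)) = 0 := by
  rw [ev_rad]
  have h1 : HasDerivAt (fun s : ℝ => (1 + s) • y) y 0 := by
    simpa using ((hasDerivAt_id (0:ℝ)).const_add 1).smul_const y
  have h2 : HasFDerivAt (homSF f).1 (fderiv ℝ (homSF f).1 y) ((1 + (0:ℝ)) • y) := by
    simpa using ((homSF f).diff y).hasFDerivAt
  have h3 := h2.comp_hasDerivAt (0:ℝ) h1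
  have hc : ContinuousAt (fun s : ℝ => ‖(1 + s) • y‖) 0 := by fun_prop
  have hev : ∀ᶠ s : ℝ in nhds 0, 1/2 < ‖(1 + s) • y‖ := by
    apply hc.eventually_const_lt
    simpa using hy
  have hev2 : ∀ᶠ s : ℝ in nhds 0, -1 < s := eventually_gt_nhds (by norm_num)
  have h4 : ((homSF f).1 ∘ fun s : ℝ => (1 + s) • y) =ᶠ[nhds 0] (fun _ => f.1 (‖y‖⁻¹ • y)) := by
    filter_upwards [hev, hev2] with s hs hs2
    have hp : 0 < 1 + s := by linarith
    simp only [Function.comp]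
    rw [homSF_eq f hs, norm_smul, Real.norm_eq_abs, abs_of_pos hp, smul_smul]
    field_simp
  exact h3.unique ((hasDerivAt_const (0:ℝ) _).congr_of_eventuallyEq h4)

lemma near_S2 {x : E3} (hx : x ∈ S2) : ∀ᶠ y in nhds x, 1/2 < ‖y‖ := by
  have hc : ContinuousAt (fun y : E3 => ‖y‖) x := by fun_prop
  apply hc.eventually_const_lt
  change 1/2 < ‖x‖
  rw [norm_S2 hx]; norm_num

lemma pd_rad_homSF (f : SF) {x : E3} (hx : x ∈ S2) (i : Fin 3) : ev x (pd i (rad (homSF f))) = 0 := by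
  rw [ev_pd]
  have : (rad (homSF f)).1 =ᶠ[nhds x] (fun _ => 0) := by
    filter_upwards [near_S2 hx] with y hy
    exact rad_homSF f hy
  rw [this.fderiv_eq]; simp

lemma Lap_homSF (f : SF) {x : E3} (hx : x ∈ S2) :
    ev x (Lap f) = ev x (pd 0 (pd 0 (homSF f))) + ev x (pd 1 (pd 1 (homSF f))) + ev x (pd 2 (pd 2 (homSF f))) := by
  have e : ∀ i, ev x (X i (X i f)) = ev x (X i (X i (homSF f))) := fun i =>
    X_congr (X_congr (fun y hy => (homSF_S2 f hy).symm) i) i x hx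
  have h1 : ev x (Lap f) = ev x (Lap (homSF f)) := by
    simp only [Lap, map_add, e]
  rw [h1, Lap_pd]
  have hr := rad_homSF f (y := x) (by rw [norm_S2 hx]; norm_num)
  have hx' := mem_S2.1 hx
  simp only [map_add, map_sub, map_mul, map_pow, pd_rad_homSF f hx, hr, ev_co, hx']
  ring

/-- vector map with given smooth components -/
def vec (U : Fin 3 → SF) : E3 → E3 := fun y => WithLp.toLp 2 (fun j => (U j).1 y)

lemma vec_diff (U : Fin 3 → SF) (y : E3) : DifferentiableAt ℝ (vec U) y := by
  rw [differentiableAt_euclidean]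
  intro j
  exact (U j).diff y

lemma vec_fderiv (U : Fin 3 → SF) (y v : E3) (j : Fin 3) :
    (fderiv ℝ (vec U) y v) j = fderiv ℝ (U j).1 y v := by
  have h := ((EuclideanSpace.proj j : E3 →L[ℝ] ℝ).hasFDerivAt.comp y (vec_diff U y).hasFDerivAt)
  have e : ((EuclideanSpace.proj j : E3 →L[ℝ] ℝ) ∘ vec U) = (U j).1 := rfl
  rw [e] at h
  rw [h.fderiv]; rfl

/-- `u` has components `U` on the sphere -/
def CRep (u : E3 → E3) (U : Fin 3 → SF) : Prop := ∀ x ∈ S2, ∀ j, u x j = ev x (U j)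

lemma CRep.near {u : E3 → E3} {U : Fin 3 → SF} (h : CRep u U) {y : E3} (hy : 1/2 < ‖y‖) :
    homExt u y = vec (fun j => homSF (U j)) y := by
  have hm : ‖y‖⁻¹ • y ∈ S2 := by
    have : ‖y‖ ≠ 0 := by intro h; rw [h] at hy; norm_num at hy
    simp [S2, norm_smul, this]
  ext j
  change u (‖y‖⁻¹ • y) j = (homSF (U j)).1 y
  rw [h _ hm, homSF_eq _ hy]; rfl

lemma near_near {y : E3} (hy : 1/2 < ‖y‖) : ∀ᶠ z in nhds y, 1/2 < ‖z‖ := by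
  have hc : ContinuousAt (fun y : E3 => ‖y‖) y := by fun_prop
  exact hc.eventually_const_lt hy

lemma CRep.fd {u : E3 → E3} {U : Fin 3 → SF} (h : CRep u U) {y : E3} (hy : 1/2 < ‖y‖) (i j : Fin 3) :
    (fderiv ℝ (homExt u) y (e3 i)) j = ev y (pd i (homSF (U j))) := by
  have e : homExt u =ᶠ[nhds y] vec (fun j => homSF (U j)) := by
    filter_upwards [near_near hy] with z hz
    exact h.near hz
  rw [e.fderiv_eq, vec_fderiv]; rfl

lemma CRep.lap {u : E3 → E3} {U : Fin 3 → SF} (h : CRep u U) {x : E3} (hx : x ∈ S2) (j : Fin 3) :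
    (sphLap u x) j = ev x (Lap (U j)) := by
  have hx2 : 1/2 < ‖x‖ := by rw [norm_S2 hx]; norm_num
  have e : ∀ i, (fderiv ℝ (fun y => fderiv ℝ (homExt u) y (e3 i)) x (e3 i)) j = ev x (pd i (pd i (homSF (U j)))) := by
    intro i
    have e : (fun y => fderiv ℝ (homExt u) y (e3 i)) =ᶠ[nhds x] vec (fun j => pd i (homSF (U j))) := by
      filter_upwards [near_near hx2] with z hz
      ext j
      exact h.fd hz i j
    rw [e.fderiv_eq, vec_fderiv]; rfl
  rw [Lap_homSF _ hx, sphLap]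
  simp [Fin.sum_univ_three, e]

lemma pd_dot {f : SF} {x : E3} (hx : x ∈ S2) : x 0 * ev x (pd 0 (homSF f)) + x 1 * ev x (pd 1 (homSF f)) + x 2 * ev x (pd 2 (homSF f)) = 0 := by
  have hr := rad_homSF f (y := x) (by rw [norm_S2 hx]; norm_num)
  simpa [rad] using hr

lemma X_hom {f : SF} {x : E3} (hx : x ∈ S2) (i : Fin 3) : ev x (X i f) = ev x (X i (homSF f)) :=
  X_congr (fun y hy => (homSF_S2 f hy).symm) i x hx

lemma g2_hom {f : SF} {x : E3} (hx : x ∈ S2) : ev x (g2 f) =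
    ev x (pd 0 (homSF f))^2 + ev x (pd 1 (homSF f))^2 + ev x (pd 2 (homSF f))^2 := by
  have h := pd_dot (f := f) hx
  have hx' := mem_S2.1 hx
  simp only [g2, map_add, map_pow, X_hom (f := f) hx]
  simp only [X_pd0, X_pd1, X_pd2, map_sub, map_mul, ev_co]
  generalize ev x (pd 0 (homSF f)) = a at *
  generalize ev x (pd 1 (homSF f)) = b at *
  generalize ev x (pd 2 (homSF f)) = c at *
  linear_combination (a^2+b^2+c^2) * hx' - (x 0 * a + x 1 * b + x 2 * c) * h

def AA (U : Fin 3 → SF) : SF := g2 (U 0) + g2 (U 1) + g2 (U 2)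

lemma CRep.en {u : E3 → E3} {U : Fin 3 → SF} (h : CRep u U) {x : E3} (hx : x ∈ S2) :
    enDensity u x = ev x (AA U) := by
  have hx2 : 1/2 < ‖x‖ := by rw [norm_S2 hx]; norm_num
  simp only [enDensity, norm3, h.fd hx2, Fin.sum_univ_three, AA, map_add, g2_hom hx]
  ring

/-- `x · (∇f × ∇g)` expressed through the Killing fields -/
def cr (f g : SF) : SF := - (X 0 f * (rt (Xf g)) 0 + X 1 f * (rt (Xf g)) 1 + X 2 f * (rt (Xf g)) 2)

lemma cr_hom {f g : SF} {x : E3} (hx : x ∈ S2) : ev x (cr f g) =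
    x 0 * (ev x (pd 1 (homSF f)) * ev x (pd 2 (homSF g)) - ev x (pd 2 (homSF f)) * ev x (pd 1 (homSF g)))
    + x 1 * (ev x (pd 2 (homSF f)) * ev x (pd 0 (homSF g)) - ev x (pd 0 (homSF f)) * ev x (pd 2 (homSF g)))
    + x 2 * (ev x (pd 0 (homSF f)) * ev x (pd 1 (homSF g)) - ev x (pd 1 (homSF f)) * ev x (pd 0 (homSF g))) := by
  have hx' := mem_S2.1 hx
  simp only [cr, rt, Xf, Matrix.cons_val_zero, Matrix.cons_val_one, Matrix.cons_val, map_neg, map_add, map_mul, map_sub, ev_co, X_hom (f := f) hx, X_hom (f := g) hx]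
  simp only [X_pd0, X_pd1, X_pd2, map_sub, map_mul, ev_co]
  generalize ev x (pd 0 (homSF f)) = a at *
  generalize ev x (pd 1 (homSF f)) = b at *
  generalize ev x (pd 2 (homSF f)) = c at *
  generalize ev x (pd 0 (homSF g)) = a' at *
  generalize ev x (pd 1 (homSF g)) = b' at *
  generalize ev x (pd 2 (homSF g)) = c' at *
  linear_combination (x 0 * (b * c' - c * b') + x 1 * (c * a' - a * c') + x 2 * (a * b' - b * a')) * hx'

def Jc (U : Fin 3 → SF) : SF := U 0 * cr (U 1) (U 2) + U 1 * cr (U 2) (U 0) + U 2 * cr (U 0) (U 1)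

lemma CRep.jac {u : E3 → E3} {U : Fin 3 → SF} (h : CRep u U) {x : E3} (hx : x ∈ S2) :
    jacobian u x = ev x (Jc U) := by
  have hx2 : 1/2 < ‖x‖ := by rw [norm_S2 hx]; norm_num
  simp only [jacobian, det3, h.fd hx2, h x hx, Fin.sum_univ_three, Jc, map_add, map_mul, cr_hom hx]
  simp [e3]
  ring

def tau (U : Fin 3 → SF) (j : Fin 3) : SF := Lap (U j) + AA U * U j

lemma CRep.tens {u : E3 → E3} {U : Fin 3 → SF} (h : CRep u U) {x : E3} (hx : x ∈ S2) :
    ‖tension u x‖ ^ 2 = ev x (tau U 0 ^ 2 + tau U 1 ^ 2 + tau U 2 ^ 2) := by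
  have e : ∀ j, tension u x j = ev x (tau U j) := by
    intro j
    simp [tension, tau, h.lap hx, h.en hx, h x hx]
  rw [norm3]; simp [e]

lemma rep_of_smooth {u : E3 → E3} (hu : ContDiff ℝ (⊤ : ℕ∞) u) : ∃ U, CRep u U :=
  ⟨fun j => ⟨fun y => u y j, by
    change ContDiff ℝ (⊤ : ℕ∞) _
    exact (contDiff_euclidean.1 hu) j⟩, fun x hx j => rfl⟩

def Nm (p : E3) (t : ℝ) (j : Fin 3) : SF :=
  p j • ((-(1 - t^2)) • 1 + ((1 - t)^2) • zf p) + (2 * t) • co j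

def Mm (p : E3) (t : ℝ) (j : Fin 3) : SF := iD p t * Nm p t j

lemma X_Nm (p : E3) (t : ℝ) (i j : Fin 3) : X i (Nm p t j) =
    (p j * (1 - t)^2) • X i (zf p) + (2 * t) • X i (co j) := by
  simp [Nm, smul_smul]

lemma X_Mm {p : E3} {t : ℝ} (hp : p ∈ S2) (h0 : 0 < t) (h1 : t < 1) (x : E3) (i j : Fin 3) :
    ev x (X i (Mm p t j)) = (ev x (Dw p t))⁻¹ ^ 2 * (ev x (Dw p t) * ((p j * (1 - t)^2) * ev x (X i (zf p)) + (2 * t) * ev x (X i (co j)))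
      + (1 - t^2) * ev x (Nm p t j) * ev x (X i (zf p))) := by
  have hD := Dw_pos p h0 h1 x
  rw [Mm, Derivation.leibniz, X_Nm, iD, X_sInv (Dw_pos p h0 h1), X_Dw]
  simp only [map_add, map_mul, map_smul, smul_eq_mul, map_neg, map_pow, ev_sInv (Dw_pos p h0 h1)]
  generalize ev x (Dw p t) = D at *
  field_simp

lemma AA_Mm {p : E3} {t : ℝ} (hp : p ∈ S2) (h0 : 0 < t) (h1 : t < 1) {x : E3} (hx : x ∈ S2) :
    ev x (AA (Mm p t)) = 2 * ev x (rho2 p t) := by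
  have hD := Dw_pos p h0 h1 x
  have hDe := ev_Dw hp hx t
  have hx' := mem_S2.1 hx
  have hp' := mem_S2.1 hp
  have hz := inner3 p x
  have e0 : ev x (X 0 (zf p)) = p 2 * x 1 - p 1 * x 2 := by rw [X0_zf]; simp
  have e1 : ev x (X 1 (zf p)) = p 0 * x 2 - p 2 * x 0 := by rw [X1_zf]; simp
  have e2 : ev x (X 2 (zf p)) = p 1 * x 0 - p 0 * x 1 := by rw [X2_zf]; simp
  have eN : ∀ j, ev x (Nm p t j) = p j * (-(1 - t^2) + (1-t)^2 * ⟪p, x⟫) + 2 * t * x j := by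
    intro j; simp [Nm]; ring
  have erho : ev x (rho2 p t) = 4 * t^2 * (ev x (Dw p t))⁻¹ ^ 2 := by
    simp [rho2, ev_iD hp h0 h1]
  rw [erho]
  simp only [AA, g2, map_add, map_pow, X_Mm hp h0 h1]
  simp only [X00, X01, X02, X10c, X11, X12, X20c, X21c, X22, map_zero, map_neg, ev_co]
  generalize ev x (Dw p t) = D at *
  generalize ⟪p, x⟫ = z at *
  have q0 : ev x (X 0 (zf p))^2 + ev x (X 1 (zf p))^2 + ev x (X 2 (zf p))^2 = 1 - z^2 := by
    rw [e0, e1, e2, hz]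
    linear_combination (x 0 ^ 2 + x 1 ^ 2 + x 2 ^ 2) * hp' + hx'
  have S1 : ∀ z0 z1 z2 : ℝ, z0 = p 2 * x 1 - p 1 * x 2 → z1 = p 0 * x 2 - p 2 * x 0 → z2 = p 1 * x 0 - p 0 * x 1 →
     z0^2+z1^2+z2^2 = 1 - z^2 →
     (((p 0 * (1 - t)^2) * z0)^2 + ((p 0 * (1 - t)^2) * z1 + (2 * t) * x 2)^2 + ((p 0 * (1 - t)^2) * z2 + (2 * t) * (-x 1))^2)
    + (((p 1 * (1 - t)^2) * z0 + (2 * t) * (-x 2))^2 + ((p 1 * (1 - t)^2) * z1)^2 + ((p 1 * (1 - t)^2) * z2 + (2 * t) * (x 0))^2)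
    + (((p 2 * (1 - t)^2) * z0 + (2 * t) * (x 1))^2 + ((p 2 * (1 - t)^2) * z1 + (2 * t) * (-x 0))^2 + ((p 2 * (1 - t)^2) * z2)^2)
      = (1-t^2)^2 * (1 - z^2) + 8 * t^2 := by
    intro z0 z1 z2 h0 h1 h2 h3
    linear_combination ((1-t)^4 * (z0^2+z1^2+z2^2)) * hp' + ((1-t)^4 + 4*t*(1-t)^2) * h3 + 8 * t^2 * hx' + (-4*t*(1-t)^2 * z0) * h0 + (-4*t*(1-t)^2 * z1) * h1 + (-4*t*(1-t)^2 * z2) * h2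
  have S2' : ∀ z0 z1 z2 : ℝ, z0 = p 2 * x 1 - p 1 * x 2 → z1 = p 0 * x 2 - p 2 * x 0 → z2 = p 1 * x 0 - p 0 * x 1 →
     z0^2+z1^2+z2^2 = 1 - z^2 → ∀ n0 n1 n2 : ℝ, (∀ k : ℝ, True) →
     n0 = p 0 * (-(1 - t^2) + (1-t)^2 * z) + 2 * t * x 0 → n1 = p 1 * (-(1 - t^2) + (1-t)^2 * z) + 2 * t * x 1 →
     n2 = p 2 * (-(1 - t^2) + (1-t)^2 * z) + 2 * t * x 2 →
     n0 * (((p 0 * (1 - t)^2) * z0) * z0 + ((p 0 * (1 - t)^2) * z1 + (2 * t) * x 2) * z1 + ((p 0 * (1 - t)^2) * z2 + (2 * t) * (-x 1)) * z2)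
    + n1 * (((p 1 * (1 - t)^2) * z0 + (2 * t) * (-x 2)) * z0 + ((p 1 * (1 - t)^2) * z1) * z1 + ((p 1 * (1 - t)^2) * z2 + (2 * t) * (x 0)) * z2)
    + n2 * (((p 2 * (1 - t)^2) * z0 + (2 * t) * (x 1)) * z0 + ((p 2 * (1 - t)^2) * z1 + (2 * t) * (-x 0)) * z1 + ((p 2 * (1 - t)^2) * z2) * z2)
      = - (1-t^2) * (1 - z^2) * D := by
    intro z0 z1 z2 h0 h1 h2 h3 n0 n1 n2 _ k0 k1 k2
    have a1 : n0 * p 0 + n1 * p 1 + n2 * p 2 = -(1 - t^2) + (1-t)^2 * z + 2 * t * z := by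
      rw [k0, k1, k2, hz]; linear_combination (-(1 - t^2) + (1-t)^2 * (p 0 * x 0 + p 1 * x 1 + p 2 * x 2)) * hp'
    have a2 : n0 * (x 2 * z1 - x 1 * z2) + n1 * (x 0 * z2 - x 2 * z0) + n2 * (x 1 * z0 - x 0 * z1)
        = (-(1 - t^2) + (1-t)^2 * z) * (1 - z^2) := by
      rw [k0, k1, k2]
      linear_combination (-(1 - t^2) + (1-t)^2 * z) * (h3 - z0 * h0 - z1 * h1 - z2 * h2)
    rw [hDe]
    linear_combination (1-t)^2 * (z0^2+z1^2+z2^2) * a1 + 2 * t * a2 + (1-t)^2 * (-(1 - t^2) + (1-t)^2 * z + 2 * t * z) * h3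
  have S3 : ∀ n0 n1 n2 : ℝ,
     n0 = p 0 * (-(1 - t^2) + (1-t)^2 * z) + 2 * t * x 0 → n1 = p 1 * (-(1 - t^2) + (1-t)^2 * z) + 2 * t * x 1 →
     n2 = p 2 * (-(1 - t^2) + (1-t)^2 * z) + 2 * t * x 2 → n0^2+n1^2+n2^2 = D^2 := by
    intro n0 n1 n2 k0 k1 k2
    rw [k0, k1, k2, hDe]
    linear_combination (-(1 - t^2) + (1-t)^2 * z)^2 * hp' + 4*t^2*hx' - 4 * t * (-(1 - t^2) + (1-t)^2 * z) * hz
  have T1 := S1 _ _ _ e0 e1 e2 q0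
  have T2 := S2' _ _ _ e0 e1 e2 q0 _ _ _ (fun _ => trivial) (eN 0) (eN 1) (eN 2)
  have T3 := S3 _ _ _ (eN 0) (eN 1) (eN 2)
  clear S1 S2' S3
  generalize ev x (X 0 (zf p)) = z0 at *
  generalize ev x (X 1 (zf p)) = z1 at *
  generalize ev x (X 2 (zf p)) = z2 at *
  generalize ev x (Nm p t 0) = n0 at *
  generalize ev x (Nm p t 1) = n1 at *
  generalize ev x (Nm p t 2) = n2 at *
  clear e0 e1 e2 eN hDe hz hp' hx' erho
  have hDD : D⁻¹ * D = 1 := inv_mul_cancel₀ hD.ne'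
  generalize D⁻¹ = k at *
  have e : ∀ P : ℝ, P = D^2 * (8 * t^2) → k^4 * P = 2 * (4 * t^2 * k^2) := by
    intro P hP; rw [hP]; linear_combination 8*t^2*k^2 * (k*D+1) * hDD
  rw [← e _ rfl]
  linear_combination k^4 * (D^2 * T1 + 2 * (1-t^2) * D * T2 + (1-t^2)^2 * (z0^2+z1^2+z2^2) * T3 + (1-t^2)^2 * D^2 * q0)

lemma mob_rep {p : E3} {t : ℝ} (hp : p ∈ S2) (h0 : 0 < t) (h1 : t < 1) : CRep (mobius p t⁻¹) (Mm p t) := by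
  intro x hx j
  have hD := Dw_pos p h0 h1 x
  have hDe := ev_Dw hp hx t
  have hc : (1 + ⟪x, p⟫) + t⁻¹ ^ 2 * (1 - ⟪x, p⟫) = t⁻¹^2 * ev x (Dw p t) := by
    rw [hDe, real_inner_comm]; field_simp; ring
  rw [mobius, hc]
  simp only [Mm, Nm, map_mul, ev_iD hp h0 h1, map_add, map_smul, smul_eq_mul, ev_zf, ev_co, map_one]
  simp only [PiLp.smul_apply, PiLp.add_apply, PiLp.sub_apply, smul_eq_mul]
  rw [real_inner_comm p x]
  generalize ev x (Dw p t) = D at *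
  field_simp
  ring

lemma confSq_eq {p : E3} {r : ℝ} (hp : p ∈ S2) (h0 : 0 < Real.tan (r/2)) (h1 : Real.tan (r/2) < 1) {x : E3} (hx : x ∈ S2) :
    confSq p r x = ev x (rho2 p (Real.tan (r/2))) := by
  rw [confSq, mobiusDil, (mob_rep hp h0 h1).en hx, AA_Mm hp h0 h1 hx]; ring

lemma tan_half {r : ℝ} (hr : r ∈ Set.Ioo 0 (π/2)) : 0 < Real.tan (r/2) ∧ Real.tan (r/2) < 1 ∧ -Real.log (Real.tan (r/2)) ≤ 1 + |Real.log r| := by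
  have hpi := Real.pi_pos
  have h0 : 0 < r / 2 := by linarith [hr.1]
  have h2 : r / 2 < π / 4 := by linarith [hr.2]
  have hp : 0 < Real.tan (r/2) := Real.tan_pos_of_pos_of_lt_pi_div_two h0 (by linarith)
  refine ⟨hp, ?_, ?_⟩
  · rw [← Real.tan_pi_div_four]
    exact Real.tan_lt_tan_of_lt_of_lt_pi_div_two (by linarith) (by linarith) h2
  · have h3 : r / 2 ≤ Real.tan (r/2) := (Real.lt_tan h0 (by linarith)).le
    have h4 := Real.log_le_log h0 h3
    rw [Real.log_div hr.1.ne' (by norm_num)] at h4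
    have h5 : Real.log 2 ≤ 1 := by
      have := Real.log_two_lt_d9; linarith
    have := neg_abs_le (Real.log r)
    linarith

def Vc (s : ℝ) (f g h : SF) : VF := fun i => Xf f i - s • (g * rt (Xf h) i - h * rt (Xf g) i)

lemma Xf0 (f : SF) : Xf f 0 = X 0 f := rfl
lemma Xf1 (f : SF) : Xf f 1 = X 1 f := rfl
lemma Xf2 (f : SF) : Xf f 2 = X 2 f := rfl
lemma rt0 (Y : VF) : rt Y 0 = co 1 * Y 2 - co 2 * Y 1 := rfl
lemma rt1 (Y : VF) : rt Y 1 = co 2 * Y 0 - co 0 * Y 2 := rfl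
lemma rt2 (Y : VF) : rt Y 2 = co 0 * Y 1 - co 1 * Y 0 := rfl

lemma tang_Vc (s : ℝ) (f g h : SF) : Tang (Vc s f g h) := by
  have := x_dot_X f
  simp only [Tang, Vc, Xf0, Xf1, Xf2, rt0, rt1, rt2]
  simp only [Algebra.smul_def]
  linear_combination this

lemma cr_anti (f g : SF) : cr f g = - cr g f := by
  simp only [cr, Xf0, Xf1, Xf2, rt0, rt1, rt2]; ring

lemma cl_zero (f : SF) : X 0 (rt (Xf f) 0) + X 1 (rt (Xf f) 1) + X 2 (rt (Xf f) 2) = 0 := cl_Xf f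

lemma dv_Vc (s : ℝ) (f g h : SF) : dv (Vc s f g h) = Lap f + (2 * s) • cr g h := by
  have h1 := cl_zero g
  have h2 := cl_zero h
  have h3 := cr_anti g h
  simp only [cr] at h3
  have e : ∀ i, X i (Vc s f g h i) = X i (Xf f i) - s • (g * X i (rt (Xf h) i) + rt (Xf h) i * X i g
      - (h * X i (rt (Xf g) i) + rt (Xf g) i * X i h)) := by
    intro i; simp [Vc]
  simp only [dv, e, Lap, cr, Xf0, Xf1, Xf2]
  simp only [Algebra.smul_def, map_mul, map_ofNat]
  linear_combination (-(algebraMap ℝ SF s) * g) * h2 + (algebraMap ℝ SF s * h) * h1 - algebraMap ℝ SF s * h3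

def r2 : SF := co 0^2 + co 1^2 + co 2^2

lemma X_r2 (i : Fin 3) : X i r2 = 0 := by
  fin_cases i <;> simp [r2, Derivation.leibniz_pow] <;> ring

lemma cl_Vc (s : ℝ) (f g h : SF) : cl (Vc s f g h) = s • (r2 * (g * Lap h - h * Lap g)) := by
  have h1 := x_dot_X g
  have h2 := x_dot_X h
  have e0 : rt (Vc s f g h) 0 = rt (Xf f) 0 + s • (r2 * (g * X 0 h - h * X 0 g)) := by
    simp only [Vc, r2, Xf0, Xf1, Xf2, rt0, rt1, rt2, Algebra.smul_def]
    linear_combination (-(algebraMap ℝ SF s) * g * co 0) * h2 + (algebraMap ℝ SF s * h * co 0) * h1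
  have e1 : rt (Vc s f g h) 1 = rt (Xf f) 1 + s • (r2 * (g * X 1 h - h * X 1 g)) := by
    simp only [Vc, r2, Xf0, Xf1, Xf2, rt0, rt1, rt2, Algebra.smul_def]
    linear_combination (-(algebraMap ℝ SF s) * g * co 1) * h2 + (algebraMap ℝ SF s * h * co 1) * h1
  have e2 : rt (Vc s f g h) 2 = rt (Xf f) 2 + s • (r2 * (g * X 2 h - h * X 2 g)) := by
    simp only [Vc, r2, Xf0, Xf1, Xf2, rt0, rt1, rt2, Algebra.smul_def]
    linear_combination (-(algebraMap ℝ SF s) * g * co 2) * h2 + (algebraMap ℝ SF s * h * co 2) * h1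
  have h3 := cl_zero f
  rw [cl, dv, e0, e1, e2]
  simp only [map_add, Derivation.map_smul, Derivation.leibniz, map_sub, X_r2, smul_eq_mul, Lap]
  simp only [Algebra.smul_def]
  linear_combination h3

def VV (s : ℝ) (U : Fin 3 → SF) : Fin 3 → VF :=
  ![Vc s (U 0) (U 1) (U 2), Vc s (U 1) (U 2) (U 0), Vc s (U 2) (U 0) (U 1)]

def VN (s : ℝ) (U : Fin 3 → SF) : SF := n2 (VV s U 0) + n2 (VV s U 1) + n2 (VV s U 2)

def OnS (U : Fin 3 → SF) : Prop := ∀ x ∈ S2, ev x (U 0 ^ 2 + U 1 ^ 2 + U 2 ^ 2) = ev x 1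

lemma OnS.d1 {U : Fin 3 → SF} (h : OnS U) (i : Fin 3) {x : E3} (hx : x ∈ S2) :
    ev x (U 0) * ev x (X i (U 0)) + ev x (U 1) * ev x (X i (U 1)) + ev x (U 2) * ev x (X i (U 2)) = 0 := by
  have h' : ∀ x ∈ S2, ev x (U 0 * U 0 + U 1 * U 1 + U 2 * U 2) = ev x 1 := by
    intro y hy; simpa [sq] using h y hy
  have := X_congr h' i x hx
  simp at this
  linarith

lemma OnS.d2 {U : Fin 3 → SF} (h : OnS U) (i : Fin 3) {x : E3} (hx : x ∈ S2) :
    ev x (U 0) * ev x (X i (X i (U 0))) + ev x (U 1) * ev x (X i (X i (U 1))) + ev x (U 2) * ev x (X i (X i (U 2)))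
     = - (ev x (X i (U 0))^2 + ev x (X i (U 1))^2 + ev x (X i (U 2))^2) := by
  have h' : ∀ x ∈ S2, ev x (U 0 * U 0 + U 1 * U 1 + U 2 * U 2) = ev x 1 := by
    intro y hy; simpa [sq] using h y hy
  have := X_congr (X_congr h' i) i x hx
  simp at this
  linarith

lemma cross_par {a0 a1 a2 c0 c1 c2 u0 u1 u2 : ℝ} (ha : u0*a0+u1*a1+u2*a2 = 0) (hc : u0*c0+u1*c1+u2*c2=0)
    (hu : u0^2+u1^2+u2^2=1) :
    a1*c2-a2*c1 = u0 * (u0*(a1*c2-a2*c1)+u1*(a2*c0-a0*c2)+u2*(a0*c1-a1*c0)) := by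
  linear_combination (-(a1*c2-a2*c1)) * hu + (- u1 * a2 + u2 * a1) * hc + (u1 * c2 - u2 * c1) * ha

lemma cross_n2 {c0 c1 c2 u0 u1 u2 : ℝ} (hc : u0*c0+u1*c1+u2*c2=0) (hu : u0^2+u1^2+u2^2=1) :
    (u1*c2-u2*c1)^2+(u2*c0-u0*c2)^2+(u0*c1-u1*c0)^2 = c0^2+c1^2+c2^2 := by
  linear_combination (c0^2+c1^2+c2^2)*hu - (u0*c0+u1*c1+u2*c2) * hc

lemma OnS.rt {U : Fin 3 → SF} (h : OnS U) (i : Fin 3) {x : E3} (hx : x ∈ S2) :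
    ev x (U 0) * ev x (_root_.rt (Xf (U 0)) i) + ev x (U 1) * ev x (_root_.rt (Xf (U 1)) i) + ev x (U 2) * ev x (_root_.rt (Xf (U 2)) i) = 0 := by
  have h0 := h.d1 0 hx
  have h1 := h.d1 1 hx
  have h2 := h.d1 2 hx
  fin_cases i
  · simp only [Fin.zero_eta, rt0, Xf1, Xf2, map_sub, map_mul, ev_co]
    linear_combination x 1 * h2 - x 2 * h1
  · simp only [Fin.mk_one, rt1, Xf0, Xf2, map_sub, map_mul, ev_co]
    linear_combination x 2 * h0 - x 0 * h2
  · simp only [Fin.reduceFinMk, rt2, Xf1, Xf0, map_sub, map_mul, ev_co]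
    linear_combination x 0 * h1 - x 1 * h0

lemma rt_n2 (f : SF) {x : E3} (hx : x ∈ S2) :
    ev x (rt (Xf f) 0)^2 + ev x (rt (Xf f) 1)^2 + ev x (rt (Xf f) 2)^2 = ev x (g2 f) := by
  have hx' := mem_S2.1 hx
  have := dot_ev f x
  simp only [rt0, rt1, rt2, Xf0, Xf1, Xf2, map_sub, map_mul, ev_co, g2, map_add, map_pow]
  linear_combination (ev x (X 0 f)^2+ev x (X 1 f)^2+ev x (X 2 f)^2) * hx' - (x 0 * ev x (X 0 f) + x 1 * ev x (X 1 f) + x 2 * ev x (X 2 f)) * this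

lemma OnS.one {U : Fin 3 → SF} (h : OnS U) {x : E3} (hx : x ∈ S2) : ev x (U 0)^2 + ev x (U 1)^2 + ev x (U 2)^2 = 1 := by
  simpa using h x hx

lemma VN_eq {s : ℝ} (hs : s^2 = 1) {U : Fin 3 → SF} (h : OnS U) {x : E3} (hx : x ∈ S2) :
    ev x (VN s U) = 2 * ev x (AA U) - 4 * s * ev x (Jc U) := by
  have hu := h.one hx
  have key := fun i => cross_n2 (h.rt i hx) hu
  have k0 := key 0
  have k1 := key 1
  have k2 := key 2
  have n0 := rt_n2 (U 0) hx
  have n1 := rt_n2 (U 1) hx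
  have n2' := rt_n2 (U 2) hx
  have a0 : cr (U 2) (U 1) = - cr (U 1) (U 2) := cr_anti _ _
  have a1 : cr (U 0) (U 2) = - cr (U 2) (U 0) := cr_anti _ _
  have a2 : cr (U 1) (U 0) = - cr (U 0) (U 1) := cr_anti _ _
  have b0 := congrArg (ev x) a0
  have b1 := congrArg (ev x) a1
  have b2 := congrArg (ev x) a2
  simp only [cr, map_neg, map_add, map_mul] at b0 b1 b2
  simp only [VN, VV, Vc, n2, AA, Jc, cr, Xf0, Xf1, Xf2, Matrix.cons_val_zero, Matrix.cons_val_one, Matrix.cons_val, map_add, map_sub, map_mul, map_pow, map_smul, smul_eq_mul, map_neg]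
  simp only [g2, map_add, map_pow] at n0 n1 n2' ⊢
  linear_combination s^2 * (k0 + k1 + k2 + n0 + n1 + n2') + (ev x (X 0 (U 0))^2+ev x (X 1 (U 0))^2+ev x (X 2 (U 0))^2 + ev x (X 0 (U 1))^2+ev x (X 1 (U 1))^2+ev x (X 2 (U 1))^2 + ev x (X 0 (U 2))^2+ev x (X 1 (U 2))^2+ev x (X 2 (U 2))^2) * hs
    + 2 * s * (ev x (U 0) * b0 + ev x (U 1) * b1 + ev x (U 2) * b2)

lemma cr_par {U : Fin 3 → SF} (h : OnS U) {x : E3} (hx : x ∈ S2) :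
    ev x (cr (U 1) (U 2)) = ev x (Jc U) * ev x (U 0) ∧ ev x (cr (U 2) (U 0)) = ev x (Jc U) * ev x (U 1)
      ∧ ev x (cr (U 0) (U 1)) = ev x (Jc U) * ev x (U 2) := by
  have hu := h.one hx
  have hu1 : ev x (U 1)^2 + ev x (U 2)^2 + ev x (U 0)^2 = 1 := by linarith
  have hu2 : ev x (U 2)^2 + ev x (U 0)^2 + ev x (U 1)^2 = 1 := by linarith
  have a0 : cr (U 2) (U 1) = - cr (U 1) (U 2) := cr_anti _ _
  have a1 : cr (U 0) (U 2) = - cr (U 2) (U 0) := cr_anti _ _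
  have a2 : cr (U 1) (U 0) = - cr (U 0) (U 1) := cr_anti _ _
  have b0 := congrArg (ev x) a0
  have b1 := congrArg (ev x) a1
  have b2 := congrArg (ev x) a2
  simp only [cr, map_neg, map_add, map_mul] at b0 b1 b2
  have d := fun i => h.d1 i hx
  have e := fun i => h.rt i hx
  have d' : ∀ i, ev x (U 1) * ev x (X i (U 1)) + ev x (U 2) * ev x (X i (U 2)) + ev x (U 0) * ev x (X i (U 0)) = 0 := fun i => by linarith [d i]
  have d'' : ∀ i, ev x (U 2) * ev x (X i (U 2)) + ev x (U 0) * ev x (X i (U 0)) + ev x (U 1) * ev x (X i (U 1)) = 0 := fun i => by linarith [d i]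
  have e' : ∀ i, ev x (U 1) * ev x (_root_.rt (Xf (U 1)) i) + ev x (U 2) * ev x (_root_.rt (Xf (U 2)) i) + ev x (U 0) * ev x (_root_.rt (Xf (U 0)) i) = 0 := fun i => by linarith [e i]
  have e'' : ∀ i, ev x (U 2) * ev x (_root_.rt (Xf (U 2)) i) + ev x (U 0) * ev x (_root_.rt (Xf (U 0)) i) + ev x (U 1) * ev x (_root_.rt (Xf (U 1)) i) = 0 := fun i => by linarith [e i]
  have p := fun i => cross_par (d i) (e i) hu
  have p' := fun i => cross_par (d' i) (e' i) hu1
  have p'' := fun i => cross_par (d'' i) (e'' i) hu2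
  have p0 := p 0
  have p1 := p 1
  have p2 := p 2
  have q0 := p' 0
  have q1 := p' 1
  have q2 := p' 2
  have r0 := p'' 0
  have r1 := p'' 1
  have r2 := p'' 2
  simp only [Jc, cr, map_add, map_sub, map_mul, map_neg]
  clear p p' p'' d d' d'' e e' e'' a0 a1 a2
  refine ⟨?_, ?_, ?_⟩
  · linear_combination (-1/2) * (p0 + p1 + p2) + (1/2) * b0 - (1/2) * ev x (U 0) * (ev x (U 0) * b0 + ev x (U 1) * b1 + ev x (U 2) * b2)
  · linear_combination (-1/2) * (q0 + q1 + q2) + (1/2) * b1 - (1/2) * ev x (U 1) * (ev x (U 0) * b0 + ev x (U 1) * b1 + ev x (U 2) * b2)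
  · linear_combination (-1/2) * (r0 + r1 + r2) + (1/2) * b2 - (1/2) * ev x (U 2) * (ev x (U 0) * b0 + ev x (U 1) * b1 + ev x (U 2) * b2)

lemma dv_VV {s : ℝ} (hs : s^2 = 1) {U : Fin 3 → SF} (h : OnS U) {x : E3} (hx : x ∈ S2) (j : Fin 3) :
    ev x (dv (VV s U j)) = ev x (tau U j) - (1/2) * ev x (VN s U) * ev x (U j) := by
  obtain ⟨c0, c1, c2⟩ := cr_par h hx
  have hv := VN_eq hs h hx
  fin_cases j
  · simp [VV, dv_Vc, tau, c0, hv]; ring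
  · simp [VV, dv_Vc, tau, c1, hv]; ring
  · simp [VV, dv_Vc, tau, c2, hv]; ring

lemma ev_r2 {x : E3} (hx : x ∈ S2) : ev x r2 = 1 := by simpa [r2] using mem_S2.1 hx

lemma cl_VV (s : ℝ) (U : Fin 3 → SF) {x : E3} (hx : x ∈ S2) (j : Fin 3) :
    ev x (cl (VV s U j)) = s * (ev x (U (j+1)) * ev x (tau U (j+2)) - ev x (U (j+2)) * ev x (tau U (j+1))) := by
  have := ev_r2 hx
  fin_cases j
  · simp [VV, cl_Vc, tau, this]; ring_nf; simp
  · simp [VV, cl_Vc, tau, this]; ring_nf; simp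
  · simp [VV, cl_Vc, tau, this]; ring_nf; simp

lemma tang_VV (s : ℝ) (U : Fin 3 → SF) (j : Fin 3) : Tang (VV s U j) := by
  fin_cases j <;> exact tang_Vc _ _ _ _

def TT (s : ℝ) (U : Fin 3 → SF) : SF := T2 (VV s U 0) + T2 (VV s U 1) + T2 (VV s U 2)
def SS (U : Fin 3 → SF) : SF := tau U 0 ^ 2 + tau U 1 ^ 2 + tau U 2 ^ 2

lemma VN_sum (s : ℝ) (U : Fin 3 → SF) : VN s U = ∑ q : Fin 3 × Fin 3, VV s U q.1 q.2 ^ 2 := by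
  rw [Fintype.sum_prod_type]; simp [VN, n2, Fin.sum_univ_three]

lemma TT_sum (s : ℝ) (U : Fin 3 → SF) : TT s U = ∑ q : Fin 3 × Fin 3, g2 (VV s U q.1 q.2) := by
  rw [Fintype.sum_prod_type]; simp [TT, T2, Fin.sum_univ_three]

lemma VN_nonneg (s : ℝ) (U : Fin 3 → SF) (x : E3) : 0 ≤ ev x (VN s U) := by
  rw [VN_sum, map_sum]
  exact Finset.sum_nonneg (fun q _ => by rw [map_pow]; positivity)

lemma TT_nonneg (s : ℝ) (U : Fin 3 → SF) (x : E3) : 0 ≤ ev x (TT s U) := by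
  rw [TT_sum, map_sum]
  exact Finset.sum_nonneg (fun q _ => ev_g2_nonneg x _)

lemma SS_nonneg (U : Fin 3 → SF) (x : E3) : 0 ≤ ev x (SS U) := by
  simp only [SS, map_add, map_pow]; positivity

lemma XVN_sq (s : ℝ) (U : Fin 3 → SF) (x : E3) (i : Fin 3) :
    ev x (X i (VN s U)) ^ 2 ≤ 4 * ev x (VN s U) * ∑ q : Fin 3 × Fin 3, ev x (X i (VV s U q.1 q.2)) ^ 2 := by
  have e : ev x (X i (VN s U)) = 2 * ∑ q : Fin 3 × Fin 3, ev x (VV s U q.1 q.2) * ev x (X i (VV s U q.1 q.2)) := by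
    rw [VN_sum, map_sum, map_sum, Finset.mul_sum]
    refine Finset.sum_congr rfl (fun q _ => ?_)
    simp [sq]; ring
  have h := Finset.sum_mul_sq_le_sq_mul_sq Finset.univ (fun q : Fin 3 × Fin 3 => ev x (VV s U q.1 q.2)) (fun q => ev x (X i (VV s U q.1 q.2)))
  have e2 : ev x (VN s U) = ∑ q : Fin 3 × Fin 3, ev x (VV s U q.1 q.2) ^ 2 := by
    rw [VN_sum, map_sum]; simp
  rw [e, e2, mul_pow]
  linarith

lemma gv_VN (s : ℝ) (U : Fin 3 → SF) (x : E3) :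
    ‖gv x (VN s U)‖ ≤ 2 * (√(ev x (VN s U)) * √(ev x (TT s U))) := by
  have h0 := XVN_sq s U x 0
  have h1 := XVN_sq s U x 1
  have h2 := XVN_sq s U x 2
  have e : ev x (TT s U) = ∑ q : Fin 3 × Fin 3, ev x (X 0 (VV s U q.1 q.2)) ^ 2 + ∑ q : Fin 3 × Fin 3, ev x (X 1 (VV s U q.1 q.2)) ^ 2
      + ∑ q : Fin 3 × Fin 3, ev x (X 2 (VV s U q.1 q.2)) ^ 2 := by
    rw [TT_sum, map_sum, ← Finset.sum_add_distrib, ← Finset.sum_add_distrib]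
    simp [g2]
  have hN := VN_nonneg s U x
  have hT := TT_nonneg s U x
  apply abs_le_of_sq_le_sq' _ (by positivity) |>.2
  rw [gv_sq, mul_pow, mul_pow, Real.sq_sqrt hN, Real.sq_sqrt hT, e]
  simp only [g2, map_add, map_pow]
  linarith

lemma dvcl {s : ℝ} (hs : s^2 = 1) {U : Fin 3 → SF} (h : OnS U) {x : E3} (hx : x ∈ S2) :
    ev x (dv (VV s U 0) ^ 2 + cl (VV s U 0) ^ 2) + ev x (dv (VV s U 1) ^ 2 + cl (VV s U 1) ^ 2)
      + ev x (dv (VV s U 2) ^ 2 + cl (VV s U 2) ^ 2) ≤ 3 * ev x (SS U) + (1/2) * ev x (VN s U) ^ 2 := by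
  have hu := h.one hx
  have c0 := cl_VV s U hx 0
  have c1 := cl_VV s U hx 1
  have c2 := cl_VV s U hx 2
  simp only [Fin.isValue, zero_add, Fin.reduceAdd] at c0 c1 c2
  simp only [map_add, map_pow, dv_VV hs h hx, c0, c1, c2, SS]
  generalize ev x (U 0) = a at *
  generalize ev x (U 1) = b at *
  generalize ev x (U 2) = c at *
  generalize ev x (tau U 0) = p at *
  generalize ev x (tau U 1) = q at *
  generalize ev x (tau U 2) = r at *
  generalize ev x (VN s U) = n at *
  have e : (p + (1/2)*n*a)^2 + (q + (1/2)*n*b)^2 + (r + (1/2)*n*c)^2 + (a*p+b*q+c*r)^2 =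
     3 * (p^2+q^2+r^2) + 1/2*n^2 - ((p - (1/2)*n*a)^2 + (s * (b*r-c*q))^2 + ((q - (1/2)*n*b)^2 + (s * (c*p-a*r))^2) + ((r - (1/2)*n*c)^2 + (s * (a*q-b*p))^2)) := by
    linear_combination ((1/2)*n^2 + (p^2+q^2+r^2)) * hu + ((b*r-c*q)^2 + (c*p-a*r)^2+(a*q-b*p)^2) * hs
  have : 0 ≤ (p + (1/2)*n*a)^2 + (q + (1/2)*n*b)^2 + (r + (1/2)*n*c)^2 + (a*p+b*q+c*r)^2 := by positivity
  linarith

section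
variable {m : ℕ} {p : Fin m → E3} {t : Fin m → ℝ}

lemma G_bd (W : Wts m p t) {s : ℝ} (hs : s^2 = 1) {U : Fin 3 → SF} (h : OnS U) :
    I (bb p t * TT s U) ≤ 6 * I (bb p t * SS U) + I (bb p t * VN s U ^ 2) + 16 * I (VN s U) := by
  have hb2 : ∀ x ∈ S2, ev x (g2 (bb p t)) ≤ 2 * ev x (bb p t) := fun x hx => by
    have := g2_bb_le W hx; have := bb_pos W x; linarith
  have k := fun j => bochner_weight (fun x _ => bb_pos W x) hb2 (tang_VV s U j)
  have k0 := k 0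
  have k1 := k 1
  have k2 := k 2
  have e : I (bb p t * (dv (VV s U 0) ^ 2 + cl (VV s U 0) ^ 2) + bb p t * (dv (VV s U 1) ^ 2 + cl (VV s U 1) ^ 2)
      + bb p t * (dv (VV s U 2) ^ 2 + cl (VV s U 2) ^ 2)) ≤ I ((3:ℝ) • (bb p t * SS U) + (1/2:ℝ) • (bb p t * VN s U ^ 2)) := by
    apply I_mono
    intro x hx
    have := mul_le_mul_of_nonneg_left (dvcl hs h hx) (bb_pos W x).le
    simp only [map_add, map_mul, map_smul, smul_eq_mul, map_pow] at this ⊢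
    linarith
  simp only [map_add, map_smul, smul_eq_mul] at e
  rw [TT, mul_add, mul_add]
  simp only [map_add, VN] at *
  linarith

lemma sq_sSqrt {b : SF} (hb : ∀ x, 0 < ev x b) : sSqrt b ^ 2 = b := by
  apply SF.ext'; intro x
  rw [map_pow, ev_sSqrt hb, Real.sq_sqrt (hb x).le]

lemma J_bNT (W : Wts m p t) (s : ℝ) (U : Fin 3 → SF) :
    J (fun x => √(ev x (bb p t)) * (√(ev x (VN s U)) * √(ev x (TT s U)))) ≤ √(I (VN s U)) * √(I (bb p t * TT s U)) := by
  have h := J_cs_sqrt (f := fun x => √(ev x (VN s U))) (g := fun x => √(ev x (bb p t)) * √(ev x (TT s U)))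
    (A := I (VN s U)) (B := I (bb p t * TT s U))
    (Continuous.continuousOn (by fun_prop)) (Continuous.continuousOn (by fun_prop))
    (le_of_eq (J_congr (fun x _ => by simp only [Real.sq_sqrt (VN_nonneg s U x)]; rfl)))
    (le_of_eq (J_congr (fun x _ => by
      simp only [mul_pow, Real.sq_sqrt (TT_nonneg s U x), Real.sq_sqrt (bb_pos W x).le]; rfl)))
  refine le_trans (le_of_eq (J_congr (fun x _ => ?_))) h
  ring

lemma Y_bd (W : Wts m p t) (s : ℝ) (U : Fin 3 → SF) :
    cM * I (bb p t * VN s U ^ 2) ≤ 24 * (I (VN s U) * (I (VN s U) + I (bb p t * TT s U))) := by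
  set b := bb p t with hb
  set N := VN s U with hN
  have hbp : ∀ x, 0 < ev x b := bb_pos W
  have hb1 : ∀ x, √(ev x b) ≤ 1 := fun x => by
    exact Real.sqrt_le_iff.2 ⟨by norm_num, by simpa using bb_le W x⟩
  have hN0 : ∀ x, 0 ≤ ev x N := VN_nonneg s U
  have hT0 := TT_nonneg s U
  have hsob := sobolev (F := sSqrt b * N) (fun x hx => by
    rw [map_mul, ev_sSqrt hbp]; have := hN0 x; positivity)
  rw [mul_pow, sq_sSqrt hbp] at hsob
  have h1 : I (sSqrt b * N) ≤ I N := I_mono (fun x hx => by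
    rw [map_mul, ev_sSqrt hbp]
    have := mul_le_mul_of_nonneg_right (hb1 x) (hN0 x); linarith)
  have h10 : 0 ≤ I (sSqrt b * N) := I_nonneg (fun x hx => by
    rw [map_mul, ev_sSqrt hbp]; have := hN0 x; positivity)
  have h2 : J (fun x => ‖gv x (sSqrt b * N)‖) ≤ J (fun x => ev x N + 2 * (√(ev x b) * (√(ev x N) * √(ev x (TT s U))))) := by
    apply J_mono (Continuous.continuousOn (by fun_prop)) (Continuous.continuousOn (by fun_prop))
    intro x hx
    have a1 := gv_mul_le x (sSqrt b) N
    have a2 := gv_VN s U x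
    have a3 : ‖gv x (sSqrt b)‖ ≤ 1 := by
      rw [gv_sSqrt hbp, norm_smul]
      have := gv_bb_le W hx
      have hp := Real.sqrt_pos.2 (hbp x)
      rw [Real.norm_eq_abs, abs_of_pos (by positivity), one_div, inv_mul_le_iff₀ (by positivity)]
      linarith
    rw [ev_sSqrt hbp, abs_of_nonneg (Real.sqrt_nonneg _), abs_of_nonneg (hN0 x)] at a1
    have a4 := mul_le_mul_of_nonneg_left a2 (Real.sqrt_nonneg (ev x b))
    have a5 := mul_le_mul_of_nonneg_left a3 (hN0 x)
    linarith
  rw [J_add (Continuous.continuousOn (by fun_prop)) (Continuous.continuousOn (by fun_prop)), J_mul] at h2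
  have h3 := J_bNT W s U
  have h20 : 0 ≤ J (fun x => ‖gv x (sSqrt b * N)‖) := J_nonneg (fun x _ => norm_nonneg _)
  rw [← I_def] at h2
  have hd : 0 ≤ I N := I_nonneg (fun x _ => hN0 x)
  have hG : 0 ≤ I (b * TT s U) := I_nonneg (fun x _ => by rw [map_mul]; exact mul_nonneg (hbp x).le (hT0 x))
  have h4 : I (sSqrt b * N) + J (fun x => ‖gv x (sSqrt b * N)‖) ≤ 2 * I N + 2 * (√(I N) * √(I (b * TT s U))) := by linarith
  have h5 : (I (sSqrt b * N) + J (fun x => ‖gv x (sSqrt b * N)‖)) ^ 2 ≤ (2 * I N + 2 * (√(I N) * √(I (b * TT s U)))) ^ 2 := by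
    gcongr
  have e1 := Real.sq_sqrt hd
  have e2 := Real.sq_sqrt hG
  generalize √(I N) = α at *
  generalize √(I (b * TT s U)) = β at *
  have h6 : (2 * I N + 2 * (α * β)) ^ 2 ≤ 8 * (I N ^ 2 + I N * I (b * TT s U)) := by
    rw [← e2]
    have : I N * β^2 = (α*β)^2 := by rw [← e1]; ring
    rw [this]; nlinarith [sq_nonneg (I N - α * β)]
  linarith

end

section
variable {m : ℕ} {p : Fin m → E3} {t : Fin m → ℝ}

lemma YG_fin (hc : 0 < cM) (W : Wts m p t) {s : ℝ} (hs : s^2 = 1) {U : Fin 3 → SF} (h : OnS U)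
    (hsm : 48 * I (VN s U) ≤ cM) :
    cM * I (bb p t * VN s U ^ 2) ≤ 900 * (I (VN s U) * (I (VN s U) + I (bb p t * SS U))) ∧
    I (bb p t * TT s U) ≤ 36 * (I (VN s U) + I (bb p t * SS U)) := by
  have h1 := G_bd W hs h
  have h2 := Y_bd W s U
  have hd : 0 ≤ I (VN s U) := I_nonneg (fun x _ => VN_nonneg s U x)
  have hQ : 0 ≤ I (bb p t * SS U) := I_nonneg (fun x _ => by
    rw [map_mul]; exact mul_nonneg (bb_pos W x).le (SS_nonneg U x))
  have hY : 0 ≤ I (bb p t * VN s U ^ 2) := I_nonneg (fun x _ => by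
    rw [map_mul, map_pow]; have := (bb_pos W x); positivity)
  generalize I (VN s U) = δ at *
  generalize I (bb p t * SS U) = Q at *
  generalize I (bb p t * VN s U ^ 2) = Y at *
  generalize I (bb p t * TT s U) = G at *
  have h3 : cM * Y ≤ 24 * (δ * (δ + (6 * Q + Y + 16 * δ))) := by
    refine h2.trans ?_
    gcongr
  have h4 : 48 * δ * Y ≤ cM * Y := by gcongr
  have h5 : cM * Y ≤ 48 * (δ * (17 * δ + 6 * Q)) := by linarith
  have h6 : 0 ≤ δ * Q := mul_nonneg hd hQ
  refine ⟨by nlinarith, ?_⟩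
  have h7 : cM * Y ≤ cM * (17 * δ + 6 * Q) := by
    refine h5.trans ?_
    rw [← mul_assoc]; gcongr
  have h8 := le_of_mul_le_mul_left h7 hc
  linarith

lemma J_XpF (W : Wts m p t) (s : ℝ) (U : Fin 3 → SF) (i : Fin m) :
    J (fun x => |ev x (chi p t i * VN s U)| + |ev x (Xv (p i) (chi p t i * VN s U))|) ≤
      5 * I (VN s U) + 4 * (√(I (VN s U)) * √(I (bb p t * TT s U))) := by
  have h3 := J_bNT W s U
  have h2 : J (fun x => |ev x (chi p t i * VN s U)| + |ev x (Xv (p i) (chi p t i * VN s U))|) ≤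
     J (fun x => 5 * ev x (VN s U) + 4 * (√(ev x (bb p t)) * (√(ev x (VN s U)) * √(ev x (TT s U))))) := by
    apply J_mono (Continuous.continuousOn (by fun_prop)) (Continuous.continuousOn (by fun_prop))
    intro x hx
    have hN0 := VN_nonneg s U x
    have hc0 := (chi_pos W x i).le
    have hc1 := chi_le W x i
    have b1 : |ev x (chi p t i * VN s U)| ≤ ev x (VN s U) := by
      rw [map_mul, abs_of_nonneg (by positivity)]
      nlinarith
    have b2 : |ev x (Xv (p i) (chi p t i * VN s U))| ≤ √(ev x (qf (p i))) * ‖gv x (chi p t i * VN s U)‖ := by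
      have := Xp_sq_le (W.hp i) hx (chi p t i * VN s U)
      rw [← ev_qf (p i) hx, ← gv_sq] at this
      apply Real.abs_le_sqrt this |>.trans
      rw [Real.sqrt_mul (qf_nonneg (W.hp i) x), Real.sqrt_sq (norm_nonneg _)]
    have a1 := gv_mul_le x (chi p t i) (VN s U)
    rw [abs_of_nonneg hc0, abs_of_nonneg hN0] at a1
    have a2 := gv_VN s U x
    have a3 := q_chi W hx i
    have a4 := q_gv_chi W hx i
    have hq := Real.sqrt_nonneg (ev x (qf (p i)))
    have b3 : √(ev x (qf (p i))) * ‖gv x (chi p t i * VN s U)‖ ≤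
       (√(ev x (qf (p i))) * ev x (chi p t i)) * ‖gv x (VN s U)‖ + ev x (VN s U) * (√(ev x (qf (p i))) * ‖gv x (chi p t i)‖) := by
      have := mul_le_mul_of_nonneg_left a1 hq
      linarith
    have b4 : (√(ev x (qf (p i))) * ev x (chi p t i)) * ‖gv x (VN s U)‖ ≤ 2 * √(ev x (bb p t)) * (2 * (√(ev x (VN s U)) * √(ev x (TT s U)))) := by
      gcongr
    have b5 := mul_le_mul_of_nonneg_left a4 hN0
    linarith
  have e := J_add (f := fun x => 5 * ev x (VN s U)) (g := fun x => 4 * (√(ev x (bb p t)) * (√(ev x (VN s U)) * √(ev x (TT s U)))))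
    (Continuous.continuousOn (by fun_prop)) (Continuous.continuousOn (by fun_prop))
  rw [J_mul, J_mul, ← I_def] at e
  rw [e] at h2
  linarith

lemma err_b (hc : 0 < cM) (W : Wts m p t) (s : ℝ) (U : Fin 3 → SF) (i : Fin m) (g : SF) (hg : ∀ x ∈ S2, 0 ≤ ev x g) {L : ℝ}
    (hL : ∀ i, -Real.log (t i) ≤ L) :
    I (chi p t i * VN s U * (qf (p i) * Kf (p i) (t i) * g)) ≤ (30 * √(I 1) / cM) * √((1 + L) * H1 g) *
      (5 * I (VN s U) + 4 * (√(I (VN s U)) * √(I (bb p t * TT s U)))) := by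
  have h1 := hemi (W.hp i) (W.h0 i) (W.h1 i) (chi p t i * VN s U) g hg
  have h2 := J_XpF W s U i
  have hH := H1_nonneg g
  have h3 : √((1 + -Real.log (t i)) * I 1 * H1 g) ≤ √(I 1) * √((1 + L) * H1 g) := by
    rw [← Real.sqrt_mul I_one_nonneg]
    apply Real.sqrt_le_sqrt
    have a := mul_le_mul_of_nonneg_right (hL i) (mul_nonneg I_one_nonneg hH)
    linarith
  have h0 : 0 ≤ J (fun x => |ev x (chi p t i * VN s U)| + |ev x (Xv (p i) (chi p t i * VN s U))|) := J_nonneg (fun x _ => by positivity)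
  have h4 : cM * I (chi p t i * VN s U * (qf (p i) * Kf (p i) (t i) * g)) ≤ 30 * (√(I 1) * √((1 + L) * H1 g)) *
      (5 * I (VN s U) + 4 * (√(I (VN s U)) * √(I (bb p t * TT s U)))) := by
    refine h1.trans ?_
    gcongr
  rw [mul_comm, ← le_div_iff₀ hc] at h4
  refine h4.trans (le_of_eq ?_)
  ring

lemma err_c (W : Wts m p t) (s : ℝ) (U : Fin 3 → SF) (i : Fin m) (g : SF) (hg : ∀ x ∈ S2, 0 ≤ ev x g) {L : ℝ}
    (hL : ∀ i, -Real.log (t i) ≤ L) :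
    I (chi p t i * VN s U * ((t i ^ 2) • Kf (p i) (t i) * g)) ≤ 5 * √(I (bb p t * VN s U ^ 2)) * √((1 + L) * H1 g) := by
  have hH := H1_nonneg g
  have h0 := W.h0 i
  have h := J_cs_sqrt (f := fun x => √(ev x (bb p t)) * ev x (VN s U))
    (g := fun x => √(ev x (bb p t)) * (t i ^ 2 * ev x (Kf (p i) (t i)) * ev x (Bw (p i) (t i)) * ev x g))
    (A := I (bb p t * VN s U ^ 2)) (B := 25 * ((1 + L) * H1 g))
    (Continuous.continuousOn (by fun_prop)) (Continuous.continuousOn (by fun_prop))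
    (le_of_eq (J_congr (fun x _ => by
      simp only [mul_pow, Real.sq_sqrt (bb_pos W x).le]; rfl))) ?_
  · rw [Real.sqrt_mul (by norm_num) ((1 + L) * H1 g), show √(25:ℝ) = 5 by
      rw [show (25:ℝ) = 5^2 by norm_num]; exact Real.sqrt_sq (by norm_num)] at h
    refine le_trans (le_of_eq ?_) (h.trans (le_of_eq (by ring)))
    apply J_congr
    intro x hx
    have := Real.mul_self_sqrt (bb_pos W x).le
    rw [← ev_def]
    simp only [chi, map_mul, map_smul, smul_eq_mul]
    linear_combination (-(ev x (VN s U)) * t i ^ 2 * ev x (Kf (p i) (t i)) * ev x (Bw (p i) (t i)) * ev x g) * this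
  · have hk := I_K2' (W.hp i) (W.h0 i) (W.h1 i) g
    have : J (fun x => (√(ev x (bb p t)) * (t i ^ 2 * ev x (Kf (p i) (t i)) * ev x (Bw (p i) (t i)) * ev x g)) ^ 2) ≤
       I ((t i ^ 2) • (Kf (p i) (t i) ^ 2 * g ^ 2)) := by
      apply J_mono (Continuous.continuousOn (by fun_prop)) (SF.cont _).continuousOn
      intro x hx
      rw [← ev_def]
      rw [mul_pow, Real.sq_sqrt (bb_pos W x).le]
      simp only [map_smul, map_mul, map_pow, smul_eq_mul]
      have c1 := chi_le W x i
      rw [chi, map_mul] at c1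
      have hB := Bw_pos (W.hp i) (W.h0 i) (W.h1 i) x
      have c2 : t i ^ 2 * ev x (Bw (p i) (t i)) ≤ 1 := by
        have hD := (Dw_bd (W.hp i) (W.h0 i) (W.h1 i) hx).1
        have hDp := Dw_pos (p i) (W.h0 i) (W.h1 i) x
        rw [ev_Bw (W.hp i) (W.h0 i) (W.h1 i), ← mul_div_assoc, div_le_one hDp]
        linarith
      have hb := bb_pos W x
      have c3 : (ev x (bb p t) * ev x (Bw (p i) (t i))) * (t i ^ 2 * ev x (Bw (p i) (t i))) ≤ 1 * 1 := by gcongr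
      have c4 := mul_le_mul_of_nonneg_right c3 (show 0 ≤ t i ^ 2 * (ev x (Kf (p i) (t i)) ^ 2 * ev x g ^ 2) by positivity)
      linarith
    have a := mul_le_mul_of_nonneg_right (hL i) hH
    have b := log_t_pos (W.h0 i) (W.h1 i)
    nlinarith

lemma err_a (W : Wts m p t) (s : ℝ) (U : Fin 3 → SF) (g : SF) {L : ℝ} (hL : 0 ≤ L) :
    I (bb p t * VN s U * g) ≤ √(I (bb p t * VN s U ^ 2)) * √((1 + L) * H1 g) := by
  have h := J_cs_sqrt (f := fun x => √(ev x (bb p t)) * ev x (VN s U))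
    (g := fun x => √(ev x (bb p t)) * ev x g)
    (A := I (bb p t * VN s U ^ 2)) (B := (1 + L) * H1 g)
    (Continuous.continuousOn (by fun_prop)) (Continuous.continuousOn (by fun_prop))
    (le_of_eq (J_congr (fun x _ => by
      simp only [mul_pow, Real.sq_sqrt (bb_pos W x).le]; rfl))) ?_
  · refine le_trans (le_of_eq ?_) h
    apply J_congr
    intro x hx
    have := Real.mul_self_sqrt (bb_pos W x).le
    rw [← ev_def]
    simp only [map_mul]
    linear_combination (-(ev x (VN s U)) * ev x g) * this
  · have : J (fun x => (√(ev x (bb p t)) * ev x g) ^ 2) ≤ I (g ^ 2) := by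
      apply J_mono (Continuous.continuousOn (by fun_prop)) (SF.cont _).continuousOn
      intro x hx
      rw [← ev_def]
      rw [mul_pow, Real.sq_sqrt (bb_pos W x).le, map_pow]
      have := bb_le W x
      nlinarith [sq_nonneg (ev x g)]
    have a := I_g2_nonneg g
    have b := H1_nonneg g
    have c : I (g^2) ≤ H1 g := by rw [H1]; linarith
    nlinarith

lemma qK_one {q : E3} {t : ℝ} (hq : q ∈ S2) (h0 : 0 < t) : qf q * Kf q t + (t^2) • Kf q t = 1 := by
  apply SF.ext'; intro x
  have h := qf_nonneg hq x
  simp only [map_add, map_mul, map_smul, smul_eq_mul, map_one, ev_Kf hq h0]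
  have : 0 < ev x (qf q) + t^2 := by positivity
  field_simp

lemma err (hc : 0 < cM) (W : Wts m p t) {d : ℕ} (hm : m ≤ d) {s : ℝ} (hs : s^2 = 1) {U : Fin 3 → SF} (h : OnS U)
    (hsm : 48 * I (VN s U) ≤ cM) (g : SF) (hg : ∀ x ∈ S2, 0 ≤ ev x g) {L : ℝ}
    (hL0 : 0 ≤ L) (hL : ∀ i, -Real.log (t i) ≤ L) :
    I (VN s U * g) ≤ ((1 + 5 * d) * √(900 / cM) + d * (900 * √(I 1) / cM)) * (√(I (VN s U)) * √(I (VN s U) + I (bb p t * SS U)))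
       * √((1 + L) * H1 g) := by
  have e : VN s U * g = bb p t * VN s U * g + ∑ i, (chi p t i * VN s U * (qf (p i) * Kf (p i) (t i) * g)
      + chi p t i * VN s U * ((t i ^ 2) • Kf (p i) (t i) * g)) := by
    have e1 : ∀ i, chi p t i * VN s U * (qf (p i) * Kf (p i) (t i) * g)
      + chi p t i * VN s U * ((t i ^ 2) • Kf (p i) (t i) * g) = chi p t i * (VN s U * g) := by
      intro i
      have := qK_one (W.hp i) (W.h0 i)
      linear_combination (chi p t i * VN s U * g) * this
    simp only [e1]
    rw [← Finset.sum_mul]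
    have := chi_sum W
    linear_combination (-VN s U * g) * this
  obtain ⟨hY, hG⟩ := YG_fin hc W hs h hsm
  have hd : 0 ≤ I (VN s U) := I_nonneg (fun x _ => VN_nonneg s U x)
  have hQ : 0 ≤ I (bb p t * SS U) := I_nonneg (fun x _ => by
    rw [map_mul]; exact mul_nonneg (bb_pos W x).le (SS_nonneg U x))
  have ha := err_a W s U g hL0
  set Z := √(I (VN s U)) * √(I (VN s U) + I (bb p t * SS U)) with hZ
  set R := √((1 + L) * H1 g) with hR
  have hR0 : 0 ≤ R := Real.sqrt_nonneg _
  have hYs : √(I (bb p t * VN s U ^ 2)) ≤ √(900 / cM) * Z := by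
    rw [hZ, ← Real.sqrt_mul hd, ← Real.sqrt_mul (by positivity)]
    apply Real.sqrt_le_sqrt
    rw [div_mul_eq_mul_div, le_div_iff₀ hc]; linarith
  have hGs : √(I (bb p t * TT s U)) ≤ 6 * √(I (VN s U) + I (bb p t * SS U)) := by
    rw [show (6:ℝ) = √36 by rw [show (36:ℝ) = 6^2 by norm_num]; exact (Real.sqrt_sq (by norm_num)).symm, ← Real.sqrt_mul (by norm_num)]
    exact Real.sqrt_le_sqrt hG
  have hdZ : I (VN s U) ≤ Z := by
    rw [hZ]
    calc I (VN s U) = √(I (VN s U)) * √(I (VN s U)) := (Real.mul_self_sqrt hd).symm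
      _ ≤ _ := by gcongr; linarith
  have hE : 5 * I (VN s U) + 4 * (√(I (VN s U)) * √(I (bb p t * TT s U))) ≤ 30 * Z := by
    have : √(I (VN s U)) * √(I (bb p t * TT s U)) ≤ 6 * Z := by
      rw [hZ]
      calc _ ≤ √(I (VN s U)) * (6 * √(I (VN s U) + I (bb p t * SS U))) := by gcongr
        _ = _ := by ring
    linarith
  have hi : ∀ i, I (chi p t i * VN s U * (qf (p i) * Kf (p i) (t i) * g)
      + chi p t i * VN s U * ((t i ^ 2) • Kf (p i) (t i) * g)) ≤ (5 * √(900 / cM) + 900 * √(I 1) / cM) * Z * R := by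
    intro i
    have b := err_b hc W s U i g hg hL
    have c := err_c W s U i g hg hL
    rw [map_add]
    have b' : (30 * √(I 1) / cM) * R * (5 * I (VN s U) + 4 * (√(I (VN s U)) * √(I (bb p t * TT s U)))) ≤ (30 * √(I 1) / cM) * R * (30 * Z) := by
      gcongr
    have c' : 5 * √(I (bb p t * VN s U ^ 2)) * R ≤ 5 * (√(900 / cM) * Z) * R := by gcongr
    calc _ ≤ (30 * √(I 1) / cM) * R * (30 * Z) + 5 * (√(900 / cM) * Z) * R := add_le_add (b.trans b') (c.trans c')
      _ = _ := by ring
  rw [e, map_add, map_sum]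
  have hsum := Finset.sum_le_sum (fun i (_ : i ∈ Finset.univ) => hi i)
  rw [Finset.sum_const, Finset.card_univ, Fintype.card_fin, nsmul_eq_mul] at hsum
  have hZ0 : 0 ≤ Z := by rw [hZ]; positivity
  have hmd : (m:ℝ) * ((5 * √(900 / cM) + 900 * √(I 1) / cM) * Z * R) ≤ (d:ℝ) * ((5 * √(900 / cM) + 900 * √(I 1) / cM) * Z * R) := by
    have : (m:ℝ) ≤ d := by exact_mod_cast hm
    gcongr
  have ha' : √(I (bb p t * VN s U ^ 2)) * R ≤ √(900 / cM) * Z * R := by gcongr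
  calc _ ≤ √(900 / cM) * Z * R + (d:ℝ) * ((5 * √(900 / cM) + 900 * √(I 1) / cM) * Z * R) := add_le_add (ha.trans ha') (hsum.trans hmd)
    _ = _ := by ring

end

lemma cl_dv_bd {s : ℝ} (hs : s^2 = 1) {U : Fin 3 → SF} (h : OnS U) {x : E3} (hx : x ∈ S2) (j : Fin 3) :
    |ev x (cl (VV s U j))| ≤ √(ev x (SS U)) ∧ |ev x (tau U j)| ≤ √(ev x (SS U)) ∧ |ev x (U j)| ≤ 1 := by
  have hu := h.one hx
  have cj := cl_VV s U hx j
  have key : ∀ a b c p q r : ℝ, a^2+b^2+c^2 = 1 → (s * (b*r - c*q))^2 ≤ p^2+q^2+r^2 := by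
    intro a b c p q r e
    have : (s * (b*r - c*q))^2 = (b*r-c*q)^2 := by rw [mul_pow, hs, one_mul]
    rw [this]
    nlinarith [sq_nonneg (b*q+c*r), sq_nonneg (a*q), sq_nonneg (a*r), sq_nonneg p]
  have hS : ev x (SS U) = ev x (tau U 0)^2 + ev x (tau U 1)^2 + ev x (tau U 2)^2 := by
    simp only [SS, map_add, map_pow]
  refine ⟨Real.abs_le_sqrt ?_, Real.abs_le_sqrt ?_, ?_⟩
  · rw [cj, hS]
    fin_cases j
    · exact key (ev x (U 0)) _ _ _ _ _ hu
    · have := key (ev x (U 1)) (ev x (U 2)) (ev x (U 0)) (ev x (tau U 1)) (ev x (tau U 2)) (ev x (tau U 0)) (by linarith)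
      refine le_trans this (le_of_eq (by ring))
    · have := key (ev x (U 2)) (ev x (U 0)) (ev x (U 1)) (ev x (tau U 2)) (ev x (tau U 0)) (ev x (tau U 1)) (by linarith)
      refine le_trans this (le_of_eq (by ring))
  · rw [hS]
    fin_cases j <;> simp only [Fin.zero_eta, Fin.mk_one, Fin.reduceFinMk, Fin.isValue] <;>
      nlinarith [sq_nonneg (ev x (tau U 0)), sq_nonneg (ev x (tau U 1)), sq_nonneg (ev x (tau U 2))]
  · rw [← sq_le_one_iff_abs_le_one]
    fin_cases j <;> simp only [Fin.zero_eta, Fin.mk_one, Fin.reduceFinMk, Fin.isValue] <;>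
      nlinarith [sq_nonneg (ev x (U 0)), sq_nonneg (ev x (U 1)), sq_nonneg (ev x (U 2))]

/-- smooth approximation of the absolute value -/
lemma abs_approx (h : SF) {η : ℝ} (hη : 0 < η) :
    ∃ g : SF, (∀ x, |ev x h| ≤ ev x g) ∧ H1 g ≤ H1 h + η * I 1 := by
  have hf : ∀ x, 0 < ev x (h^2 + η • (1:SF)) := fun x => by
    simp only [map_add, map_pow, map_smul, map_one, smul_eq_mul]; positivity
  refine ⟨sSqrt (h^2 + η • (1:SF)), fun x => ?_, ?_⟩
  · rw [ev_sSqrt hf]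
    apply Real.abs_le_sqrt
    simp only [map_add, map_pow, map_smul, map_one, smul_eq_mul]; linarith
  · rw [H1, H1, sq_sSqrt hf]
    have : I (g2 (sSqrt (h^2 + η • (1:SF)))) ≤ I (g2 h) := by
      apply I_mono
      intro x hx
      rw [← gv_sq, ← gv_sq, gv_sSqrt hf]
      have hD := hf x
      have hh : ev x h ^ 2 ≤ ev x (h^2 + η • (1:SF)) := by
        simp only [map_add, map_pow, map_smul, map_one, smul_eq_mul]; linarith
      have e : gv x (h^2 + η • (1:SF)) = (2 * ev x h) • gv x h := by
        apply E3.ext3 <;> simp [gv, sq] <;> ring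
      rw [e, smul_smul, norm_smul, mul_pow]
      have : ‖1 / (2 * √(ev x (h^2 + η • (1:SF)))) * (2 * ev x h)‖ ^ 2 ≤ 1 := by
        rw [Real.norm_eq_abs, sq_abs, mul_pow, div_pow, mul_pow, mul_pow, Real.sq_sqrt hD.le]
        generalize ev x (h^2 + η • (1:SF)) = D at *
        rw [one_pow, div_mul_eq_mul_div, div_le_one (by positivity)]
        linarith
      have := mul_le_mul_of_nonneg_right this (sq_nonneg ‖gv x h‖)
      linarith
    simp only [map_add, map_smul, smul_eq_mul]
    linarith

section
variable {m : ℕ} {p : Fin m → E3} {t : Fin m → ℝ}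

def ww {m : ℕ} (p : Fin m → E3) (t : Fin m → ℝ) : SF := 1 + ∑ i, rho2 (p i) (t i)

lemma ev_ww (x : E3) : ev x (ww p t) = 1 + ∑ i, ev x (rho2 (p i) (t i)) := by simp [ww]

lemma ww_pos (W : Wts m p t) (x : E3) : 0 < ev x (ww p t) := by
  rw [ev_ww]
  have := Finset.sum_nonneg (fun i (_ : i ∈ Finset.univ) => rho2_nonneg (W.hp i) (W.h0 i) (W.h1 i) x)
  linarith

lemma ww_bd (W : Wts m p t) {d : ℕ} (hm : m ≤ d) {L : ℝ} (hL0 : 0 ≤ L) (hL : ∀ i, -Real.log (t i) ≤ L) (h : SF) :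
    I (ww p t * h^2) ≤ (1 + 10 * d) * (1 + L) * H1 h := by
  have a := I_g2_nonneg h
  have b := I_sq_nonneg' h
  have hi : ∀ i, I (rho2 (p i) (t i) * h^2) ≤ 10 * (1 + L) * H1 h := by
    intro i
    have := rho2_main (W.hp i) (W.h0 i) (W.h1 i) h
    have c := mul_le_mul_of_nonneg_right (hL i) a
    have d := mul_nonneg hL0 b
    rw [H1]; nlinarith
  have e : ww p t * h^2 = h^2 + ∑ i, rho2 (p i) (t i) * h^2 := by
    rw [ww, add_mul, one_mul, Finset.sum_mul]
  have hsum := Finset.sum_le_sum (fun i (_ : i ∈ Finset.univ) => hi i)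
  rw [Finset.sum_const, Finset.card_univ, Fintype.card_fin, nsmul_eq_mul] at hsum
  rw [e, map_add, map_sum]
  have hH := H1_nonneg h
  have h1 : I (h^2) ≤ (1 + L) * H1 h := by
    have := mul_nonneg hL0 hH
    have e : H1 h = I (h^2) + I (g2 h) := rfl
    linarith
  have hmd : (m:ℝ) * (10 * (1 + L) * H1 h) ≤ (d:ℝ) * (10 * (1 + L) * H1 h) := by
    have : (m:ℝ) ≤ d := by exact_mod_cast hm
    gcongr
  linarith

lemma pair_bd (W : Wts m p t) {d : ℕ} (hm : m ≤ d) {L : ℝ} (hL0 : 0 ≤ L) (hL : ∀ i, -Real.log (t i) ≤ L) (U : Fin 3 → SF)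
    (h k : SF) {A : ℝ} (hA : H1 h + H1 k ≤ A) :
    J (fun x => (|ev x k| + |ev x h|) * √(ev x (SS U))) ≤ √(2 * ((1 + 10 * d) * (1 + L) * A)) * √(I (sInv (ww p t) * SS U)) := by
  have hw := ww_pos W
  have H := J_cs_sqrt (f := fun x => √(ev x (ww p t)) * (|ev x k| + |ev x h|))
    (g := fun x => √(ev x (sInv (ww p t))) * √(ev x (SS U)))
    (A := 2 * ((1 + 10 * d) * (1 + L) * A)) (B := I (sInv (ww p t) * SS U))
    (Continuous.continuousOn (by fun_prop)) (Continuous.continuousOn (by fun_prop)) ?_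
    (le_of_eq (J_congr (fun x _ => by
      simp only [mul_pow, Real.sq_sqrt (sInv_pos hw x).le, Real.sq_sqrt (SS_nonneg U x)]; rfl)))
  · refine le_trans (le_of_eq ?_) H
    apply J_congr
    intro x hx
    have : √(ev x (ww p t)) * √(ev x (sInv (ww p t))) = 1 := by
      rw [ev_sInv hw, Real.sqrt_inv, mul_inv_cancel₀ (Real.sqrt_pos.2 (hw x)).ne']
    linear_combination (-(|ev x k| + |ev x h|) * √(ev x (SS U))) * this
  · have h1 := ww_bd W hm hL0 hL h
    have h2 := ww_bd W hm hL0 hL k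
    have h3 : J (fun x => (√(ev x (ww p t)) * (|ev x k| + |ev x h|)) ^ 2) ≤ I ((2:ℝ) • (ww p t * h^2) + (2:ℝ) • (ww p t * k^2)) := by
      apply J_mono (Continuous.continuousOn (by fun_prop)) (SF.cont _).continuousOn
      intro x hx
      rw [← ev_def, mul_pow, Real.sq_sqrt (hw x).le]
      simp only [map_add, map_smul, map_mul, map_pow, smul_eq_mul]
      have : (|ev x k| + |ev x h|)^2 ≤ 2 * ev x h ^2 + 2 * ev x k ^2 := by
        rw [← sq_abs (ev x h), ← sq_abs (ev x k)]
        nlinarith [sq_nonneg (|ev x k| - |ev x h|)]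
      have := mul_le_mul_of_nonneg_left this (hw x).le
      linarith
    simp only [map_add, map_smul, smul_eq_mul] at h3
    have h4 : (1 + 10 * d) * (1 + L) * (H1 h + H1 k) ≤ (1 + 10 * d) * (1 + L) * A := by gcongr
    linarith

lemma one_j (hc : 0 < cM) (W : Wts m p t) {d : ℕ} (hm : m ≤ d) {L : ℝ} (hL0 : 0 ≤ L) (hL : ∀ i, -Real.log (t i) ≤ L)
    {s : ℝ} (hs : s^2 = 1) {U : Fin 3 → SF} (h : OnS U)
    (hsm : 48 * I (VN s U) ≤ cM) (hpos : 0 < I (VN s U)) (j : Fin 3) {C1 : ℝ}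
    (hC1 : C1 = (1 + 5 * d) * √(900 / cM) + d * (900 * √(I 1) / cM)) :
    I (n2 (VV s U j)) ≤ 2 * (√(2 * ((1 + 10 * d) * (1 + L) * (11 * I (VN s U)))) * √(I (sInv (ww p t) * SS U))
      + (1/2) * (C1 * (√(I (VN s U)) * √(I (VN s U) + I (bb p t * SS U))) * √((1 + L) * (12 * I (VN s U))))) + I (VN s U) / 12 := by
  obtain ⟨f, k, a1, a2, a3, a4⟩ := hodge hc (tang_VV s U j) (η := I (VN s U) / 12) (by positivity)
  have hn : I (n2 (VV s U j)) ≤ I (VN s U) := by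
    apply I_mono
    intro x hx
    have q : ∀ j, 0 ≤ ev x (n2 (VV s U j)) := fun j => by
      simp only [n2, map_add, map_pow]; positivity
    have q0 := q 0
    have q1 := q 1
    have q2 := q 2
    simp only [VN, map_add]
    fin_cases j <;> simp only [Fin.zero_eta, Fin.mk_one, Fin.reduceFinMk, Fin.isValue] <;> linarith
  have hH : H1 f + H1 k ≤ 11 * I (VN s U) := by
    rw [H1, H1]; linarith
  have h1p := I_one_pos hc
  obtain ⟨g, g1, g3⟩ := abs_approx f (η := I (VN s U) / I 1) (by positivity)
  rw [div_mul_cancel₀ _ h1p.ne'] at g3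
  have hHk := H1_nonneg k
  have hHg : H1 g ≤ 12 * I (VN s U) := by linarith
  have hE := err hc W hm hs h hsm g (fun x _ => (abs_nonneg _).trans (g1 x)) hL0 hL
  rw [← hC1] at hE
  have hP := pair_bd W hm hL0 hL U f k hH
  have hC0 : 0 ≤ C1 := by rw [hC1]; positivity
  have hE' : I (VN s U * g) ≤ C1 * (√(I (VN s U)) * √(I (VN s U) + I (bb p t * SS U))) * √((1 + L) * (12 * I (VN s U))) := by
    refine hE.trans ?_
    gcongr
  have hM : I (k * cl (VV s U j)) - I (f * dv (VV s U j)) ≤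
      J (fun x => (|ev x k| + |ev x f|) * √(ev x (SS U))) + (1/2) * I (VN s U * g) := by
    rw [← map_sub, I_def (VN s U * g), ← J_mul]
    rw [← J_add (Continuous.continuousOn (by fun_prop)) (Continuous.continuousOn (by fun_prop)), I_def]
    apply J_mono (Continuous.continuousOn (by fun_prop)) (Continuous.continuousOn (by fun_prop))
    intro x hx
    obtain ⟨b1, b2, b3⟩ := cl_dv_bd hs h hx j
    have hN := VN_nonneg s U x
    simp only [map_sub, map_mul, dv_VV hs h hx j]
    have c1 : ev x k * ev x (cl (VV s U j)) ≤ |ev x k| * √(ev x (SS U)) := by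
      refine (le_abs_self _).trans ?_
      rw [abs_mul]; gcongr
    have c2 : -(ev x f * ev x (tau U j)) ≤ |ev x f| * √(ev x (SS U)) := by
      refine (neg_le_abs _).trans ?_
      rw [abs_mul]; gcongr
    have c3 : ev x f * ev x (U j) ≤ ev x g := by
      refine (le_abs_self _).trans ?_
      rw [abs_mul]
      calc |ev x f| * |ev x (U j)| ≤ |ev x f| * 1 := by gcongr
        _ ≤ ev x g := by rw [mul_one]; exact g1 x
    have c4 := mul_le_mul_of_nonneg_left c3 hN
    linarith
  linarith

lemma main_est (hc : 0 < cM) (W : Wts m p t) {d : ℕ} (hm : m ≤ d) {L : ℝ} (hL0 : 0 ≤ L) (hL : ∀ i, -Real.log (t i) ≤ L)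
    {s : ℝ} (hs : s^2 = 1) {U : Fin 3 → SF} (h : OnS U)
    (hsm : 48 * I (VN s U) ≤ cM) {C1 : ℝ}
    (hC1 : C1 = (1 + 5 * d) * √(900 / cM) + d * (900 * √(I 1) / cM))
    (hsm2 : 3 * C1 * √((1 + L) * (12 * I (VN s U))) ≤ 1 / 4) :
    I (VN s U) ≤ 3172 * (1 + 10 * d) * (1 + L) * I (sInv (ww p t) * SS U) := by
  have hw := ww_pos W
  have hQt : 0 ≤ I (sInv (ww p t) * SS U) := I_nonneg (fun x _ => by
    rw [map_mul]; exact mul_nonneg (sInv_pos hw x).le (SS_nonneg U x))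
  have hd : 0 ≤ I (VN s U) := I_nonneg (fun x _ => VN_nonneg s U x)
  rcases hd.eq_or_lt with hz | hpos
  · rw [← hz]; positivity
  have hQ0 : 0 ≤ I (bb p t * SS U) := I_nonneg (fun x _ => by
    rw [map_mul]; exact mul_nonneg (bb_pos W x).le (SS_nonneg U x))
  have hQ : I (bb p t * SS U) ≤ I (sInv (ww p t) * SS U) := I_mono (fun x hx => by
    rw [map_mul, map_mul, ev_sInv hw, ev_ww]
    exact mul_le_mul_of_nonneg_right (w_bb W hx) (SS_nonneg U x))
  have j0 := one_j hc W hm hL0 hL hs h hsm hpos 0 hC1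
  have j1 := one_j hc W hm hL0 hL hs h hsm hpos 1 hC1
  have j2 := one_j hc W hm hL0 hL hs h hsm hpos 2 hC1
  have e : I (VN s U) = I (n2 (VV s U 0)) + I (n2 (VV s U 1)) + I (n2 (VV s U 2)) := by
    rw [← map_add, ← map_add]; rfl
  have k1 : √(I (VN s U)) * √(I (VN s U) + I (bb p t * SS U)) ≤ I (VN s U) + I (bb p t * SS U) := by
    calc _ ≤ √(I (VN s U) + I (bb p t * SS U)) * √(I (VN s U) + I (bb p t * SS U)) := by gcongr; linarith
      _ = _ := Real.mul_self_sqrt (by positivity)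
  have k2 : 3 * (C1 * (√(I (VN s U)) * √(I (VN s U) + I (bb p t * SS U))) * √((1 + L) * (12 * I (VN s U)))) ≤
      1/4 * (I (VN s U) + I (bb p t * SS U)) := by
    calc _ = (3 * C1 * √((1 + L) * (12 * I (VN s U)))) * (√(I (VN s U)) * √(I (VN s U) + I (bb p t * SS U))) := by ring
      _ ≤ _ := by gcongr
  generalize I (VN s U) = δ at *
  generalize I (sInv (ww p t) * SS U) = T at *
  generalize I (bb p t * SS U) = Q at *
  have hD1 : (1:ℝ) ≤ (1 + 10 * d) * (1 + L) := by
    have : (0:ℝ) ≤ d := by positivity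
    nlinarith
  generalize hDD : (1 + 10 * (d:ℝ)) * (1 + L) = D at *
  have k3 : 6 * (√(2 * (D * (11 * δ))) * √T) ≤ 1/4 * δ + 792 * D * T := by
    have r1 : √(2 * (D * (11 * δ))) * √T = √δ * √(22 * D * T) := by
      rw [← Real.sqrt_mul (by positivity), ← Real.sqrt_mul hd]; congr 1; ring
    rw [r1]
    have e1 := Real.sq_sqrt hd
    have e2 := Real.sq_sqrt (show 0 ≤ 22 * D * T by positivity)
    nlinarith [sq_nonneg (√δ * (1/2) - 6 * √(22 * D * T))]
  have k4 : T ≤ D * T := by nlinarith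
  have : 3172 * (1 + 10 * (d:ℝ)) * (1 + L) * T = 3172 * (D * T) := by rw [← hDD]; ring
  rw [this]
  linarith

end

lemma sphVol_zero (hc : ¬ 0 < cM) : sphVol = 0 := by
  have h0 : cM = 0 := le_antisymm (not_lt.1 hc) cM_nonneg
  have h1 : I 1 = 0 := by
    rw [cM, div_eq_zero_iff] at h0
    rcases h0 with h | h
    · exact h
    · have := Real.pi_pos; linarith
  rw [I_def] at h1
  simp only [map_one, J, integral_const, smul_eq_mul, mul_one] at h1
  have hf : sphVol univ ≠ ⊤ := measure_ne_top _ _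
  rw [Measure.real, ENNReal.toReal_eq_zero_iff] at h1
  exact Measure.measure_univ_eq_zero.1 (h1.resolve_right hf)

lemma defect_rep {u : E3 → E3} {U : Fin 3 → SF} (hU : CRep u U) (h : OnS U) :
    ∃ s : ℝ, s^2 = 1 ∧ I (VN s U) = 4 * defect u := by
  have e1 : energy u = (1/2) * I (AA U) := by
    rw [energy, energyOn, sphVol_restrict, I_def]
    congr 1
    exact J_congr (fun x hx => hU.en hx)
  have e2 : ∫ x, jacobian u x ∂sphVol = I (Jc U) := J_congr (fun x hx => hU.jac hx)
  have e3 : 4 * π * |sphDeg u| = |I (Jc U)| := by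
    have := Real.pi_pos
    rw [sphDeg, e2, abs_mul, abs_of_pos (by positivity : 0 < (4 * π)⁻¹), ← mul_assoc, mul_inv_cancel₀ (by positivity), one_mul]
  have e4 : ∀ s : ℝ, s^2 = 1 → I (VN s U) = 2 * I (AA U) - 4 * s * I (Jc U) := by
    intro s hs
    have : I (VN s U) = I ((2:ℝ) • AA U - (4 * s) • Jc U) := I_congr (fun x hx => by
      rw [VN_eq hs h hx]; simp)
    rw [this]; simp
  rw [defect, e1, e3]
  rcases le_total 0 (I (Jc U)) with hj | hj
  · exact ⟨1, by norm_num, by rw [e4 1 (by norm_num), abs_of_nonneg hj]; ring⟩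
  · exact ⟨-1, by norm_num, by rw [e4 (-1) (by norm_num), abs_of_nonpos hj]; ring⟩

lemma one_le_prod {m : ℕ} (l : Fin m → ℝ) (hl : ∀ i, 0 ≤ l i) : 1 + ⨆ i, l i ≤ ∏ i, (1 + l i) := by
  have h1 : ∀ S : Finset (Fin m), 1 ≤ ∏ i ∈ S, (1 + l i) := fun S => by
    induction S using Finset.induction_on with
    | empty => simp
    | insert a S ha ih => rw [Finset.prod_insert ha]; have := hl a; nlinarith
  rcases isEmpty_or_nonempty (Fin m) with hE | hE
  · simp
  · have : ⨆ i, l i ≤ ∏ i, (1 + l i) - 1 := by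
      apply ciSup_le
      intro i
      rw [← Finset.mul_prod_erase _ _ (Finset.mem_univ i)]
      have := h1 (Finset.univ.erase i)
      have := hl i
      nlinarith
    linarith

/-- Proposition 2.1 / `prop:1`: Łojasiewicz estimate with respect to
weighted metrics `g = (1 + ∑ᵢ ρ_{pᵢ,rᵢ}²) g_{S²}`. -/
theorem statement4 (d : ℕ) :
    ∃ C ε : ℝ, 0 < C ∧ 0 < ε ∧
      ∀ (m : ℕ) (p : Fin m → E3) (r : Fin m → ℝ),
        m ≤ d → (∀ i, p i ∈ S2) → (∀ i, r i ∈ Set.Ioo 0 (π / 2)) →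
        ∀ u : E3 → E3, IsSphereMap u → |sphDeg u| ≤ d →
          defect u * (∏ i, (1 + |Real.log (r i)|)) ≤ ε →
          defect u ≤ C * (1 + ⨆ i, |Real.log (r i)|) *
            ∫ x, (1 + ∑ i, confSq (p i) (r i) x)⁻¹ * ‖tension u x‖ ^ 2 ∂sphVol := by
  by_cases hc : 0 < cM
  swap
  · refine ⟨1, 1, one_pos, one_pos, fun m p r _ _ _ u _ _ _ => ?_⟩
    simp [defect, energy, energyOn, sphDeg, sphVol_zero hc]
  obtain ⟨C1, hC1⟩ : ∃ C1 : ℝ, C1 = (1 + 5 * d) * √(900 / cM) + d * (900 * √(I 1) / cM) := ⟨_, rfl⟩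
  have hC0 : 0 ≤ C1 := by rw [hC1]; positivity
  have hq : 0 < 1 / (12 * (C1 + 1)) := by positivity
  refine ⟨2 * (3172 * (1 + 10 * d)), min (cM / 192) ((1 / (12 * (C1 + 1)))^2 / 96), by positivity,
    lt_min (by positivity) (by positivity), fun m p r hm hp hr u hu _ hε => ?_⟩
  obtain ⟨U, hU⟩ := rep_of_smooth hu.1
  have hO : OnS U := by
    intro x hx
    have h1 := norm_S2 (hu.2 x hx)
    have h2 := norm3 (u x)
    rw [h1, hU x hx, hU x hx, hU x hx] at h2
    simp only [map_add, map_pow, map_one]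
    linarith
  obtain ⟨s, hs, hN⟩ := defect_rep hU hO
  set t : Fin m → ℝ := fun i => Real.tan (r i / 2) with ht
  have W : Wts m p t := ⟨hp, fun i => (tan_half (hr i)).1, fun i => (tan_half (hr i)).2.1⟩
  set M := ⨆ i, |Real.log (r i)| with hM
  have hM0 : 0 ≤ M := Real.iSup_nonneg (fun i => abs_nonneg _)
  have hMi : ∀ i, |Real.log (r i)| ≤ M := fun i => le_ciSup (Set.finite_range (fun i => |Real.log (r i)|)).bddAbove i
  have hL : ∀ i, -Real.log (t i) ≤ 1 + M := fun i => (tan_half (hr i)).2.2.trans (by linarith [hMi i])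
  have hP := one_le_prod (fun i => |Real.log (r i)|) (fun i => abs_nonneg _)
  rw [← hM] at hP
  have hd : 0 ≤ I (VN s U) := I_nonneg (fun x _ => VN_nonneg s U x)
  have hd0 : 0 ≤ defect u := by linarith
  have hdM : defect u * (1 + M) ≤ min (cM / 192) ((1 / (12 * (C1 + 1)))^2 / 96) :=
    (mul_le_mul_of_nonneg_left hP hd0).trans hε
  have hd1 : defect u ≤ defect u * (1 + M) := by nlinarith
  have s1 := hdM.trans (min_le_left _ _)
  have s2 := hdM.trans (min_le_right _ _)
  have hsm : 48 * I (VN s U) ≤ cM := by linarith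
  have hsq : √((1 + (1 + M)) * (12 * I (VN s U))) ≤ 1 / (12 * (C1 + 1)) := by
    rw [Real.sqrt_le_left hq.le, hN]
    nlinarith
  have hsm2 : 3 * C1 * √((1 + (1 + M)) * (12 * I (VN s U))) ≤ 1 / 4 := by
    calc _ ≤ 3 * C1 * (1 / (12 * (C1 + 1))) := by gcongr
      _ ≤ 1 / 4 := by
        rw [mul_one_div, div_le_div_iff₀ (by positivity) (by norm_num)]; linarith
  have key := main_est hc W hm (by linarith) hL hs hO hsm hC1 hsm2
  have hI : ∫ x, (1 + ∑ i, confSq (p i) (r i) x)⁻¹ * ‖tension u x‖ ^ 2 ∂sphVol = I (sInv (ww p t) * SS U) := by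
    rw [I_def]
    apply J_congr
    intro x hx
    rw [map_mul, ev_sInv (ww_pos W), ev_ww, hU.tens hx]
    congr 3
    refine Finset.sum_congr rfl (fun i _ => ?_)
    exact confSq_eq (hp i) (W.h0 i) (W.h1 i) hx
  rw [hI]
  have hQt : 0 ≤ I (sInv (ww p t) * SS U) := I_nonneg (fun x _ => by
    rw [map_mul]; exact mul_nonneg (sInv_pos (ww_pos W) x).le (SS_nonneg U x))
  rw [hN] at key
  have a : 3172 * (1 + 10 * (d:ℝ)) * (1 + (1 + M)) * I (sInv (ww p t) * SS U) ≤
      3172 * (1 + 10 * (d:ℝ)) * (2 * (1 + M)) * I (sInv (ww p t) * SS U) := by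
    gcongr; linarith
  linarith
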